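/- arXiv:math/0508265 — 9 statements merged into one kernel-verified Lean document; each statement's English description precedes it below -/
import Mathlib

section
/- Let M = [m_{uv}] be an n×n symmetric matrix over ℝ[x] whose graph (vertices 1,…,n, with an edge uv for u ≠ v exactly when m_{uv} ≠ 0) is a tree T, and let P_{i_1−j_1}, …, P_{i_k−j_k} be pairwise vertex-disjoint paths in T, where P_{i_s−j_s} is the unique path in T from i_s to j_s. Then the determinant of the submatrix of M obtained by deleting rows j_1, …, j_k and columns i_1, …, i_k equals ± (∏_{s=1}^{k} wt(P_{i_s→j_s})) · det M[T ∖ (P_{i_1−j_1} ∪ ⋯ ∪ P_{i_k−j_k})], where wt(P_{i_s→j_s}) is the product of the entries m_{uv} over consecutive vertices u, v along the path from i_s to j_s, and M[H] denotes the principal submatrix of M on the vertices of the induced subgraph H. -/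
open Polynomial Matrix

/-- The graph of a square matrix `M`: vertices are the indices, with an edge `u v`
(for `u ≠ v`) exactly when the corresponding entry is nonzero.  (For a symmetric matrix
`M u v ≠ 0 ∨ M v u ≠ 0` is equivalent to `M u v ≠ 0`.) -/
def graphOf {V R : Type*} [Zero R] (M : Matrix V V R) : SimpleGraph V :=
  SimpleGraph.fromRel (fun u v => M u v ≠ 0)

/-- The weight of a walk in the graph of `M`: the product of the entries `M u v` over the
consecutive pairs of vertices (darts) along the walk. -/
def walkWeight {V R : Type*} [CommRing R] (M : Matrix V V R) {G : SimpleGraph V}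
    {u v : V} (w : G.Walk u v) : R :=
  (w.darts.map fun d => M d.toProd.1 d.toProd.2).prod

section helpers

variable {V : Type*} {G : SimpleGraph V}

lemma aux_reach_of_not_mem {u v a b : V} (p : G.Walk a b) (hu : u ∉ p.support) :
    (G.deleteEdges {s(u, v)}).Reachable a b :=
  ⟨p.toDeleteEdge s(u, v) (fun h => hu (p.fst_mem_support_of_mem_edges h))⟩

lemma aux_reach_dart {a b : V} (p : G.Walk a b) (hp : p.IsPath) (d : G.Dart) (hd : d ∈ p.darts) :
    (G.deleteEdges {s(d.fst, d.snd)}).Reachable a d.fst ∧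
    (G.deleteEdges {s(d.fst, d.snd)}).Reachable d.snd b := by
  induction p with
  | nil => simp at hd
  | @cons x y z h p ih =>
    rw [SimpleGraph.Walk.cons_isPath_iff] at hp
    rw [SimpleGraph.Walk.darts_cons, List.mem_cons] at hd
    rcases hd with rfl | hd
    · exact ⟨SimpleGraph.Reachable.refl _, aux_reach_of_not_mem p hp.2⟩
    · obtain ⟨h1, h2⟩ := ih hp.1 hd
      refine ⟨?_, h2⟩
      have hf := p.dart_fst_mem_support_of_mem_darts hd
      have hs := p.dart_snd_mem_support_of_mem_darts hd
      refine SimpleGraph.Reachable.trans (SimpleGraph.Adj.reachable ?_) h1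
      rw [SimpleGraph.deleteEdges_adj]
      refine ⟨h, ?_⟩
      simp only [Set.mem_singleton_iff, Sym2.eq_iff]
      rintro (⟨rfl, -⟩ | ⟨rfl, -⟩)
      · exact hp.2 hf
      · exact hp.2 hs

lemma aux_dart_snd_ne {a b : V} (p : G.Walk a b) (hp : p.IsPath) (d : G.Dart) (hd : d ∈ p.darts) :
    d.snd ≠ a := by
  have h1 : d.snd ∈ p.support.tail := by
    rw [← p.map_snd_darts]; exact List.mem_map_of_mem hd
  have h2 := hp.support_nodup
  rw [← p.cons_tail_support] at h2
  rintro rfl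
  exact (List.nodup_cons.1 h2).1 h1

lemma aux_dart_fst_ne {a b : V} (p : G.Walk a b) (hp : p.IsPath) (d : G.Dart) (hd : d ∈ p.darts) :
    d.fst ≠ b := by
  have := aux_dart_snd_ne p.reverse hp.reverse d.symm (by simpa using hd)
  simpa using this

lemma aux_dart_snd_inj {a b : V} (p : G.Walk a b) (hp : p.IsPath) (d d' : G.Dart)
    (hd : d ∈ p.darts) (hd' : d' ∈ p.darts) (h : d.snd = d'.snd) : d = d' := by
  have h2 := hp.support_nodup.tail
  rw [← p.map_snd_darts] at h2
  exact List.inj_on_of_nodup_map h2 hd hd' h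

lemma aux_fst_nodup {a b : V} (p : G.Walk a b) (hp : p.IsPath) :
    (p.darts.map (·.fst)).Nodup := by
  rw [p.map_fst_darts]
  exact hp.support_nodup.sublist (List.dropLast_sublist _)

lemma aux_dart_fst_inj {a b : V} (p : G.Walk a b) (hp : p.IsPath) (d d' : G.Dart)
    (hd : d ∈ p.darts) (hd' : d' ∈ p.darts) (h : d.fst = d'.fst) : d = d' :=
  List.inj_on_of_nodup_map (aux_fst_nodup p hp) hd hd' h

lemma aux_exists_dart {a b x : V} (p : G.Walk a b) (hx : x ∈ p.support) (hb : x ≠ b) :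
    ∃ d ∈ p.darts, d.fst = x := by
  rw [← p.map_fst_darts_append] at hx
  simpa [hb] using hx

variable [Fintype V] [DecidableEq V]

lemma aux_key (hG : G.IsAcyclic) {k : ℕ} (i j : Fin k → V)
    (w : ∀ s : Fin k, G.Walk (i s) (j s))
    (hpath : ∀ s, (w s).IsPath)
    (hi : Function.Injective i) (hj : Function.Injective j)
    (hdisj : ∀ s t : Fin k, s ≠ t → ∀ v, v ∈ (w s).support → v ∉ (w t).support)
    (σ : {v : V // v ∉ Finset.image j Finset.univ} ≃ {v : V // v ∉ Finset.image i Finset.univ})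
    (hσ : ∀ a, ((σ a : V) = a ∨ G.Adj a (σ a)))
    (s : Fin k) (d : G.Dart) (hd : d ∈ (w s).darts)
    (a : {v : V // v ∉ Finset.image j Finset.univ}) (ha : (a : V) = d.fst) :
    (σ a : V) = d.snd := by
  classical
  set H := G.deleteEdges {s(d.fst, d.snd)} with hH
  have hbr : ¬ H.Reachable d.fst d.snd :=
    SimpleGraph.isBridge_iff.1 (SimpleGraph.isAcyclic_iff_forall_adj_isBridge.1 hG d.adj)
  let f : V → ℤ := fun x => if H.Reachable d.fst x then 1 else 0
  have hf : ∀ x y, H.Reachable x y → f x = f y := by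
    intro x y h
    have : H.Reachable d.fst x ↔ H.Reachable d.fst y := ⟨fun h' => h'.trans h, fun h' => h'.trans h.symm⟩
    simp only [f, this]
  have split : ∀ g : Fin k → V, Function.Injective g →
      ∑ x, f x = (∑ t, f (g t)) + ∑ x : {v : V // v ∉ Finset.image g Finset.univ}, f x := by
    intro g hg
    rw [← Fintype.sum_subtype_add_sum_subtype (fun v => v ∈ Finset.image g Finset.univ) f]
    congr 1
    rw [← Finset.sum_subtype (Finset.image g Finset.univ) (fun x => Iff.rfl) f,
      Finset.sum_image (fun _ _ _ _ h => hg h)]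
  have h1 := split i hi
  rw [split j hj] at h1
  have h2 : ∑ x : {v : V // v ∉ Finset.image j Finset.univ}, f (σ x)
      = ∑ x : {v : V // v ∉ Finset.image i Finset.univ}, f x :=
    Equiv.sum_comp σ (fun x => f x)
  have h3 : ∑ t, (f (i t) - f (j t)) = 1 := by
    rw [Finset.sum_eq_single s]
    · obtain ⟨r1, r2⟩ := aux_reach_dart (w s) (hpath s) d hd
      rw [hf _ _ r1, ← hf _ _ r2]
      simp [f, hbr]
    · intro t _ hts
      rw [hf _ _ (aux_reach_of_not_mem (w t)
        (hdisj s t hts.symm _ ((w s).dart_fst_mem_support_of_mem_darts hd))), sub_self]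
    · simp
  have h4 : ∑ x : {v : V // v ∉ Finset.image j Finset.univ}, (f x - f (σ x)) = 1 := by
    rw [Finset.sum_sub_distrib] at h3 ⊢
    linarith
  obtain ⟨x, -, hx⟩ : ∃ x : {v : V // v ∉ Finset.image j Finset.univ},
      x ∈ Finset.univ ∧ 0 < f (x : V) - f (σ x) := by
    by_contra! hcon
    have := Finset.sum_nonpos hcon
    omega
  have hx1 : H.Reachable d.fst x := by
    by_contra hc
    simp only [f, if_neg hc] at hx
    split_ifs at hx <;> omega
  have hx2 : ¬ H.Reachable d.fst (σ x) := by
    intro hc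
    simp [f, hc, hx1] at hx
  rcases hσ x with h | h
  · rw [h] at hx2; exact absurd hx1 hx2
  · have : ¬ H.Adj x (σ x) := fun hc => hx2 (hx1.trans hc.reachable)
    rw [hH, SimpleGraph.deleteEdges_adj] at this
    have h5 : s((x : V), (σ x : V)) = s(d.fst, d.snd) := by
      by_contra hc; exact this ⟨h, hc⟩
    rw [Sym2.eq_iff] at h5
    rcases h5 with ⟨h6, h7⟩ | ⟨h6, h7⟩
    · have : a = x := Subtype.ext (ha.trans h6.symm)
      rw [this, h7]
    · rw [h6] at hx1; exact absurd hx1 hbr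

lemma aux_det {m R : Type*} [Fintype m] [DecidableEq m] [CommRing R] (B : Matrix m m R)
    (p : m → Prop) [DecidablePred p]
    (h : ∀ τ : Equiv.Perm m, (∀ a, B (τ a) a ≠ 0) → ∀ r, p r → τ r = r) :
    B.det = (∏ a : {a // p a}, B a a) * (toSquareBlockProp B fun a => ¬ p a).det := by
  classical
  let B' : Matrix m m R := fun a b => if p a ∧ b ≠ a then 0 else B a b
  have hB : B.det = B'.det := by
    rw [det_apply', det_apply']
    refine Finset.sum_congr rfl fun τ _ => ?_
    congr 1
    by_cases hτ : ∀ r, p r → τ r = r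
    · refine Finset.prod_congr rfl fun a _ => ?_
      have : ¬ (p (τ a) ∧ a ≠ τ a) := by
        rintro ⟨h1, h2⟩
        exact h2 (τ.injective (hτ _ h1)).symm
      simp only [B', if_neg this]
    · have h1 : ∃ a, B (τ a) a = 0 := by
        by_contra! hc; exact hτ (h τ hc)
      obtain ⟨a, ha⟩ := h1
      push Not at hτ
      obtain ⟨r, hr, hr'⟩ := hτ
      refine (Finset.prod_eq_zero (f := fun i => B (τ i) i) (Finset.mem_univ a) ha).trans
        (Finset.prod_eq_zero (f := fun i => B' (τ i) i) (Finset.mem_univ (τ.symm r)) ?_).symm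
      have : p (τ (τ.symm r)) ∧ τ.symm r ≠ τ (τ.symm r) := by
        rw [τ.apply_symm_apply]
        refine ⟨hr, fun hc => hr' ?_⟩
        conv_lhs => rw [← hc]
        simp
      simp only [B', if_pos this]
  rw [hB, twoBlockTriangular_det' B' p]
  · congr 1
    · have : toSquareBlockProp B' p = diagonal (fun a : {a // p a} => B a a) := by
        ext a b
        show (if p a ∧ (b : m) ≠ a then 0 else B a b) = _
        simp only [diagonal_apply]
        by_cases hab : a = b
        · simp [hab]
        · have : ¬ (b : m) = a := fun hc => hab (Subtype.ext hc.symm)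
          simp [hab, this, a.2]
      rw [this, det_diagonal]
    · congr 1
      ext a b
      have : ¬ (p a ∧ (b : m) ≠ a) := fun hc => a.2 hc.1
      show (if p a ∧ (b : m) ≠ a then 0 else B a b) = B a b
      rw [if_neg this]
  · intro a ha b hb
    have : b ≠ a := by rintro rfl; exact hb ha
    simp [B', ha, this]

end helpers

/-- Let `M` be an `n × n` symmetric matrix over `ℝ[x]` whose graph is a tree `T`, and let
`P_{i_s - j_s}` (`s = 1, …, k`) be pairwise vertex-disjoint paths in `T`.  Then, deleting
rows `j_1, …, j_k` and columns `i_1, …, i_k` (the remaining rows and columns being matched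
up by any bijection `e`), the determinant of the resulting submatrix equals
`± ∏_s wt(P_{i_s → j_s})` times the determinant of the principal submatrix of `M` on the
vertices not covered by the paths. -/
theorem det_submatrix_eq_weight_mul_det {n : ℕ} (M : Matrix (Fin n) (Fin n) (Polynomial ℝ))
    (hM : M.IsSymm) (hT : (graphOf M).IsTree)
    (k : ℕ) (i j : Fin k → Fin n)
    (w : ∀ s : Fin k, (graphOf M).Walk (i s) (j s))
    (hpath : ∀ s, (w s).IsPath)
    (hdisj : ∀ s t : Fin k, s ≠ t → ∀ v : Fin n,
      v ∈ (w s).support → v ∉ (w t).support)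
    (e : {v : Fin n // v ∉ Finset.image j Finset.univ} ≃
         {v : Fin n // v ∉ Finset.image i Finset.univ}) :
    ∃ ε : Polynomial ℝ, (ε = 1 ∨ ε = -1) ∧
      (M.submatrix
          (fun a : {v : Fin n // v ∉ Finset.image j Finset.univ} => (a : Fin n))
          (fun a : {v : Fin n // v ∉ Finset.image j Finset.univ} => ((e a : _) : Fin n))).det
        = ε * (∏ s : Fin k, walkWeight M (w s)) *
          (M.submatrix
            (fun a : {v : Fin n // v ∉ Finset.univ.biUnion
                (fun s : Fin k => (w s).support.toFinset)} => (a : Fin n))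
            (fun a : {v : Fin n // v ∉ Finset.univ.biUnion
                (fun s : Fin k => (w s).support.toFinset)} => (a : Fin n))).det := by
  classical
  have hst : ∀ s t v, v ∈ (w s).support → v ∈ (w t).support → s = t := by
    intro s t v h1 h2
    by_contra hc
    exact hdisj s t hc v h1 h2
  have hi : Function.Injective i := fun s t h =>
    hst s t (i s) (w s).start_mem_support (by rw [h]; exact (w t).start_mem_support)
  have hj : Function.Injective j := fun s t h =>
    hst s t (j s) (w s).end_mem_support (by rw [h]; exact (w t).end_mem_support)
  set U : Finset (Fin n) := Finset.univ.biUnion (fun s : Fin k => (w s).support.toFinset) with hU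
  have memU : ∀ v, v ∈ U ↔ ∃ s, v ∈ (w s).support := by intro v; simp [hU]
  have memJ : ∀ v, v ∉ Finset.image j Finset.univ ↔ ∀ s, j s ≠ v := by intro v; simp
  have memI : ∀ v, v ∉ Finset.image i Finset.univ ↔ ∀ s, i s ≠ v := by intro v; simp
  let D : Fin n → Fin n → Prop := fun a b =>
    ∃ s, ∃ d ∈ (w s).darts, d.fst = a ∧ d.snd = b
  have hnx : ∀ a, ∃ b, (∀ s, j s ≠ a) → (∀ s, i s ≠ b) ∧ (D a b ∨ (a = b ∧ a ∉ U)) := by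
    intro a
    by_cases haJ : ∀ s, j s ≠ a
    · by_cases haU : a ∈ U
      · obtain ⟨s, hs⟩ := (memU a).1 haU
        obtain ⟨d, hd, hda⟩ := aux_exists_dart (w s) hs (haJ s).symm
        refine ⟨d.snd, fun _ => ⟨?_, Or.inl ⟨s, d, hd, hda, rfl⟩⟩⟩
        intro t ht
        have := hst s t d.snd ((w s).dart_snd_mem_support_of_mem_darts hd)
          (ht ▸ (w t).start_mem_support)
        subst this
        exact aux_dart_snd_ne (w s) (hpath s) d hd ht.symm
      · refine ⟨a, fun _ => ⟨?_, Or.inr ⟨rfl, haU⟩⟩⟩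
        rintro t rfl
        exact haU ((memU _).2 ⟨t, (w t).start_mem_support⟩)
    · exact ⟨a, fun h => absurd h haJ⟩
  choose nx hnx using hnx
  -- following the darts
  have nx_dart : ∀ s, ∀ d ∈ (w s).darts, nx d.fst = d.snd ∧ d.fst ∉ Finset.image j Finset.univ := by
    intro s d hd
    have hfs := (w s).dart_fst_mem_support_of_mem_darts hd
    have h0 : ∀ t, j t ≠ d.fst := by
      intro t ht
      have := hst s t d.fst hfs (ht ▸ (w t).end_mem_support)
      subst this
      exact aux_dart_fst_ne (w s) (hpath s) d hd ht.symm
    refine ⟨?_, (memJ _).2 h0⟩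
    rcases (hnx _ h0).2 with ⟨t, d', hd', h1, h2⟩ | ⟨-, h⟩
    · have := hst s t d.fst hfs (h1 ▸ (w t).dart_fst_mem_support_of_mem_darts hd')
      subst this
      rw [← h2, aux_dart_fst_inj (w s) (hpath s) d' d hd' hd h1]
    · exact absurd ((memU _).2 ⟨s, hfs⟩) h
  let f0 : {v : Fin n // v ∉ Finset.image j Finset.univ} →
      {v : Fin n // v ∉ Finset.image i Finset.univ} :=
    fun a => ⟨nx a, (memI _).2 (hnx _ ((memJ _).1 a.2)).1⟩
  have f0inj : Function.Injective f0 := by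
    rintro ⟨a, ha⟩ ⟨b, hb⟩ hab
    have hab' : nx a = nx b := congrArg Subtype.val hab
    apply Subtype.ext
    show a = b
    rcases (hnx a ((memJ _).1 ha)).2 with ⟨s, d, hd, h1, h2⟩ | ⟨h1, h2⟩ <;>
    rcases (hnx b ((memJ _).1 hb)).2 with ⟨t, d', hd', h1', h2'⟩ | ⟨h1', h2'⟩
    · have hs := (w s).dart_snd_mem_support_of_mem_darts hd
      have hdd : d.snd = d'.snd := by rw [h2, h2', hab']
      have := hst s t d.snd hs (hdd ▸ (w t).dart_snd_mem_support_of_mem_darts hd')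
      subst this
      rw [← h1, ← h1', aux_dart_snd_inj (w s) (hpath s) d d' hd hd' hdd]
    · have hs := (w s).dart_snd_mem_support_of_mem_darts hd
      rw [h2, hab', ← h1'] at hs
      exact absurd ((memU _).2 ⟨s, hs⟩) h2'
    · have hs := (w t).dart_snd_mem_support_of_mem_darts hd'
      rw [h2', ← hab', ← h1] at hs
      exact absurd ((memU _).2 ⟨t, hs⟩) h2
    · rw [h1, h1', hab']
  let σ0 := Equiv.ofBijective f0
    ((Fintype.bijective_iff_injective_and_card f0).2 ⟨f0inj, Fintype.card_congr e⟩)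
  have σ0val : ∀ a, ((σ0 a : _) : Fin n) = nx a := fun a => rfl
  let B : Matrix {v : Fin n // v ∉ Finset.image j Finset.univ}
    {v : Fin n // v ∉ Finset.image j Finset.univ} (Polynomial ℝ) := fun a b => M a (nx b)
  have hdetB := aux_det B (fun a => (a : Fin n) ∈ U) (by
    intro τ hτ r hr
    obtain ⟨s, hs⟩ := (memU _).1 hr
    obtain ⟨d, hd, hda⟩ := aux_exists_dart (w s) hs ((memJ _).1 r.2 s).symm
    have key := aux_key hT.2 i j w hpath hi hj hdisj (τ.symm.trans σ0) (by
      intro a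
      have h1 := hτ (τ.symm a)
      rw [τ.apply_symm_apply] at h1
      have h2 : M a (((τ.symm.trans σ0) a : _) : Fin n) ≠ 0 := h1
      by_cases hc : (((τ.symm.trans σ0) a : _) : Fin n) = a
      · exact Or.inl hc
      · right
        rw [graphOf, SimpleGraph.fromRel_adj]
        exact ⟨fun h => hc h.symm, Or.inl h2⟩) s d hd r hda.symm
    have h3 : σ0 (τ.symm r) = σ0 r := by
      apply Subtype.ext
      have h4 : nx r = d.snd := by rw [← hda]; exact (nx_dart s d hd).1
      rw [σ0val r, h4]
      exact key
    have h5 := σ0.injective h3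
    conv_lhs => rw [← h5]
    simp)
  have hprod : (∏ a : {a : {v : Fin n // v ∉ Finset.image j Finset.univ} // (a : Fin n) ∈ U}, B a a)
      = ∏ s : Fin k, walkWeight M (w s) := by
    have e1 : ∀ s, walkWeight M (w s)
        = ∏ v ∈ ((w s).darts.map (·.fst)).toFinset, M v (nx v) := by
      intro s
      rw [List.prod_toFinset _ (aux_fst_nodup (w s) (hpath s)), List.map_map, walkWeight]
      congr 1
      refine List.map_congr_left fun d hd => ?_
      simp only [Function.comp]
      rw [(nx_dart s d hd).1]
    rw [Finset.prod_congr rfl (fun s _ => e1 s), ← Finset.prod_biUnion]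
    · refine Finset.prod_bij (fun a _ => ((a : {v : Fin n // v ∉ Finset.image j Finset.univ}) : Fin n)) ?_ ?_ ?_ ?_
      · rintro ⟨⟨a, ha⟩, ha'⟩ -
        obtain ⟨s, hs⟩ := (memU _).1 ha'
        obtain ⟨d, hd, hda⟩ := aux_exists_dart (w s) hs ((memJ _).1 ha s).symm
        rw [Finset.mem_biUnion]
        exact ⟨s, Finset.mem_univ _, by
          rw [List.mem_toFinset]; exact List.mem_map.2 ⟨d, hd, hda⟩⟩
      · intro a _ b _ h
        exact Subtype.ext (Subtype.ext h)
      · intro b hb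
        rw [Finset.mem_biUnion] at hb
        obtain ⟨s, -, hb⟩ := hb
        rw [List.mem_toFinset] at hb
        obtain ⟨d, hd, rfl⟩ := List.mem_map.1 hb
        exact ⟨⟨⟨d.fst, (nx_dart s d hd).2⟩,
          (memU _).2 ⟨s, (w s).dart_fst_mem_support_of_mem_darts hd⟩⟩, Finset.mem_univ _, rfl⟩
      · intro a _
        rfl
    · intro s _ t _ hst'
      rw [Function.onFun, Finset.disjoint_left]
      intro v hv hv'
      rw [List.mem_toFinset] at hv hv'
      obtain ⟨d, hd, rfl⟩ := List.mem_map.1 hv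
      obtain ⟨d', hd', h'⟩ := List.mem_map.1 hv'
      apply hst'
      refine hst s t _ ((w s).dart_fst_mem_support_of_mem_darts hd) ?_
      have := (w t).dart_fst_mem_support_of_mem_darts hd'
      rwa [h'] at this
  have hJU : ∀ v, v ∉ U → v ∉ Finset.image j Finset.univ := by
    intro v hv
    rw [memJ]
    rintro s rfl
    exact hv ((memU _).2 ⟨s, (w s).end_mem_support⟩)
  let E : {v : Fin n // v ∉ U} ≃
      {a : {v : Fin n // v ∉ Finset.image j Finset.univ} // ¬ (a : Fin n) ∈ U} :=
    { toFun := fun v => ⟨⟨v, hJU v v.2⟩, v.2⟩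
      invFun := fun a => ⟨a.1.1, a.2⟩
      left_inv := fun _ => rfl
      right_inv := fun _ => rfl }
  have hrest : (toSquareBlockProp B fun a => ¬ (a : Fin n) ∈ U).det
      = (M.submatrix (fun a : {v : Fin n // v ∉ U} => (a : Fin n))
          (fun a : {v : Fin n // v ∉ U} => (a : Fin n))).det := by
    rw [← det_submatrix_equiv_self E]
    congr 1
    ext1 a b
    have hb : nx b = b := by
      rcases (hnx b ((memJ _).1 (hJU b b.2))).2 with ⟨s, d, hd, h1, h2⟩ | ⟨h, -⟩
      · exact absurd ((memU _).2 ⟨s, h1 ▸ (w s).dart_fst_mem_support_of_mem_darts hd⟩) b.2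
      · exact h.symm
    show M a (nx b) = M a b
    rw [hb]
  have hN : (M.submatrix
          (fun a : {v : Fin n // v ∉ Finset.image j Finset.univ} => (a : Fin n))
          (fun a : {v : Fin n // v ∉ Finset.image j Finset.univ} => ((e a : _) : Fin n)))
      = B.submatrix id (e.trans σ0.symm) := by
    ext1 a b
    have : nx ((e.trans σ0.symm) b) = e b := by
      rw [← σ0val]; simp
    show M a (e b) = M a (nx ((e.trans σ0.symm) b))
    rw [this]
  refine ⟨((Equiv.Perm.sign (e.trans σ0.symm) : ℤ) : Polynomial ℝ), ?_, ?_⟩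
  · rcases Int.units_eq_one_or (Equiv.Perm.sign (e.trans σ0.symm)) with h | h <;> simp [h]
  · rw [hN, det_permute', hdetB, hprod, hrest, mul_assoc]
end

section
/- Let T be a tree on n vertices and A a real symmetric matrix with graph T. If some k pairwise vertex-disjoint paths of T cover n−t vertices of T, then at most t distinct eigenvalues of A have algebraic multiplicity k+1 or more. -/
open Polynomial Matrix

theorem aux_eig {n k : ℕ} (A : Matrix (Fin n) (Fin n) ℝ) (hA : A.IsSymm) (i : Fin k → Fin n)
    (lam : ℝ) (h : k + 1 ≤ A.charpoly.rootMultiplicity lam) :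
    ∃ x : Fin n → ℝ, x ≠ 0 ∧ A *ᵥ x = lam • x ∧ ∀ s, x (i s) = 0 := by
  have hH : A.IsHermitian := by
    rw [Matrix.IsHermitian, Matrix.conjTranspose_eq_transpose_of_trivial]; exact hA
  have hS := isSymmetric_toEuclideanLin_iff.mpr hH
  set T := toEuclideanLin A with hTdef
  have hc : T.charpoly = A.charpoly := by
    rw [hTdef, toEuclideanLin_eq_toLin_orthonormal]
    exact Matrix.charpoly_toLin _ _
  have h1 := LinearMap.finrank_maxGenEigenspace_eq T lam
  rw [(LinearMap.IsSymmetric.isFinitelySemisimple hS).maxGenEigenspace_eq_eigenspace, hc] at h1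
  let F : Module.End.eigenspace T lam →ₗ[ℝ] (Fin k → ℝ) :=
    { toFun := fun x s => x.1 (i s)
      map_add' := by intros; rfl
      map_smul' := by intros; rfl }
  have h2 : F.ker ≠ ⊥ := LinearMap.ker_ne_bot_of_finrank_lt (by rw [h1, Module.finrank_fin_fun]; omega)
  obtain ⟨x, hx, hx0⟩ := Submodule.exists_mem_ne_zero_of_ne_bot h2
  refine ⟨x.1.ofLp, ?_, ?_, ?_⟩
  · intro h0
    apply hx0
    ext r
    exact congrFun h0 r
  · have := Module.End.mem_eigenspace_iff.1 x.2
    have := congrArg WithLp.ofLp this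
    simpa [hTdef] using this
  · intro s
    exact congrFun (LinearMap.mem_ker.1 hx) s

theorem aux_inj {V : Type*} {G : SimpleGraph V} {k : ℕ} {i j : Fin k → V}
    (w : ∀ s : Fin k, G.Walk (i s) (j s)) (hpath : ∀ s, (w s).IsPath)
    (hdisj : ∀ s t : Fin k, s ≠ t → ∀ v, v ∈ (w s).support → v ∉ (w t).support)
    {s s' : Fin k} {m m' : ℕ} (hm : m ≤ (w s).length) (hm' : m' ≤ (w s').length)
    (h : (w s).getVert m = (w s').getVert m') : s = s' ∧ m = m' := by
  have hs : s = s' := by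
    by_contra hne
    exact hdisj s s' hne _ ((w s).getVert_mem_support m) (h ▸ (w s').getVert_mem_support m')
  subst hs
  exact ⟨rfl, (hpath s).getVert_injOn hm hm' h⟩

theorem aux_comb {V : Type*} [Fintype V] {G : SimpleGraph V} (hG : G.IsAcyclic)
    {k : ℕ} {i j : Fin k → V}
    (w : ∀ s : Fin k, G.Walk (i s) (j s)) (hpath : ∀ s, (w s).IsPath)
    (hdisj : ∀ s t : Fin k, s ≠ t → ∀ v, v ∈ (w s).support → v ∉ (w t).support)
    (σ : Equiv.Perm V) (hσj : ∀ s, σ (j s) = i s)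
    (hσ : ∀ r, (∀ s, r ≠ j s) → σ r = r ∨ G.Adj r (σ r))
    (s₀ : Fin k) (m₀ : ℕ) (hm₀ : m₀ < (w s₀).length) :
    σ ((w s₀).getVert m₀) = (w s₀).getVert (m₀ + 1) := by
  classical
  have inj := fun {s s' : Fin k} {m m' : ℕ} => aux_inj w hpath hdisj (s := s) (s' := s') (m := m) (m' := m')
  set a := (w s₀).getVert m₀ with ha
  set b := (w s₀).getVert (m₀ + 1) with hb
  by_contra hne
  have hab : G.Adj a b := (w s₀).adj_getVert_succ hm₀
  have hbr := SimpleGraph.isBridge_iff.1 (SimpleGraph.isAcyclic_iff_forall_adj_isBridge.1 hG hab)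
  set H := G.deleteEdges {s(a, b)} with hH
  let f : V → ℤ := fun v => if H.Reachable a v then 1 else 0
  have fa : f a = 1 := by simp [f]
  have fb : f b = 0 := by simp [f, hbr]
  have fadj : ∀ u v, G.Adj u v → s(u, v) ≠ s(a, b) → f u = f v := by
    intro u v huv hn
    have h1 : H.Adj u v := by
      rw [hH, SimpleGraph.deleteEdges_adj]; exact ⟨huv, by simpa using hn⟩
    have : H.Reachable a u ↔ H.Reachable a v :=
      ⟨fun h => h.trans h1.reachable, fun h => h.trans h1.symm.reachable⟩
    simp [f, this]
  have fstep : ∀ s m, m < (w s).length → (s = s₀ → m ≠ m₀) →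
      f ((w s).getVert m) = f ((w s).getVert (m + 1)) := by
    intro s m hm hsm
    refine fadj _ _ ((w s).adj_getVert_succ hm) ?_
    intro he
    rw [Sym2.eq_iff] at he
    rcases he with ⟨h1, h2⟩ | ⟨h1, h2⟩
    · obtain ⟨e1, e2⟩ := inj hm.le hm₀.le h1
      exact hsm e1 e2
    · obtain ⟨e1, e2⟩ := inj hm.le hm₀ h1
      obtain ⟨e3, e4⟩ := inj hm hm₀.le h2
      omega
  have f1 : ∀ s, s ≠ s₀ → f (i s) = f (j s) := by
    intro s hs
    have : ∀ m, m ≤ (w s).length → f (i s) = f ((w s).getVert m) := by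
      intro m
      induction m with
      | zero => intro _; simp
      | succ m ih =>
        intro h
        rw [ih (by omega)]
        exact fstep s m (by omega) (fun h => absurd h hs)
    simpa using this _ le_rfl
  have f2 : f (i s₀) = 1 := by
    have : ∀ m, m ≤ m₀ → f (i s₀) = f ((w s₀).getVert m) := by
      intro m
      induction m with
      | zero => intro _; simp
      | succ m ih =>
        intro h
        rw [ih (by omega)]
        exact fstep s₀ m (by omega) (fun _ => by omega)
    rw [this m₀ le_rfl, ← ha, fa]
  have f3 : f (j s₀) = 0 := by
    have : ∀ m, m₀ + 1 + m ≤ (w s₀).length → f b = f ((w s₀).getVert (m₀ + 1 + m)) := by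
      intro m
      induction m with
      | zero => intro _; rfl
      | succ m ih =>
        intro h
        rw [ih (by omega)]
        exact fstep s₀ (m₀ + 1 + m) (by omega) (fun _ => by omega)
    have h := this ((w s₀).length - (m₀ + 1)) (by omega)
    rw [Nat.add_sub_cancel' hm₀, SimpleGraph.Walk.getVert_length, fb] at h
    exact h.symm
  have hsum : ∑ r, (f (σ r) - f r) = 0 := by
    rw [Finset.sum_sub_distrib, Equiv.sum_comp σ f, sub_self]
  have hnn : ∀ r, 0 ≤ f (σ r) - f r := by
    intro r
    by_cases hr : ∃ s, r = j s
    · obtain ⟨s, rfl⟩ := hr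
      rw [hσj]
      by_cases hs : s = s₀
      · subst hs; rw [f2, f3]; norm_num
      · rw [f1 s hs]; simp
    · push Not at hr
      rcases hσ r hr with h | h
      · simp [h]
      · by_cases he : s(r, σ r) = s(a, b)
        · rw [Sym2.eq_iff] at he
          rcases he with ⟨h1, h2⟩ | ⟨h1, h2⟩
          · exact absurd (h1 ▸ h2) hne
          · rw [h2, h1, fa, fb]; norm_num
        · rw [fadj _ _ h he]; simp
  have hpos : 0 < ∑ r, (f (σ r) - f r) :=
    Finset.sum_pos' (fun r _ => hnn r) ⟨j s₀, Finset.mem_univ _, by rw [hσj, f2, f3]; norm_num⟩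
  omega

theorem aux_main {n : ℕ} (A : Matrix (Fin n) (Fin n) ℝ)
    (hA : A.IsSymm) (hT : (graphOf A).IsAcyclic)
    (k : ℕ) (i j : Fin k → Fin n)
    (w : ∀ s : Fin k, (graphOf A).Walk (i s) (j s))
    (hpath : ∀ s, (w s).IsPath)
    (hdisj : ∀ s t : Fin k, s ≠ t → ∀ v : Fin n,
      v ∈ (w s).support → v ∉ (w t).support)
    (lam : ℝ) (h : k + 1 ≤ A.charpoly.rootMultiplicity lam)
    (Q : Finset (Fin n)) (hQ : ∀ v, v ∉ Q ↔ ∃ s, v ∈ (w s).support) :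
    (A.submatrix (fun q : Q => q.1) (fun q : Q => q.1)).charpoly.IsRoot lam := by
  classical
  have inj := fun {s s' : Fin k} {m m' : ℕ} => aux_inj w hpath hdisj (s := s) (s' := s') (m := m) (m' := m')
  have hadj : ∀ u v, (graphOf A).Adj u v ↔ u ≠ v ∧ A u v ≠ 0 := by
    intro u v
    have : A v u = A u v := hA.apply u v
    simp [graphOf, SimpleGraph.fromRel_adj, this]
  obtain ⟨x, hx0, hx, hxi⟩ := aux_eig A hA i lam h
  have jinj : ∀ s s', j s = j s' → s = s' := by
    intro s s' h
    refine (inj (s := s) (s' := s') (m := (w s).length) (m' := (w s').length) le_rfl le_rfl ?_).1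
    simpa using h
  let B : Matrix (Fin n) (Fin n) ℝ := scalar (Fin n) lam - A
  have hBx : B *ᵥ x = 0 := by
    simp [B, Matrix.sub_mulVec, hx]
  let C : Matrix (Fin n) (Fin n) ℝ := fun r c =>
    if ∃ s, r = j s then (if ∃ s, r = j s ∧ c = i s then 1 else 0) else B r c
  have hC1 : ∀ s c, C (j s) c = if c = i s then 1 else 0 := by
    intro s c
    have : (∃ s', j s = j s' ∧ c = i s') ↔ c = i s := by
      constructor
      · rintro ⟨s', h1, h2⟩
        rw [jinj _ _ h1]; exact h2
      · intro h; exact ⟨s, rfl, h⟩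
    simp only [C, this]
    rw [if_pos ⟨s, rfl⟩]
  have hC2 : ∀ r, (∀ s, r ≠ j s) → C r = B r := by
    intro r hr
    funext c
    simp only [C]
    rw [if_neg (by push Not; exact hr)]
  have hCx : C *ᵥ x = 0 := by
    funext r
    by_cases hr : ∃ s, r = j s
    · obtain ⟨s, rfl⟩ := hr
      simp [Matrix.mulVec, dotProduct, hC1, hxi]
    · push Not at hr
      have := congrFun hBx r
      simpa [Matrix.mulVec, hC2 r hr] using this
  have hdetC : C.det = 0 := Matrix.exists_mulVec_eq_zero_iff.1 ⟨x, hx0, hCx⟩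
  -- successor relation
  let N : Fin n → Fin n → Prop := fun r c => ∃ s m, m ≤ (w s).length ∧ r = (w s).getVert m ∧
    c = if m < (w s).length then (w s).getVert (m + 1) else i s
  have hNu : ∀ r c c', N r c → N r c' → c = c' := by
    rintro r c c' ⟨s, m, hm, h1, h2⟩ ⟨s', m', hm', h1', h2'⟩
    obtain ⟨e1, e2⟩ := inj hm hm' (h1.symm.trans h1')
    subst e1; subst e2
    rw [h2, h2']
  have hNC : ∀ r c, N r c → C r c ≠ 0 := by
    rintro r c ⟨s, m, hm, h1, h2⟩
    by_cases hlt : m < (w s).length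
    · rw [if_pos hlt] at h2
      have had := (w s).adj_getVert_succ hlt
      rw [← h1, ← h2, hadj] at had
      have hr : ∀ s', r ≠ j s' := by
        intro s' h
        have := inj (s := s) (s' := s') (m := m) (m' := (w s').length) hm le_rfl (by rw [← h1, h]; simp)
        obtain ⟨e1, e2⟩ := this
        subst e1
        omega
      rw [hC2 r hr]
      simp [B, had.1, had.2]
    · rw [if_neg hlt] at h2
      have : m = (w s).length := by omega
      subst this
      rw [SimpleGraph.Walk.getVert_length] at h1
      rw [h1, hC1, h2]; simp
  have hNs : ∀ c, c ∉ Q → ∃ r, r ∉ Q ∧ N r c := by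
    intro c hc
    obtain ⟨s, hs⟩ := (hQ c).1 hc
    obtain ⟨m, hm, hml⟩ := SimpleGraph.Walk.mem_support_iff_exists_getVert.1 hs
    cases m with
    | zero =>
      refine ⟨j s, (hQ _).2 ⟨s, by simp⟩, s, (w s).length, le_rfl, by simp, ?_⟩
      simp at hm
      simp [hm]
    | succ m =>
      refine ⟨(w s).getVert m, (hQ _).2 ⟨s, (w s).getVert_mem_support m⟩, s, m, by omega, rfl, ?_⟩
      rw [if_pos (by omega), hm]
  let C' : Matrix (Fin n) (Fin n) ℝ := fun r c => if r ∉ Q ∧ ¬ N r c then 0 else C r c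
  have hdet : C'.det = 0 := by
    rw [← hdetC, ← Matrix.det_transpose C', ← Matrix.det_transpose C, Matrix.det_apply, Matrix.det_apply]
    refine Finset.sum_congr rfl fun σ _ => ?_
    congr 1
    simp only [Matrix.transpose_apply]
    by_cases hz : ∏ r, C r (σ r) = 0
    · rw [hz]
      obtain ⟨r, _, hr⟩ := Finset.prod_eq_zero_iff.1 hz
      refine Finset.prod_eq_zero (Finset.mem_univ r) ?_
      simp [C', hr]
    · refine Finset.prod_congr rfl fun r _ => ?_
      have hnz : ∀ r, C r (σ r) ≠ 0 := fun r => Finset.prod_ne_zero_iff.1 hz r (Finset.mem_univ r)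
      have hσj : ∀ s, σ (j s) = i s := by
        intro s
        have := hnz (j s)
        rw [hC1] at this
        by_contra hh
        simp [hh] at this
      have hσ : ∀ r, (∀ s, r ≠ j s) → σ r = r ∨ (graphOf A).Adj r (σ r) := by
        intro r hr
        have h1 := hnz r
        rw [hC2 r hr] at h1
        by_cases he : σ r = r
        · exact Or.inl he
        · refine Or.inr ((hadj _ _).2 ⟨fun h => he h.symm, fun h0 => h1 ?_⟩)
          simp [B, h0, Ne.symm he]
      simp only [C']
      rw [if_neg]
      rintro ⟨hr, hN⟩
      apply hN
      obtain ⟨s, hs⟩ := (hQ r).1 hr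
      obtain ⟨m, hm, hml⟩ := SimpleGraph.Walk.mem_support_iff_exists_getVert.1 hs
      refine ⟨s, m, hml, hm.symm, ?_⟩
      by_cases hlt : m < (w s).length
      · rw [if_pos hlt, ← hm]
        exact aux_comb hT w hpath hdisj σ hσj hσ s m hlt
      · rw [if_neg hlt]
        have : m = (w s).length := by omega
        subst this
        rw [← hm, SimpleGraph.Walk.getVert_length, hσj]
  obtain ⟨y, hy0, hy⟩ := Matrix.exists_mulVec_eq_zero_iff.2 hdet
  have hyP : ∀ c, c ∉ Q → y c = 0 := by
    intro c hc
    obtain ⟨r, hr, hrc⟩ := hNs c hc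
    have h1 := congrFun hy r
    simp only [Matrix.mulVec, dotProduct, Pi.zero_apply] at h1
    rw [Finset.sum_eq_single c] at h1
    · have h2 : C' r c = C r c := by simp [C', hrc]
      rw [h2] at h1
      exact (mul_eq_zero.1 h1).resolve_left (hNC r c hrc)
    · intro c' _ hne
      have : ¬ N r c' := fun h => hne (hNu _ _ _ h hrc)
      simp [C', hr, this]
    · simp
  rw [Polynomial.IsRoot, Matrix.eval_charpoly]
  refine Matrix.exists_mulVec_eq_zero_iff.1 ⟨fun q => y q.1, ?_, ?_⟩
  · intro h0
    apply hy0
    funext v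
    by_cases hv : v ∈ Q
    · exact congrFun h0 ⟨v, hv⟩
    · exact hyP v hv
  · funext q
    have h1 := congrFun hy q.1
    simp only [Matrix.mulVec, dotProduct, Pi.zero_apply] at h1 ⊢
    rw [← h1, ← Finset.sum_subset (Finset.subset_univ Q) (fun v _ hv => by rw [hyP v hv, mul_zero]),
      ← Finset.sum_coe_sort Q]
    refine Finset.sum_congr rfl fun c _ => ?_
    congr 1
    have hqj : ∀ s, q.1 ≠ j s := by
      intro s h
      exact (hQ q.1).2 ⟨s, by rw [h]; simp⟩ q.2
    have h3 : C' q.1 c.1 = B q.1 c.1 := by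
      simp only [C']
      rw [if_neg (fun h => h.1 q.2), hC2 _ hqj]
    rw [h3]
    by_cases hqc : q = c
    · subst hqc
      simp [B]
    · have hqc' : q.1 ≠ c.1 := fun h => hqc (Subtype.ext h)
      simp only [B, Matrix.sub_apply, Matrix.scalar_apply, Matrix.submatrix_apply,
        Matrix.diagonal_apply_ne _ hqc, Matrix.diagonal_apply_ne _ hqc']

/-- Let `A` be an `n × n` real symmetric matrix whose graph is a tree `T`.  If some `k`
pairwise vertex-disjoint paths of `T` cover `n - t` vertices of `T` (`t ≤ n`), then at most
`t` distinct eigenvalues of `A` have algebraic multiplicity `k + 1` or more. -/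
theorem card_high_multiplicity_le {n : ℕ} (A : Matrix (Fin n) (Fin n) ℝ)
    (hA : A.IsSymm) (hT : (graphOf A).IsTree)
    (k : ℕ) (i j : Fin k → Fin n)
    (w : ∀ s : Fin k, (graphOf A).Walk (i s) (j s))
    (hpath : ∀ s, (w s).IsPath)
    (hdisj : ∀ s t : Fin k, s ≠ t → ∀ v : Fin n,
      v ∈ (w s).support → v ∉ (w t).support)
    (t : ℕ) (ht : t ≤ n)
    (hcover : (Finset.univ.biUnion (fun s : Fin k => (w s).support.toFinset)).card = n - t) :
    (A.charpoly.roots.toFinset.filter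
        (fun lam => k + 1 ≤ A.charpoly.rootMultiplicity lam)).card ≤ t := by
  set P := Finset.univ.biUnion (fun s : Fin k => (w s).support.toFinset) with hP
  have hQ : ∀ v, v ∉ Pᶜ ↔ ∃ s, v ∈ (w s).support := by
    intro v; simp [hP]
  have hcard : (Pᶜ).card = t := by
    rw [Finset.card_compl, hcover, Fintype.card_fin]; omega
  set D := A.submatrix (fun q : (Pᶜ : Finset (Fin n)) => q.1) (fun q : (Pᶜ : Finset (Fin n)) => q.1)
  have hsub : A.charpoly.roots.toFinset.filter
        (fun lam => k + 1 ≤ A.charpoly.rootMultiplicity lam) ⊆ D.charpoly.roots.toFinset := by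
    intro lam hl
    rw [Finset.mem_filter] at hl
    rw [Multiset.mem_toFinset, Polynomial.mem_roots (Matrix.charpoly_monic D).ne_zero]
    exact aux_main A hA hT.isAcyclic k i j w hpath hdisj lam hl.2 _ hQ
  calc _ ≤ D.charpoly.roots.toFinset.card := Finset.card_le_card hsub
    _ ≤ D.charpoly.roots.card := Multiset.toFinset_card_le _
    _ ≤ D.charpoly.natDegree := Polynomial.card_roots' _
    _ = t := by rw [Matrix.charpoly_natDegree_eq_dim, Fintype.card_coe, hcard]
end

section
/- For every tree T, the maximum multiplicity M(T) occurring for an eigenvalue of a real symmetric matrix whose graph is T is at most the path cover number p(T). -/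
open Polynomial Matrix

/-- `HasPathCover G k` : the vertices of `G` can be covered by `k` pairwise
vertex-disjoint paths. -/
def HasPathCover {V : Type*} (G : SimpleGraph V) (k : ℕ) : Prop :=
  ∃ (i j : Fin k → V) (w : ∀ s : Fin k, G.Walk (i s) (j s)),
    (∀ s, (w s).IsPath) ∧
    (∀ s t : Fin k, s ≠ t → ∀ v : V, v ∈ (w s).support → v ∉ (w t).support) ∧
    (∀ v : V, ∃ s : Fin k, v ∈ (w s).support)

/-- The path cover number of a graph: the minimum number of vertex-disjoint paths needed to
cover all vertices. -/
noncomputable def pathCoverNumber {V : Type*} (G : SimpleGraph V) : ℕ :=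
  sInf {k | HasPathCover G k}

/-- The maximum multiplicity `M(T)` occurring for an eigenvalue of a real symmetric matrix
whose graph is `T`. -/
noncomputable def maxEigenMult {V : Type*} [Fintype V] [DecidableEq V]
    (T : SimpleGraph V) : ℕ :=
  sSup {m | ∃ A : Matrix V V ℝ, A.IsSymm ∧ graphOf A = T ∧
    ∃ lam : ℝ, A.charpoly.IsRoot lam ∧ m = A.charpoly.rootMultiplicity lam}

theorem no_nonbacktracking {V I : Type*} [Fintype V] (T : SimpleGraph V) (hT : T.IsAcyclic)
    (W : I → Prop) (pos : I → V) (g : I → I) (hW : ∀ i, W i → W (g i))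
    (hadj : ∀ i, W i → T.Adj (pos i) (pos (g i)))
    (hne : ∀ i, W i → pos (g (g i)) ≠ pos i) (i : I) (hi : W i) : False := by
  have key : ∀ n : ℕ, ∀ i, W i → ∃ (u : V) (p : T.Walk (pos i) u), p.length = n ∧
      ∀ a, a ≠ pos (g i) → List.IsChain (· ≠ ·) (s(a, pos i) :: p.edges) := by
    intro n
    induction n with
    | zero => intro i _; exact ⟨_, SimpleGraph.Walk.nil, rfl, by simp⟩
    | succ n ih =>
      intro i hi
      obtain ⟨u, p, hp, hc⟩ := ih (g i) (hW i hi)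
      refine ⟨u, SimpleGraph.Walk.cons (hadj i hi) p, by simp [hp], ?_⟩
      intro a ha
      rw [SimpleGraph.Walk.edges_cons, List.isChain_cons_cons]
      refine ⟨?_, hc _ (hne i hi).symm⟩
      have := (hadj i hi).ne
      intro h
      rw [Sym2.eq_iff] at h
      grind
  obtain ⟨u, p, hp, hc⟩ := key (Fintype.card V) i hi
  have h1 : p.IsPath := (hT.isPath_iff_isChain p).2
    (List.IsChain.tail (hc (pos i) (hadj i hi).ne))
  have := h1.length_lt
  omega

theorem forcing {V : Type*} [Fintype V] [DecidableEq V]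
    (T : SimpleGraph V) (hT : T.IsAcyclic) (A : Matrix V V ℝ) (hA : A.IsSymm)
    (hG : graphOf A = T) (lam : ℝ) (x : V → ℝ) (hx : A *ᵥ x = lam • x) (k : ℕ)
    (i j : Fin k → V) (w : ∀ s : Fin k, T.Walk (i s) (j s))
    (hp : ∀ s, (w s).IsPath)
    (hd : ∀ s t : Fin k, s ≠ t → ∀ v : V, v ∈ (w s).support → v ∉ (w t).support)
    (hc : ∀ v : V, ∃ s : Fin k, v ∈ (w s).support)
    (h0 : ∀ s, x (i s) = 0) : x = 0 := by
  classical
  by_contra hne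
  let Q : Fin k → ℕ → Prop := fun s m => m ≤ (w s).length ∧ x ((w s).getVert m) ≠ 0
  let bad : Fin k → Prop := fun s => ∃ m, Q s m
  have hf : ∃ f : Fin k → ℕ, ∀ s, bad s → Q s (f s) ∧ ∀ m, Q s m → f s ≤ m := by
    refine ⟨fun s => if h : bad s then Nat.find h else 0, ?_⟩
    intro s hs
    have hs' : ∃ m, Q s m := hs
    simp only [dif_pos hs]
    exact ⟨Nat.find_spec hs', fun m hm => Nat.find_min' hs' hm⟩
  obtain ⟨f, hf⟩ := hf
  have hf1 : ∀ s, bad s → 1 ≤ f s := by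
    intro s hs
    rcases Nat.eq_zero_or_pos (f s) with h | h
    · have := (hf s hs).1.2
      rw [h, SimpleGraph.Walk.getVert_zero] at this
      exact absurd (h0 s) this
    · exact h
  have hcov : ∀ v, ∃ s m, m ≤ (w s).length ∧ (w s).getVert m = v := by
    intro v
    obtain ⟨s, hs⟩ := hc v
    obtain ⟨m, hm, hl⟩ := SimpleGraph.Walk.mem_support_iff_exists_getVert.1 hs
    exact ⟨s, m, hl, hm⟩
  have hinj : ∀ s m t n, m ≤ (w s).length → n ≤ (w t).length →
      (w s).getVert m = (w t).getVert n → s = t ∧ m = n := by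
    intro s m t n hm hn h
    have hst : s = t := by
      by_contra hst
      exact hd s t hst _ ((w s).getVert_mem_support m) (h ▸ (w t).getVert_mem_support n)
    subst hst
    exact ⟨rfl, (hp s).getVert_injOn hm hn h⟩
  -- the other nonzero neighbour
  have hu : ∀ s, bad s → ∃ q : Fin k × ℕ, Q q.1 q.2 ∧
      T.Adj ((w s).getVert (f s - 1)) ((w q.1).getVert q.2) ∧
      (w q.1).getVert q.2 ≠ (w s).getVert (f s) := by
    intro s hs
    obtain ⟨hQ, hmin⟩ := hf s hs
    have h1 := hf1 s hs
    have hz : x ((w s).getVert (f s - 1)) = 0 := by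
      by_contra hz
      have := hmin (f s - 1) ⟨by have := hQ.1; omega, hz⟩
      omega
    have hadj : T.Adj ((w s).getVert (f s - 1)) ((w s).getVert (f s)) := by
      have := (w s).adj_getVert_succ (i := f s - 1) (by have := hQ.1; omega)
      rwa [Nat.sub_add_cancel h1] at this
    generalize (w s).getVert (f s - 1) = p at *
    have hqx := hQ.2
    generalize (w s).getVert (f s) = q at *
    have hrow : ∑ u, A p u * x u = 0 := by
      have := congrFun hx p
      simpa [Matrix.mulVec, dotProduct, hz] using this
    have hApq : A p q ≠ 0 := by
      rw [← hG] at hadj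
      simp only [graphOf, SimpleGraph.fromRel_adj] at hadj
      rcases hadj.2 with h | h
      · exact h
      · rwa [hA.apply] at h
    have : ∃ u, u ≠ q ∧ A p u * x u ≠ 0 := by
      by_contra hcon
      push Not at hcon
      rw [Finset.sum_eq_single q (fun u _ hu => hcon u hu) (by simp)] at hrow
      exact mul_ne_zero hApq hqx hrow
    obtain ⟨u, huq, hu⟩ := this
    have hxu : x u ≠ 0 := right_ne_zero_of_mul hu
    have hApu : A p u ≠ 0 := left_ne_zero_of_mul hu
    obtain ⟨t, m, hm, rfl⟩ := hcov u
    refine ⟨(t, m), ⟨hm, hxu⟩, ?_, huq⟩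
    have hgen : ∀ b, x b ≠ 0 → A p b ≠ 0 → T.Adj p b := by
      intro b hb1 hb2
      rw [← hG]
      simp only [graphOf, SimpleGraph.fromRel_adj]
      exact ⟨fun h => hb1 (h ▸ hz), Or.inl hb2⟩
    exact hgen _ hxu hApu
  choose! u hu using hu
  obtain ⟨v, hv⟩ : ∃ v, x v ≠ 0 := by
    by_contra h
    push Not at h
    exact hne (funext h)
  obtain ⟨s0, m0, hm0, rfl⟩ := hcov v
  obtain ⟨g, hg1, hg2⟩ : ∃ g : Fin k × ℕ → Fin k × ℕ,
      (∀ s m, f s ≤ m → g (s, m) = (s, m - 1)) ∧ (∀ s m, ¬ f s ≤ m → g (s, m) = u s) :=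
    ⟨fun q => if f q.1 ≤ q.2 then (q.1, q.2 - 1) else u q.1,
      fun s m h => if_pos h, fun s m h => if_neg h⟩
  refine no_nonbacktracking (I := Fin k × ℕ) T hT
    (fun q => bad q.1 ∧ f q.1 ≤ q.2 + 1 ∧ q.2 ≤ (w q.1).length)
    (fun q => (w q.1).getVert q.2)
    g ?_ ?_ ?_ (s0, m0)
    ⟨⟨m0, hm0, hv⟩, ?_, hm0⟩
  · rintro ⟨s, m⟩ ⟨hb, h1, h2⟩
    dsimp only at hb h1 h2
    by_cases h : f s ≤ m
    · rw [hg1 s m h]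
      refine ⟨hb, ?_, ?_⟩ <;> dsimp only <;> omega
    · rw [hg2 s m h]
      have := (hu s hb).1
      have hb' : bad (u s).1 := ⟨_, this⟩
      exact ⟨hb', ((hf _ hb').2 _ this).trans (Nat.le_succ _), this.1⟩
  · rintro ⟨s, m⟩ ⟨hb, h1, h2⟩
    dsimp only at hb h1 h2
    have := hf1 s hb
    by_cases h : f s ≤ m
    · rw [hg1 s m h]
      have h3 := (w s).adj_getVert_succ (i := m - 1) (by omega)
      rw [Nat.sub_add_cancel (by omega)] at h3
      exact h3.symm
    · rw [hg2 s m h]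
      have hm : m = f s - 1 := by omega
      rw [hm]
      exact (hu s hb).2.1
  · rintro ⟨s, m⟩ ⟨hb, h1, h2⟩
    dsimp only at hb h1 h2
    have := hf1 s hb
    by_cases h : f s ≤ m
    · rw [hg1 s m h]
      by_cases h' : f s ≤ m - 1
      · rw [hg1 s _ h']
        intro he
        have := (hinj _ _ _ _ (by dsimp only; omega) h2 he).2
        dsimp only at this
        omega
      · rw [hg2 s _ h']
        have hm : m = f s := by omega
        rw [hm]
        exact (hu s hb).2.2
    · rw [hg2 s m h]
      have hQ := (hu s hb).1
      have hne := (hu s hb).2.2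
      generalize u s = q at *
      obtain ⟨t, n⟩ := q
      dsimp only at hQ hne
      have hb' : bad t := ⟨_, hQ⟩
      have h3 := (hf _ hb').2 _ hQ
      rw [hg1 _ _ h3]
      intro he
      have h5 := hQ.1
      have h6 := hf1 _ hb'
      obtain ⟨e1, e2⟩ := hinj _ _ _ _ (by dsimp only; omega) h2 he
      dsimp only at e1 e2
      subst e1
      have e3 : n = f t := by omega
      exact hne (by rw [e3])
  · exact ((hf _ ⟨m0, hm0, hv⟩).2 m0 ⟨hm0, hv⟩).trans (Nat.le_succ _)

theorem mult_le {V : Type*} [Fintype V] [DecidableEq V]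
    (T : SimpleGraph V) (hT : T.IsTree) (A : Matrix V V ℝ) (hA : A.IsSymm)
    (hG : graphOf A = T) (lam : ℝ) (k : ℕ) (hk : HasPathCover T k) :
    A.charpoly.rootMultiplicity lam ≤ k := by
  classical
  obtain ⟨i, j, w, hp, hd, hc⟩ := hk
  have hH : A.IsHermitian := by
    rw [Matrix.IsHermitian, Matrix.conjTranspose_eq_transpose_of_trivial]; exact hA
  let I := {a : V // hH.eigenvalues a = lam}
  have hcard : A.charpoly.rootMultiplicity lam = Fintype.card I := by
    rw [← Polynomial.count_roots, hH.roots_charpoly_eq_eigenvalues, Multiset.count_map,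
      Fintype.card_subtype]
    simp [Finset.card, eq_comm]
  let v : I → V → ℝ := fun a => ⇑(hH.eigenvectorBasis a.1)
  have hv : ∀ a, A *ᵥ (v a) = lam • v a := by
    rintro ⟨a, rfl⟩
    exact hH.mulVec_eigenvectorBasis a
  have hli : LinearIndependent ℝ v := by
    have h1 := hH.eigenvectorBasis.toBasis.linearIndependent
    have h2 := h1.comp (fun a : I => a.1) Subtype.val_injective
    have h3 := h2.map' (WithLp.linearEquiv 2 ℝ (V → ℝ)).toLinearMap (LinearEquiv.ker _)
    have h4 : v = (WithLp.linearEquiv 2 ℝ (V → ℝ)).toLinearMap ∘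
        (hH.eigenvectorBasis.toBasis ∘ fun a : I => a.1) := by
      funext a
      simp [v]
    rw [h4]
    exact h3
  let L : (I → ℝ) →ₗ[ℝ] (Fin k → ℝ) :=
    (LinearMap.funLeft ℝ ℝ i).comp (Fintype.linearCombination ℝ v)
  have hL : Function.Injective L := by
    rw [← LinearMap.ker_eq_bot, LinearMap.ker_eq_bot']
    intro c hc0
    have hx : Fintype.linearCombination ℝ v c = 0 := by
      refine forcing T hT.isAcyclic A hA hG lam _ ?_ k i j w hp hd hc (fun s => congrFun hc0 s)
      rw [Fintype.linearCombination_apply, Matrix.mulVec_sum, Finset.smul_sum]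
      refine Finset.sum_congr rfl fun a _ => ?_
      rw [Matrix.mulVec_smul, hv, smul_comm]
    rw [Fintype.linearCombination_apply] at hx
    exact funext (Fintype.linearIndependent_iff.1 hli c hx)
  have := LinearMap.finrank_le_finrank_of_injective hL
  simpa [hcard] using this

theorem hasPathCover_card {V : Type*} [Fintype V] (T : SimpleGraph V) :
    HasPathCover T (Fintype.card V) := by
  let e := (Fintype.equivFin V).symm
  refine ⟨e, e, fun s => SimpleGraph.Walk.nil, by simp, ?_, ?_⟩
  · intro s t hst v hv
    simp only [SimpleGraph.Walk.support_nil, List.mem_singleton] at *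
    rw [hv]
    exact fun h => hst (e.injective h)
  · intro v
    exact ⟨e.symm v, by simp⟩

/-- For every tree `T`, the maximum eigenvalue multiplicity over real symmetric matrices
with graph `T` is at most the path cover number of `T`. -/
theorem maxEigenMult_le_pathCoverNumber {V : Type*} [Fintype V] [DecidableEq V]
    (T : SimpleGraph V) (hT : T.IsTree) :
    maxEigenMult T ≤ pathCoverNumber T := by
  refine csSup_le' ?_
  rintro m ⟨A, hA, hG, lam, -, rfl⟩
  have hk : HasPathCover T (pathCoverNumber T) :=
    Nat.sInf_mem (s := {k | HasPathCover T k}) ⟨_, hasPathCover_card T⟩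
  exact mult_le T hT A hA hG lam _ hk
end

section
/- For every tree T, the maximum multiplicity M(T) occurring for an eigenvalue of a real symmetric matrix whose graph is T equals the path cover number p(T). -/
open Polynomial Matrix

section Aux

lemma acyc_second {V : Type*} {G : SimpleGraph V} (hG : G.IsAcyclic) {v u a w : V}
    (h : G.Adj v u) (q : G.Walk u a) (hp : (SimpleGraph.Walk.cons h q).IsPath)
    (hw : G.Adj v w) (hmem : w ∈ (SimpleGraph.Walk.cons h q).support) : w = u := by
  classical
  have hne : v ≠ w := hw.ne
  have hmq : w ∈ q.support := by
    rcases List.mem_cons.1 (by simpa using hmem) with h1 | h1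
    · exact absurd h1.symm hne
    · exact h1
  have hp' := (SimpleGraph.Walk.cons_isPath_iff h q).1 hp
  have hpath : (SimpleGraph.Walk.cons h (q.takeUntil w hmq)).IsPath := by
    rw [SimpleGraph.Walk.cons_isPath_iff]
    exact ⟨hp'.1.takeUntil hmq, fun hh => hp'.2 (q.support_takeUntil_subset_support hmq hh)⟩
  have := (hG.subsingleton_path v w).elim ⟨_, hpath⟩ (SimpleGraph.Path.singleton hw)
  have h2 := congrArg (fun p : G.Path v w => (p : G.Walk v w).support) this
  simp [SimpleGraph.Path.singleton] at h2
  have h3 := SimpleGraph.Walk.head_support (q.takeUntil w hmq)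
  simp [h2] at h3
  exact h3

lemma no_dart_set {V : Type*} [Fintype V] {G : SimpleGraph V} (hG : G.IsAcyclic)
    (D : V → V → Prop) (hadj : ∀ u v, D u v → G.Adj u v)
    (hD : ∀ u v, D u v → ∃ w, w ≠ u ∧ D v w) (u v : V) : ¬ D u v := by
  intro h0
  have key : ∀ m : ℕ, ∃ (u v a : V) (h : G.Adj v u) (q : G.Walk u a),
      D u v ∧ (SimpleGraph.Walk.cons h q).IsPath ∧ q.length = m := by
    intro m
    induction m with
    | zero =>
      refine ⟨u, v, u, (hadj u v h0).symm, .nil, h0, ?_, rfl⟩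
      simp [(hadj u v h0).symm.ne]
    | succ m ih =>
      obtain ⟨u, v, a, h, q, hd, hp, hl⟩ := ih
      obtain ⟨w, hwu, hvw⟩ := hD u v hd
      refine ⟨v, w, a, (hadj _ _ hvw).symm, .cons h q, hvw, ?_, by simp [hl]⟩
      rw [SimpleGraph.Walk.cons_isPath_iff]
      exact ⟨hp, fun hm => hwu (acyc_second hG h q hp (hadj _ _ hvw) hm)⟩
  obtain ⟨u, v, a, h, q, -, hp, hl⟩ := key (Fintype.card V)
  have := hp.length_lt
  simp at this
  omega

lemma dichotomy {V : Type*} [Fintype V] {G : SimpleGraph V} (hG : G.IsAcyclic) (hne : G ≠ ⊥) :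
    (∃ u v z, (∀ y, G.Adj u y ↔ y = v) ∧ ∀ y, G.Adj v y → y = u ∨ y = z) ∨
    (∃ v a b, a ≠ b ∧ (∀ y, G.Adj a y ↔ y = v) ∧ (∀ y, G.Adj b y ↔ y = v)) := by
  by_contra hcon
  push Not at hcon
  obtain ⟨hb, ha⟩ := hcon
  have hleaf : ∀ u v, G.Adj u v → (∀ w, w ≠ u → ¬ G.Adj v w) → ∀ y, G.Adj v y ↔ y = u := by
    intro u v huv h y
    constructor
    · intro hy
      by_contra hc
      exact h y hc hy
    · rintro rfl
      exact huv.symm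
  let D : V → V → Prop := fun u v => G.Adj u v ∧ ∃ w, w ≠ u ∧ G.Adj v w
  have hno := no_dart_set hG D (fun _ _ h => h.1) (by
    rintro u v ⟨huv, w, hwu, hvw⟩
    by_contra hc
    push Not at hc
    have hl : ∀ w, w ≠ u → G.Adj v w → ∀ y, G.Adj w y ↔ y = v := by
      intro w hwu hvw
      apply hleaf v w hvw
      intro z hz hz'
      exact hc w hwu ⟨hvw, z, hz, hz'⟩
    obtain ⟨y, hvy, hyw, hyu⟩ := hb w v u (hl w hwu hvw)
    obtain ⟨z, hz⟩ := ha v w y (Ne.symm hyw) (hl w hwu hvw)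
    have := hl y hyu hvy z
    tauto)
  obtain ⟨u, v, huv⟩ := SimpleGraph.ne_bot_iff_exists_adj.1 hne
  have h1 := hleaf u v huv (fun w hw hvw => hno u v ⟨huv, w, hw, hvw⟩)
  have h2 := hleaf v u huv.symm (fun w hw hvw => hno v u ⟨huv.symm, w, hw, hvw⟩)
  obtain ⟨y, hy, hy1, hy2⟩ := hb u v u h2
  exact hy1 ((h1 y).1 hy)

inductive ZZ {V : Type*} (x : V → ℝ) (R : Set V) (pr : V → V) : V → Prop
  | base (v : V) : x v ≠ 0 → ZZ x R pr v
  | step (v : V) : v ∉ R → ZZ x R pr (pr v) → ZZ x R pr v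

lemma upper_core {V : Type*} [Fintype V] {G : SimpleGraph V} (hG : G.IsAcyclic)
    (A : Matrix V V ℝ) (hA : ∀ u v, u ≠ v → (A u v ≠ 0 ↔ G.Adj u v))
    (R : Set V) (n : V → ℕ) (pr : V → V)
    (h1 : ∀ v, v ∉ R → G.Adj (pr v) v) (h2 : ∀ v, v ∉ R → n (pr v) < n v)
    (h3 : ∀ u v, u ∉ R → v ∉ R → pr u = pr v → u = v)
    (x : V → ℝ) (hx : A *ᵥ x = 0) (hR : ∀ v ∈ R, x v = 0) : x = 0 := by
  classical
  by_contra hx0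
  obtain ⟨v0, hv0⟩ := Function.ne_iff.1 hx0
  have hZR : ∀ v, ZZ x R pr v → v ∉ R := by
    rintro v (⟨_, h⟩ | ⟨_, h, _⟩)
    · exact fun hv => h (hR v hv)
    · exact h
  let D : V → V → Prop := fun u v =>
    (G.Adj u v ∧ ZZ x R pr v ∧ u ≠ pr v) ∨ (ZZ x R pr u ∧ v = pr u)
  refine no_dart_set hG D ?_ ?_ v0 (pr v0) (Or.inr ⟨.base _ hv0, rfl⟩)
  · rintro u v (h | ⟨h, rfl⟩)
    · exact h.1
    · exact (h1 u (hZR u h)).symm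
  · rintro u v (⟨_, hv, hne⟩ | ⟨hu, rfl⟩)
    · exact ⟨pr v, hne.symm, Or.inr ⟨hv, rfl⟩⟩
    · by_cases hv : ZZ x R pr (pr u)
      · refine ⟨pr (pr u), ?_, Or.inr ⟨hv, rfl⟩⟩
        intro he
        have a1 := h2 u (hZR u hu)
        have a2 := h2 _ (hZR _ hv)
        rw [he] at a2
        omega
      · have hxu : x u ≠ 0 := by
          rcases hu with ⟨_, h⟩ | ⟨_, _, h⟩
          · exact h
          · exact absurd h hv
        have hxv : x (pr u) = 0 := by
          by_contra h
          exact hv (.base _ h)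
        have hadj := h1 u (hZR u hu)
        have : ∃ w, w ≠ u ∧ A (pr u) w * x w ≠ 0 := by
          by_contra hc
          push Not at hc
          have hs := congrFun hx (pr u)
          simp only [Matrix.mulVec, dotProduct, Pi.zero_apply] at hs
          rw [Finset.sum_eq_single u (fun b _ hb => hc b hb) (by simp)] at hs
          exact mul_ne_zero ((hA _ _ hadj.ne).2 hadj) hxu hs
        obtain ⟨w, hwu, hw⟩ := this
        have hxw : x w ≠ 0 := right_ne_zero_of_mul hw
        have hwv : pr u ≠ w := by
          rintro rfl
          exact hxw hxv
        refine ⟨w, hwu, Or.inl ⟨(hA _ _ hwv).1 (left_ne_zero_of_mul hw), .base _ hxw, ?_⟩⟩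
        intro he
        exact hwu (h3 u w (hZR u hu) (hZR w (.base _ hxw)) he).symm

lemma upper_rank {V : Type*} [Fintype V] {G : SimpleGraph V} (hG : G.IsAcyclic)
    (A : Matrix V V ℝ) (hA : ∀ u v, u ≠ v → (A u v ≠ 0 ↔ G.Adj u v)) {k : ℕ}
    (hk : HasPathCover G k) : Fintype.card V ≤ A.rank + k := by
  classical
  obtain ⟨i, j, w, hp, hd, hc⟩ := hk
  choose c hc using hc
  have hex : ∀ v, ∃ m, (w (c v)).getVert m = v ∧ m ≤ (w (c v)).length := fun v =>
    SimpleGraph.Walk.mem_support_iff_exists_getVert.1 (hc v)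
  choose n hn hnl using hex
  have hcu : ∀ s v, v ∈ (w s).support → c v = s := by
    intro s v hv
    by_contra h
    exact hd _ _ h v (hc v) hv
  have hnu : ∀ s m, m ≤ (w s).length → n ((w s).getVert m) = m ∧ c ((w s).getVert m) = s := by
    intro s m hm
    have hcs := hcu s _ ((w s).getVert_mem_support m)
    refine ⟨?_, hcs⟩
    have e1 := hn ((w s).getVert m)
    have e2 := hnl ((w s).getVert m)
    rw [hcs] at e1 e2
    exact (hp s).getVert_injOn e2 hm e1
  have hn0 : ∀ v, v ∉ Set.range i → n v ≠ 0 := by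
    intro v hv h
    apply hv
    refine ⟨c v, ?_⟩
    have := hn v
    rw [h] at this
    simpa using this
  let pr : V → V := fun v => (w (c v)).getVert (n v - 1)
  have hpr : ∀ v, n (pr v) = n v - 1 ∧ c (pr v) = c v := fun v =>
    hnu (c v) (n v - 1) (by have := hnl v; omega)
  have core := upper_core hG A hA (Set.range i) n pr (by
      intro v hv
      have h0 := hn0 v hv
      have h1 := hnl v
      have := (w (c v)).adj_getVert_succ (i := n v - 1) (by omega)
      rw [show n v - 1 + 1 = n v by omega, hn v] at this
      exact this) (by
      intro v hv
      have := hn0 v hv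
      have := (hpr v).1
      omega) (by
      intro u v hu hv h
      have a1 := hpr u
      have a2 := hpr v
      rw [h] at a1
      have := hn0 u hu
      have := hn0 v hv
      have e1 : n u = n v := by omega
      have e2 : c u = c v := a1.2.symm.trans a2.2
      rw [← hn u, ← hn v, e1, e2])
  let f : LinearMap.ker A.mulVecLin →ₗ[ℝ] (Fin k → ℝ) :=
    (LinearMap.funLeft ℝ ℝ i) ∘ₗ (LinearMap.ker A.mulVecLin).subtype
  have hf : Function.Injective f := by
    rw [injective_iff_map_eq_zero]
    rintro ⟨x, hx⟩ h
    apply Subtype.ext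
    apply core x
    · simpa using hx
    · rintro _ ⟨s, rfl⟩
      exact congrFun h s
  have h1 := LinearMap.finrank_le_finrank_of_injective hf
  have h2 := LinearMap.finrank_range_add_finrank_ker A.mulVecLin
  simp only [Module.finrank_fintype_fun_eq_card, Fintype.card_fin] at h1 h2
  have h3 : A.rank = Module.finrank ℝ (LinearMap.range A.mulVecLin) := rfl
  omega

lemma mult_eq {V : Type*} [Fintype V] [DecidableEq V] (A : Matrix V V ℝ) (hA : A.IsSymm)
    (lam : ℝ) : (A - Matrix.scalar V lam).rank + A.charpoly.rootMultiplicity lam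
      = Fintype.card V := by
  have hB : (A - Matrix.scalar V lam).IsHermitian := by
    have : (Matrix.scalar V lam).IsSymm := by simp [Matrix.IsSymm]
    have h2 : (A - Matrix.scalar V lam).IsSymm := hA.sub this
    rw [Matrix.IsHermitian, Matrix.conjTranspose_eq_transpose_of_trivial]
    exact h2
  rw [Polynomial.rootMultiplicity_eq_rootMultiplicity, ← Matrix.charpoly_sub_scalar,
    hB.rank_eq_card_non_zero_eigs, ← Polynomial.count_roots, hB.roots_charpoly_eq_eigenvalues,
    Multiset.count_map]
  have h := Fintype.card_subtype_compl (fun i => hB.eigenvalues i = 0)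
  have h2 := Fintype.card_subtype_le (fun i => hB.eigenvalues i = 0)
  have h3 : (Multiset.filter (fun a => 0 = ((RCLike.ofReal : ℝ → ℝ) ∘ hB.eigenvalues) a)
      Finset.univ.val).card = Fintype.card {i // hB.eigenvalues i = 0} := by
    rw [Fintype.card_subtype]
    simp only [Finset.card, Finset.filter, Function.comp, eq_comm (a := (0 : ℝ))]
    rfl
  rw [h3]
  change Fintype.card {i // ¬ hB.eigenvalues i = 0} + _ = _
  omega

end Aux

section Aux2

lemma mrank_add_le {V : Type*} [Fintype V] (A B : Matrix V V ℝ) :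
    (A + B).rank ≤ A.rank + B.rank := by
  unfold Matrix.rank
  rw [Matrix.mulVecLin_add]
  refine le_trans (Submodule.finrank_mono (LinearMap.range_add_le _ _)) ?_
  exact Submodule.finrank_add_le_finrank_add_finrank _ _

def PC {V : Type*} (G : SimpleGraph V) (L : List (List V)) : Prop :=
  (∀ p ∈ L, p ≠ [] ∧ p.IsChain G.Adj) ∧ L.flatten.Nodup ∧ ∀ v, v ∈ L.flatten

lemma PC.perm {V : Type*} {G : SimpleGraph V} {L L' : List (List V)} (h : PC G L)
    (hp : L.Perm L') : PC G L' :=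
  ⟨fun p hpp => h.1 p (hp.mem_iff.2 hpp), hp.flatten.nodup_iff.1 h.2.1,
    fun v => hp.flatten.mem_iff.1 (h.2.2 v)⟩

lemma PC.mono {V : Type*} {G G' : SimpleGraph V} {L : List (List V)} (h : PC G L)
    (hp : G ≤ G') : PC G' L :=
  ⟨fun p hpp => ⟨(h.1 p hpp).1, (h.1 p hpp).2.imp (fun _ _ a => hp a)⟩, h.2.1, h.2.2⟩

lemma PC.hasPathCover {V : Type*} {G : SimpleGraph V} {L : List (List V)} (h : PC G L) :
    HasPathCover G L.length := by
  obtain ⟨h1, h2, h3⟩ := h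
  rw [List.nodup_flatten] at h2
  refine ⟨fun s => (L.get s).head (h1 _ (L.get_mem s)).1,
    fun s => (L.get s).getLast (h1 _ (L.get_mem s)).1,
    fun s => SimpleGraph.Walk.ofSupport (L.get s) (h1 _ (L.get_mem s)).1 (h1 _ (L.get_mem s)).2,
    ?_, ?_, ?_⟩
  · intro s
    rw [SimpleGraph.Walk.isPath_def, SimpleGraph.Walk.support_ofSupport]
    exact h2.1 _ (L.get_mem s)
  · intro s t hst v hv hv'
    rw [SimpleGraph.Walk.support_ofSupport] at hv hv'
    have h4 := List.pairwise_iff_get.1 h2.2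
    rcases lt_or_gt_of_ne hst with h | h
    · exact h4 s t h hv hv'
    · exact h4 t s h hv' hv
  · intro v
    obtain ⟨p, hp, hv⟩ := List.mem_flatten.1 (h3 v)
    obtain ⟨s, rfl⟩ := List.get_of_mem hp
    exact ⟨s, by rw [SimpleGraph.Walk.support_ofSupport]; exact hv⟩

lemma chain_isolated {V : Type*} {G : SimpleGraph V} {u : V} (hu : ∀ y, ¬ G.Adj u y)
    {p : List V} (hp : p.IsChain G.Adj) (hm : u ∈ p) : p = [u] := by
  obtain ⟨s, t, rfl⟩ := List.append_of_mem hm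
  have ht : t = [] := by
    rcases t with _ | ⟨y, t⟩
    · rfl
    · exfalso
      rw [List.isChain_append] at hp
      exact hu y (List.isChain_cons_cons.1 hp.2.1).1
  have hs : s = [] := by
    rcases List.eq_nil_or_concat s with rfl | ⟨s', y, rfl⟩
    · rfl
    · exfalso
      rw [List.isChain_append] at hp
      exact hu y (hp.2.2 y (by simp) u (by simp)).symm
  simp [hs, ht]

lemma PC.isolated {V : Type*} {G : SimpleGraph V} {u : V} (hu : ∀ y, ¬ G.Adj u y)
    {L : List (List V)} (h : PC G L) : [u] ∈ L := by
  obtain ⟨p, hp, hv⟩ := List.mem_flatten.1 (h.2.2 u)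
  rwa [chain_isolated hu (h.1 p hp).2 hv] at hp

lemma chain_end {V : Type*} {G : SimpleGraph V} {v z : V} (hv : ∀ y, G.Adj v y → y = z)
    {p : List V} (hp : p.IsChain G.Adj) (hn : p.Nodup) (hm : v ∈ p) :
    (∃ t, p = v :: t) ∨ ∃ s, p = s ++ [v] := by
  obtain ⟨s, t, rfl⟩ := List.append_of_mem hm
  rcases t with _ | ⟨y, t⟩
  · exact Or.inr ⟨s, rfl⟩
  rcases List.eq_nil_or_concat s with rfl | ⟨s', x, rfl⟩
  · exact Or.inl ⟨_, rfl⟩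
  exfalso
  rw [List.isChain_append] at hp
  have e1 := hv y (List.isChain_cons_cons.1 hp.2.1).1
  have e2 := hv x (hp.2.2 x (by simp) v (by simp)).symm
  subst e1 e2
  simp [List.nodup_append] at hn

lemma PC.split {V : Type*} {G : SimpleGraph V} {p : List V}
    {L : List (List V)} (h : PC G L) (hp : p ∈ L) : ∃ L', L.Perm (p :: L') := by
  obtain ⟨s, t, rfl⟩ := List.append_of_mem hp
  exact ⟨s ++ t, List.perm_middle⟩

lemma lower {V : Type*} [Fintype V] [DecidableEq V] (G : SimpleGraph V) (hG : G.IsAcyclic) :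
    ∃ A : Matrix V V ℝ, A.IsSymm ∧ (∀ u v, u ≠ v → (A u v ≠ 0 ↔ G.Adj u v)) ∧
      ∃ L, PC G L ∧ A.rank + L.length ≤ Fintype.card V := by
  classical
  induction G using WellFoundedLT.induction with
  | ind G ih =>
  by_cases hbot : G = ⊥
  · subst hbot
    refine ⟨0, by simp [Matrix.IsSymm], by simp, Finset.univ.toList.map (fun v => [v]), ?_, ?_⟩
    · have : (Finset.univ.toList.map (fun v : V => [v])).flatten = Finset.univ.toList := by
        generalize (Finset.univ : Finset V).toList = l
        induction l <;> simp_all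
      refine ⟨by simp, ?_, ?_⟩
      · rw [this]; exact Finset.nodup_toList _
      · rw [this]; simp
    · simp
  rcases dichotomy hG hbot with ⟨u, v, z, hu, hv⟩ | ⟨v, a, b, hab, ha, hb⟩
  · have huv : G.Adj u v := (hu v).2 rfl
    have hne : u ≠ v := huv.ne
    let G' : SimpleGraph V := G.deleteEdges {s(u, v)}
    have hadj : ∀ x y, G'.Adj x y ↔ G.Adj x y ∧ ¬ (x = u ∧ y = v ∨ x = v ∧ y = u) := by
      intro x y
      simp [G', SimpleGraph.deleteEdges_adj]
    have hle : G' ≤ G := SimpleGraph.deleteEdges_le _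
    have hlt : G' < G := lt_of_le_of_ne hle (fun h => by
      have := (hadj u v).1 (h ▸ huv)
      simp at this)
    obtain ⟨A, hsym, hA, L, hL, hr⟩ := ih G' hlt (hG.anti hle)
    let f : V → ℝ := fun x => if x = u ∨ x = v then 1 else 0
    refine ⟨A + Matrix.vecMulVec f f, ?_, ?_, ?_⟩
    · refine hsym.add ?_
      ext x y
      simp [Matrix.vecMulVec_apply, mul_comm]
    · intro x y hxy
      have h1 := hA x y hxy
      rw [hadj] at h1
      by_cases hc : x = u ∧ y = v ∨ x = v ∧ y = u
      · have h0 : A x y = 0 := by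
          by_contra h
          exact (h1.1 h).2 hc
        have hg : G.Adj x y := by
          rcases hc with ⟨rfl, rfl⟩ | ⟨rfl, rfl⟩
          · exact huv
          · exact huv.symm
        have hf : f x = 1 ∧ f y = 1 := by
          simp only [f]
          grind
        simp [Matrix.vecMulVec_apply, h0, hg, hf.1, hf.2]
      · have hf : f x * f y = 0 := by
          simp only [f]
          grind
        simp only [Matrix.add_apply, Matrix.vecMulVec_apply, hf, add_zero]
        tauto
    · have hrk : (A + Matrix.vecMulVec f f).rank ≤ A.rank + 1 :=
        (mrank_add_le _ _).trans (Nat.add_le_add_left (Matrix.rank_vecMulVec_le _ _) _)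
      have hiso : ∀ y, ¬ G'.Adj u y := by
        intro y hy
        rw [hadj] at hy
        have := (hu y).1 hy.1
        tauto
      have hve : ∀ y, G'.Adj v y → y = z := by
        intro y hy
        rw [hadj] at hy
        have := hv y hy.1
        tauto
      obtain ⟨L1, hp1⟩ := hL.split (hL.isolated hiso)
      have hL1 := hL.perm hp1
      have hvm : v ∈ L1.flatten := by
        have := hL1.2.2 v
        simpa [hne.symm] using this
      obtain ⟨p, hp, hvp⟩ := List.mem_flatten.1 hvm
      obtain ⟨s, t, rfl⟩ := List.append_of_mem hp
      have hp2 : ([u] :: (s ++ p :: t)).Perm ([u] :: p :: (s ++ t)) :=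
        List.Perm.cons _ List.perm_middle
      have hL2 := (hL1.perm hp2).mono hle
      have hlen := (hp1.trans hp2).length_eq
      simp only [List.length_cons] at hlen
      have hchp := (hL1.1 p (by simp)).2
      have hnp : p.Nodup := (List.nodup_flatten.1 hL1.2.1).1 p (by simp)
      rcases chain_end hve hchp hnp hvp with ⟨q, rfl⟩ | ⟨q, rfl⟩
      · refine ⟨(u :: v :: q) :: (s ++ t), ⟨?_, ?_, ?_⟩, ?_⟩
        · intro r hr
          rcases List.mem_cons.1 hr with rfl | hr
          · exact ⟨by simp, List.isChain_cons_cons.2 ⟨huv, (hL2.1 (v :: q) (by simp)).2⟩⟩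
          · exact hL2.1 r (by simp only [List.mem_cons]; tauto)
        · have := hL2.2.1
          simpa using this
        · intro y
          have := hL2.2.2 y
          simpa using this
        · simp only [List.length_cons]
          omega
      · have hpm : ([u] :: (q ++ [v]) :: (s ++ t)).flatten.Perm
            ((q ++ [v] ++ [u]) :: (s ++ t)).flatten := by
          simp only [List.flatten_cons]
          rw [← List.append_assoc]
          exact List.Perm.append_right _ List.perm_append_comm
        refine ⟨(q ++ [v] ++ [u]) :: (s ++ t), ⟨?_, hpm.nodup_iff.1 hL2.2.1,
          fun y => hpm.mem_iff.1 (hL2.2.2 y)⟩, ?_⟩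
        · intro r hr
          rcases List.mem_cons.1 hr with rfl | hr
          · refine ⟨by simp, List.isChain_append.2 ⟨(hL2.1 (q ++ [v]) (by simp)).2, by simp, ?_⟩⟩
            intro x hx y hy
            simp at hx hy
            subst hx hy
            exact huv.symm
          · exact hL2.1 r (by simp only [List.mem_cons]; tauto)
        · simp only [List.length_cons]
          omega
  · have hav : G.Adj a v := (ha v).2 rfl
    have hbv : G.Adj b v := (hb v).2 rfl
    let G' : SimpleGraph V :=
      { Adj := fun x y => G.Adj x y ∧ x ≠ v ∧ y ≠ v
        symm := ⟨fun x y h => ⟨h.1.symm, h.2.2, h.2.1⟩⟩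
        loopless := ⟨fun x h => G.loopless.irrefl x h.1⟩ }
    have hle : G' ≤ G := fun x y h => h.1
    have hlt : G' < G := lt_of_le_of_ne hle (fun h => by
      have : G'.Adj a v := h ▸ hav
      exact this.2.2 rfl)
    obtain ⟨A, hsym, hA, L, hL, hr⟩ := ih G' hlt (hG.anti hle)
    let f : V → ℝ := fun x => if G.Adj v x then 1 else 0
    let e : V → ℝ := fun x => if x = v then 1 else 0
    refine ⟨A + (Matrix.vecMulVec f e + Matrix.vecMulVec e f), ?_, ?_, ?_⟩
    · refine hsym.add ?_
      ext x y
      simp [Matrix.vecMulVec_apply, mul_comm, add_comm]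
    · intro x y hxy
      have h1 := hA x y hxy
      simp only [Matrix.add_apply, Matrix.vecMulVec_apply, f, e]
      have h2 : G'.Adj x y ↔ G.Adj x y ∧ x ≠ v ∧ y ≠ v := Iff.rfl
      rw [h2] at h1
      by_cases hx : x = v
      · subst hx
        have h0 : A x y = 0 := by
          by_contra h
          exact (h1.1 h).2.1 rfl
        simp [h0, Ne.symm hxy]
      · by_cases hy : y = v
        · subst hy
          have h0 : A x y = 0 := by
            by_contra h
            exact (h1.1 h).2.2 rfl
          simp [h0, hxy, G.adj_comm]
        · simp only [hx, hy, if_false, mul_zero, zero_mul, add_zero]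
          tauto
    · have hrk : (A + (Matrix.vecMulVec f e + Matrix.vecMulVec e f)).rank ≤ A.rank + 2 := by
        have h1 := mrank_add_le A (Matrix.vecMulVec f e + Matrix.vecMulVec e f)
        have h2 := mrank_add_le (Matrix.vecMulVec f e) (Matrix.vecMulVec e f)
        have h3 := Matrix.rank_vecMulVec_le f e
        have h4 := Matrix.rank_vecMulVec_le e f
        omega
      have i1 : [a] ∈ L := hL.isolated (fun y (hy : G'.Adj a y) => hy.2.2 ((ha y).1 hy.1))
      have i2 : [b] ∈ L := hL.isolated (fun y (hy : G'.Adj b y) => hy.2.2 ((hb y).1 hy.1))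
      have i3 : [v] ∈ L := hL.isolated (fun y (hy : G'.Adj v y) => hy.2.1 rfl)
      obtain ⟨L1, hp1⟩ := hL.split i1
      have i3' : [v] ∈ L1 := by
        have := hp1.mem_iff.1 i3
        simpa [hav.ne.symm] using this
      have i2' : [b] ∈ L1 := by
        have := hp1.mem_iff.1 i2
        simpa [hab.symm] using this
      obtain ⟨s, t, rfl⟩ := List.append_of_mem i3'
      have hp2 := hp1.trans (List.Perm.cons [a] (List.perm_middle (a := [v]) (l₁ := s) (l₂ := t)))
      have i2'' : [b] ∈ s ++ t := by
        simpa [hbv.ne] using i2'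
      obtain ⟨s', t', hst⟩ := List.append_of_mem i2''
      rw [hst] at hp2
      have hp3 := hp2.trans (List.Perm.cons [a] (List.Perm.cons [v]
        (List.perm_middle (a := [b]) (l₁ := s') (l₂ := t'))))
      have hL3 := (hL.perm hp3).mono hle
      have hlen := hp3.length_eq
      simp only [List.length_cons] at hlen
      refine ⟨[a, v, b] :: (s' ++ t'), ⟨?_, ?_, ?_⟩, ?_⟩
      · intro r hr
        rcases List.mem_cons.1 hr with rfl | hr
        · simp [hav, hbv.symm]
        · exact hL3.1 r (by simp only [List.mem_cons]; tauto)
      · simpa using hL3.2.1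
      · intro y
        simpa using hL3.2.2 y
      · simp only [List.length_cons]
        omega

lemma graphOf_iff {V : Type*} {G : SimpleGraph V} (A : Matrix V V ℝ) (hs : A.IsSymm) :
    graphOf A = G ↔ ∀ u v, u ≠ v → (A u v ≠ 0 ↔ G.Adj u v) := by
  constructor
  · rintro rfl u v huv
    simp [graphOf, SimpleGraph.fromRel_adj, huv, hs.apply u v]
  · intro h
    ext u v
    by_cases huv : u = v
    · subst huv; simp
    · rw [← h u v huv]
      simp [graphOf, SimpleGraph.fromRel_adj, huv, hs.apply u v]

end Aux2

/-- For every tree `T`, the maximum eigenvalue multiplicity over real symmetric matrices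
with graph `T` equals the path cover number of `T`. -/
theorem maxEigenMult_eq_pathCoverNumber {V : Type*} [Fintype V] [DecidableEq V]
    (T : SimpleGraph V) (hT : T.IsTree) :
    maxEigenMult T = pathCoverNumber T := by
  classical
  have hac : T.IsAcyclic := hT.isAcyclic
  obtain ⟨A, hsym, hA, L, hL, hr⟩ := lower T hac
  have hk := hL.hasPathCover
  have hp : HasPathCover T (pathCoverNumber T) := Nat.sInf_mem (s := {k | HasPathCover T k}) ⟨_, hk⟩
  have hub : ∀ m ∈ {m | ∃ A : Matrix V V ℝ, A.IsSymm ∧ graphOf A = T ∧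
      ∃ lam : ℝ, A.charpoly.IsRoot lam ∧ m = A.charpoly.rootMultiplicity lam},
      m ≤ pathCoverNumber T := by
    rintro m ⟨B, hBs, hBg, lam, -, rfl⟩
    rw [graphOf_iff B hBs] at hBg
    have h1 := mult_eq B hBs lam
    have h2 := upper_rank hac (B - Matrix.scalar V lam) (by
      intro u v huv
      rw [← hBg u v huv]
      simp [huv]) hp
    omega
  have h0 := mult_eq A hsym 0
  rw [map_zero, sub_zero] at h0
  have hle : pathCoverNumber T ≤ L.length := Nat.sInf_le hk
  have hpos : 0 < L.length := by
    obtain ⟨v⟩ := hT.connected.nonempty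
    obtain ⟨p, hp, -⟩ := List.mem_flatten.1 (hL.2.2 v)
    exact List.length_pos_of_mem hp
  have hmem : A.charpoly.rootMultiplicity 0 ∈ {m | ∃ A : Matrix V V ℝ, A.IsSymm ∧ graphOf A = T ∧
      ∃ lam : ℝ, A.charpoly.IsRoot lam ∧ m = A.charpoly.rootMultiplicity lam} := by
    refine ⟨A, hsym, (graphOf_iff A hsym).2 hA, 0, ?_, rfl⟩
    exact ((Polynomial.rootMultiplicity_pos (A.charpoly_monic.ne_zero)).1 (by omega))
  apply le_antisymm
  · exact csSup_le ⟨_, hmem⟩ hub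
  · refine le_trans ?_ (le_csSup ⟨_, hub⟩ hmem)
    omega
end

section
/- Let T be a tree which is not a path, and suppose P is a path in T whose two end vertices are pendant vertices of T and which contains exactly one vertex v of degree 3 or more in T. Then p(T) = p(T ∖ P) + 1, where T ∖ P is the forest obtained from T by deleting all vertices of P. -/
open SimpleGraph

theorem HPC_of_family {V : Type*} {G : SimpleGraph V} {ι : Type*} [Fintype ι]
    (i j : ι → V) (w : ∀ s, G.Walk (i s) (j s)) (h1 : ∀ s, (w s).IsPath)
    (h2 : ∀ s t, s ≠ t → ∀ v : V, v ∈ (w s).support → v ∉ (w t).support)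
    (h3 : ∀ v : V, ∃ s, v ∈ (w s).support) : HasPathCover G (Fintype.card ι) := by
  let e := (Fintype.equivFin ι).symm
  refine ⟨fun s => i (e s), fun s => j (e s), fun s => w (e s), fun s => h1 _,
    fun s t hst => h2 _ _ (fun h => hst (e.injective h)), fun v => ?_⟩
  obtain ⟨s, hs⟩ := h3 v
  obtain ⟨t, rfl⟩ := e.surjective s
  exact ⟨t, hs⟩

theorem HPC_mono {V : Type*} {G H : SimpleGraph V} (h : H ≤ G) {k : ℕ}
    (hk : HasPathCover H k) : HasPathCover G k := by
  obtain ⟨i, j, w, h1, h2, h3⟩ := hk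
  refine ⟨i, j, fun s => (w s).mapLe h, fun s => ?_, fun s t hst v => ?_, fun v => ?_⟩
  · simpa using h1 s
  · simpa using h2 s t hst v
  · simpa using h3 v

theorem forest_card {V : Type*} [Fintype V] (G : SimpleGraph V) (hG : G.IsAcyclic) :
    G.edgeSet.ncard + Nat.card G.ConnectedComponent = Nat.card V := by
  classical
  let e : (Σ c : G.ConnectedComponent, c) ≃ V :=
    Equiv.sigmaFiberEquiv G.connectedComponentMk
  have key : ∀ c : G.ConnectedComponent,
      ∑ v : c, G.degree v + 2 = 2 * Fintype.card c := by
    intro c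
    have h1 := (hG.isTree_connectedComponent c).card_edgeFinset
    have h2 := c.toSimpleGraph.sum_degrees_eq_twice_card_edges
    have h3 : ∀ v : c, G.degree v = c.toSimpleGraph.degree v := by
      intro v
      rw [← card_neighborFinset_eq_degree, ← card_neighborFinset_eq_degree]
      symm
      apply Finset.card_bij (fun (a : c) _ => (a : V))
      · intro a ha
        exact (mem_neighborFinset _ _ _).2 ((mem_neighborFinset _ _ _).1 ha : c.toSimpleGraph.Adj v a)
      · intro a _ b _ h
        exact Subtype.ext h
      · intro b hb
        have hb' : G.Adj v b := by simpa using hb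
        refine ⟨⟨b, (ConnectedComponent.mem_supp_congr_adj c hb').1 v.2⟩, ?_, rfl⟩
        exact (mem_neighborFinset _ _ _).2 hb'
    have h4 : Fintype.card c = Fintype.card c := by
      exact Fintype.card_congr (Equiv.refl _)
    simp_rw [h3]
    have h5 : ∑ v : c, c.toSimpleGraph.degree v = 2 * c.toSimpleGraph.edgeFinset.card := by
      rw [← h2]
    rw [h5, ← h4, ← h1]; ring
  have s1 : ∑ c : G.ConnectedComponent, ∑ v : c, G.degree v = ∑ v, G.degree v := by
    rw [← Fintype.sum_sigma']
    exact Fintype.sum_equiv e _ _ (fun x => rfl)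
  have s2 : ∑ c : G.ConnectedComponent, Fintype.card c = Fintype.card V := by
    rw [← Fintype.card_sigma]
    exact Fintype.card_congr e
  have s3 := Finset.sum_congr (rfl : (Finset.univ : Finset G.ConnectedComponent) = _)
    (fun c _ => key c)
  rw [Finset.sum_add_distrib, s1, ← Finset.mul_sum, s2, G.sum_degrees_eq_twice_card_edges] at s3
  have s4 : G.edgeSet.ncard = G.edgeFinset.card := by
    rw [← coe_edgeFinset, Set.ncard_coe_finset]
  simp only [Finset.sum_const, Finset.card_univ, smul_eq_mul] at s3
  rw [s4, Nat.card_eq_fintype_card, Nat.card_eq_fintype_card]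
  omega

theorem path_nbr_le {V : Type*} {G : SimpleGraph V} {u v : V} (p : G.Walk u v) (hp : p.IsPath)
    (x : V) : (p.toSubgraph.neighborSet x).ncard ≤ 2 := by
  by_cases hx : x ∈ p.support
  · obtain ⟨i, rfl, hi⟩ := Walk.mem_support_iff_exists_getVert.1 hx
    by_cases hn : p.Nil
    · have : p.toSubgraph.neighborSet (p.getVert i) = ∅ := by
        ext y
        simp only [Subgraph.mem_neighborSet, Walk.adj_toSubgraph_iff_mem_edges,
          Set.mem_empty_iff_false, iff_false]
        intro h
        cases p with
        | nil => simp at h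
        | cons _ _ => simp at hn
      simp [this]
    by_cases h0 : i = 0
    · subst h0
      rw [Walk.getVert_zero, hp.neighborSet_toSubgraph_startpoint hn]; simp
    by_cases h1 : i = p.length
    · subst h1
      rw [Walk.getVert_length, hp.neighborSet_toSubgraph_endpoint hn]; simp
    · exact (hp.ncard_neighborSet_toSubgraph_internal_eq_two h0 (by omega)).le
  · have : p.toSubgraph.neighborSet x = ∅ := by
      ext y
      simp only [Subgraph.mem_neighborSet, Set.mem_empty_iff_false, iff_false]
      intro h
      exact hx (Walk.mem_support_of_adj_toSubgraph h)
    simp [this]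

theorem path_nbr_eq {V : Type*} {G : SimpleGraph V} {u v : V} (p : G.Walk u v) (hp : p.IsPath)
    (x : V) (hx : x ∈ p.support) (hu : x ≠ u) (hv : x ≠ v) :
    (p.toSubgraph.neighborSet x).ncard = 2 := by
  obtain ⟨i, rfl, hi⟩ := Walk.mem_support_iff_exists_getVert.1 hx
  have h0 : i ≠ 0 := by rintro rfl; simp at hu
  have h1 : i ≠ p.length := by rintro rfl; simp at hv
  exact hp.ncard_neighborSet_toSubgraph_internal_eq_two h0 (by omega)

theorem comp_path {V : Type*} [Finite V] (G : SimpleGraph V)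
    (hd : ∀ x, (G.neighborSet x).ncard ≤ 2) (c : G.ConnectedComponent) :
    ∃ (u v : V) (p : G.Walk u v), p.IsPath ∧ ∀ x, x ∈ p.support ↔ G.connectedComponentMk x = c := by
  classical
  have := Fintype.ofFinite V
  let S : Set ℕ := {n | ∃ (u v : V) (p : G.Walk u v), p.IsPath ∧
    G.connectedComponentMk u = c ∧ p.length = n}
  have hS : S.Nonempty := by
    obtain ⟨u, rfl⟩ := c.exists_rep
    exact ⟨0, u, u, Walk.nil, by simp, rfl, rfl⟩
  have hB : BddAbove S := by
    refine ⟨Fintype.card V, ?_⟩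
    rintro n ⟨u, v, p, hp, _, rfl⟩
    exact hp.length_lt.le
  obtain ⟨u, v, p, hp, hc, hl⟩ := Nat.sSup_mem hS hB
  have hmax : ∀ (u' v' : V) (q : G.Walk u' v'), q.IsPath → G.connectedComponentMk u' = c →
      q.length ≤ p.length := by
    intro u' v' q hq hqc
    rw [hl]
    exact le_csSup hB ⟨u', v', q, hq, hqc, rfl⟩
  refine ⟨u, v, p, hp, fun x => ⟨fun hx => ?_, fun hx => ?_⟩⟩
  · rw [← hc]
    exact ConnectedComponent.sound (p.takeUntil x hx).reachable.symm
  · by_contra hxp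
    have hr : G.Reachable u x := ConnectedComponent.exact (hc.trans hx.symm)
    obtain ⟨q⟩ := hr
    obtain ⟨d, -, hd1, hd2⟩ := q.exists_boundary_dart {z | z ∈ p.support} (by simp) hxp
    obtain ⟨⟨s, t⟩, hst⟩ := d
    simp only [Set.mem_ofPred_eq] at hd1 hd2
    have hst : G.Adj s t := hst
    by_cases hu : s = u
    · subst hu
      have := hmax t v (Walk.cons hst.symm p) ((Walk.cons_isPath_iff _ _).2 ⟨hp, hd2⟩)
        ((ConnectedComponent.sound hst.symm.reachable).trans hc)
      simp at this
    by_cases hv : s = v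
    · subst hv
      have := hmax u t (p.concat hst) (hp.concat hd2 hst) hc
      simp at this
    have h2 := path_nbr_eq p hp s hd1 hu hv
    have h3 : insert t (p.toSubgraph.neighborSet s) ⊆ G.neighborSet s := by
      rintro y (rfl | hy)
      · exact hst
      · exact Subgraph.Adj.adj_sub hy
    have h4 : t ∉ p.toSubgraph.neighborSet s := by
      intro h
      exact hd2 (Walk.mem_support_of_adj_toSubgraph (Subgraph.Adj.symm h))
    have h5 := Set.ncard_le_ncard h3 (Set.toFinite _)
    rw [Set.ncard_insert_of_notMem h4 (Set.toFinite _)] at h5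
    have := hd s
    omega

theorem HPC_of_deg {V : Type*} [Finite V] (G : SimpleGraph V)
    (hd : ∀ x, (G.neighborSet x).ncard ≤ 2) :
    HasPathCover G (Nat.card G.ConnectedComponent) := by
  have := Fintype.ofFinite G.ConnectedComponent
  choose i j w h1 h2 using comp_path G hd
  rw [Nat.card_eq_fintype_card]
  refine HPC_of_family i j w h1 (fun s t hst v hv hv' => hst ?_) (fun v => ⟨_, (h2 _ v).2 rfl⟩)
  rw [← (h2 s v).1 hv, (h2 t v).1 hv']

theorem HPC_pathCoverNumber {V : Type*} [Finite V] (G : SimpleGraph V) :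
    HasPathCover G (pathCoverNumber G) := by
  apply Nat.sInf_mem (s := {k | HasPathCover G k})
  refine ⟨_, HPC_mono (bot_le : ⊥ ≤ G) (HPC_of_deg ⊥ fun x => ?_)⟩
  have : (⊥ : SimpleGraph V).neighborSet x = ∅ := by ext; simp
  simp [this]

theorem exists_sub {V : Type*} [Finite V] (G : SimpleGraph V) (k : ℕ) (hk : HasPathCover G k) :
    ∃ H ≤ G, (∀ x, (H.neighborSet x).ncard ≤ 2) ∧ Nat.card H.ConnectedComponent ≤ k := by
  classical
  obtain ⟨i, j, w, h1, h2, h3⟩ := hk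
  let H : SimpleGraph V :=
    { Adj := fun x y => ∃ s, (w s).toSubgraph.Adj x y
      symm := ⟨fun x y ⟨s, h⟩ => ⟨s, h.symm⟩⟩
      loopless := ⟨fun x ⟨s, h⟩ => G.loopless.irrefl x h.adj_sub⟩ }
  refine ⟨H, ?_, ?_, ?_⟩
  · rintro x y ⟨s, h⟩
    exact h.adj_sub
  · intro x
    obtain ⟨s, hs⟩ := h3 x
    refine le_trans (Set.ncard_le_ncard ?_ (Set.toFinite _)) (path_nbr_le (w s) (h1 s) x)
    rintro y ⟨t, ht⟩
    by_cases hst : s = t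
    · subst hst; exact ht
    · exact absurd (Walk.mem_support_of_adj_toSubgraph ht) (h2 s t hst x hs)
  · have : Function.Surjective (fun s : Fin k => H.connectedComponentMk (i s)) := by
      intro c
      obtain ⟨x, rfl⟩ := c.exists_rep
      obtain ⟨s, hs⟩ := h3 x
      refine ⟨s, ConnectedComponent.sound ?_⟩
      refine ⟨((w s).takeUntil x hs).transfer H ?_⟩
      intro e he
      have he' := (w s).edges_takeUntil_subset hs he
      induction e using Sym2.ind with
      | _ a b => exact ⟨s, Walk.adj_toSubgraph_iff_mem_edges.2 he'⟩
    simpa using Nat.card_le_card_of_surjective _ this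

theorem HPC_add {V : Type*} [DecidableEq V] (T : SimpleGraph V) {a b : V} (w : T.Walk a b)
    (hw : w.IsPath) (k : ℕ) (hk : HasPathCover (T.induce {x : V | x ∉ w.support}) k) :
    HasPathCover T (k + 1) := by
  obtain ⟨i, j, q, h1, h2, h3⟩ := hk
  let f := (Embedding.induce (G := T) {x : V | x ∉ w.support}).toHom
  have hf : ∀ x, f x = x := fun x => rfl
  have := HPC_of_family (G := T) (ι := Option (Fin k))
    (fun o => o.elim a (fun s => f (i s))) (fun o => o.elim b (fun s => f (j s)))
    (fun o => match o with
      | none => w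
      | some s => (q s).map f) ?_ ?_ ?_
  · simpa using this
  · rintro (_ | s)
    · exact hw
    · exact Walk.map_isPath_of_injective Subtype.val_injective (h1 s)
  · have aux : ∀ (s : Fin k) x, x ∈ ((q s).map f).support → x ∉ w.support := by
      intro s x hx
      rw [Walk.support_map, List.mem_map] at hx
      obtain ⟨y, _, rfl⟩ := hx
      exact y.2
    rintro (_ | s) (_ | t) hst x hx hx'
    · exact hst rfl
    · exact aux t x hx' hx
    · exact aux s x hx hx'
    · replace hx : x ∈ ((q s).map f).support := hx
      replace hx' : x ∈ ((q t).map f).support := hx'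
      rw [Walk.support_map, List.mem_map] at hx hx'
      obtain ⟨y, hy, rfl⟩ := hx
      obtain ⟨z, hz, hzy⟩ := hx'
      have : z = y := Subtype.ext hzy
      subst this
      exact h2 s t (by rintro rfl; exact hst rfl) _ hy hz
  · intro x
    by_cases hx : x ∈ w.support
    · exact ⟨none, hx⟩
    · obtain ⟨s, hs⟩ := h3 ⟨x, hx⟩
      refine ⟨some s, ?_⟩
      change x ∈ ((q s).map f).support
      rw [Walk.support_map, List.mem_map]
      exact ⟨_, hs, rfl⟩

theorem inc_le {V : Type*} [Finite V] (H : SimpleGraph V) (v : V) :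
    (H.incidenceSet v).ncard ≤ (H.neighborSet v).ncard := by
  have : H.incidenceSet v ⊆ (fun y => s(v, y)) '' H.neighborSet v := by
    rintro e ⟨he, hv⟩
    obtain ⟨y, rfl⟩ := hv
    exact ⟨y, he, rfl⟩
  exact (Set.ncard_le_ncard this (Set.toFinite _)).trans (Set.ncard_image_le (Set.toFinite _))

theorem edges_away {V : Type*} [Finite V] [DecidableEq V] (T : SimpleGraph V) {a b : V}
    (w : T.Walk a b) (hw : w.IsPath) (v : V) (hv : v ∈ w.support) (h1 : v ≠ a) (h2 : v ≠ b) :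
    {e | e ∈ w.edges ∧ v ∉ e}.ncard + 2 ≤ w.length := by
  have e1 := path_nbr_eq w hw v hv h1 h2
  have e2 : ((fun y => s(v, y)) '' w.toSubgraph.neighborSet v).ncard = 2 := by
    rw [Set.ncard_image_of_injective, e1]
    intro x y h
    simpa using Sym2.congr_right.1 h
  have e3 : Disjoint {e | e ∈ w.edges ∧ v ∉ e} ((fun y => s(v, y)) '' w.toSubgraph.neighborSet v) := by
    rw [Set.disjoint_left]
    rintro e ⟨_, he⟩ ⟨y, _, rfl⟩
    simp at he
  have e4 : {e | e ∈ w.edges ∧ v ∉ e} ∪ ((fun y => s(v, y)) '' w.toSubgraph.neighborSet v) ⊆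
      (w.edges.toFinset : Set (Sym2 V)) := by
    rintro e (he | ⟨y, hy, rfl⟩)
    · simpa using he.1
    · simpa using Walk.adj_toSubgraph_iff_mem_edges.1 hy
  have e5 := Set.ncard_le_ncard e4 (Set.toFinite _)
  rw [Set.ncard_union_eq e3 (Set.toFinite _) (Set.toFinite _), e2, Set.ncard_coe_finset] at e5
  have := List.toFinset_card_le w.edges
  rw [Walk.length_edges] at this
  omega

/-- Let `T` be a finite tree which is not a path (i.e. has no spanning path), and let `P`
(the walk `w` from `a` to `b`) be a path in `T` whose end vertices are pendant vertices of
`T` and which contains exactly one vertex `v` of degree `3` or more in `T`.  Then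
`p(T) = p(T ∖ P) + 1`, where `T ∖ P` is the induced subgraph on the vertices not on `P`. -/
theorem pathCoverNumber_delete_special_path {V : Type*} [Fintype V] [DecidableEq V]
    (T : SimpleGraph V) [DecidableRel T.Adj] (hT : T.IsTree)
    (hnotpath : ¬ ∃ (x y : V) (p : T.Walk x y), p.IsPath ∧ ∀ z : V, z ∈ p.support)
    (a b : V) (w : T.Walk a b) (hw : w.IsPath)
    (ha : T.degree a = 1) (hb : T.degree b = 1)
    (v : V) (hv : v ∈ w.support) (hv3 : 3 ≤ T.degree v)
    (hvuniq : ∀ x : V, x ∈ w.support → 3 ≤ T.degree x → x = v) :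
    pathCoverNumber T = pathCoverNumber (T.induce {x : V | x ∉ w.support}) + 1 := by
  apply le_antisymm
  · exact Nat.sInf_le (HPC_add T w hw _ (HPC_pathCoverNumber _))
  obtain ⟨H, hHT, hdeg, hcomp⟩ := exists_sub T _ (HPC_pathCoverNumber T)
  have hva : v ≠ a := by rintro rfl; omega
  have hvb : v ≠ b := by rintro rfl; omega
  have hnil : ¬ w.Nil := by
    intro hn
    cases w with
    | nil => simp at hv; exact hva hv
    | cons _ _ => simp at hn
  -- every edge of `T` at a vertex of `P` other than `v` is an edge of `P`
  have hedge : ∀ x ∈ w.support, x ≠ v → ∀ y, T.Adj x y → s(x, y) ∈ w.edges := by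
    intro x hx hxv y hxy
    have hsub : w.toSubgraph.neighborSet x ⊆ T.neighborSet x := fun z hz => Subgraph.Adj.adj_sub hz
    have hTx : (T.neighborSet x).ncard = T.degree x := by
      rw [← card_neighborSet_eq_degree, ← Nat.card_eq_fintype_card]; rfl
    have hle : (T.neighborSet x).ncard ≤ (w.toSubgraph.neighborSet x).ncard := by
      rw [hTx]
      by_cases h1 : x = a
      · subst h1
        rw [hw.neighborSet_toSubgraph_startpoint hnil, ha]; simp
      by_cases h2 : x = b
      · subst h2
        rw [hw.neighborSet_toSubgraph_endpoint hnil, hb]; simp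
      rw [path_nbr_eq w hw x hx h1 h2]
      by_contra h
      exact hxv (hvuniq x hx (by omega))
    have heq := Set.eq_of_subset_of_ncard_le hsub hle (Set.toFinite _)
    have : y ∈ w.toSubgraph.neighborSet x := by rw [heq]; exact hxy
    exact Walk.adj_toSubgraph_iff_mem_edges.1 this
  set S : Set V := {x : V | x ∉ w.support} with hS
  have hHa : H.IsAcyclic := hT.isAcyclic.anti hHT
  have f1 := forest_card H hHa
  have : Fintype S := Fintype.ofFinite _
  have f2 := forest_card (H.induce S) (hHa.induce S)
  have hcover : H.edgeSet ⊆ (Sym2.map Subtype.val '' (H.induce S).edgeSet) ∪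
      ({e | e ∈ w.edges ∧ v ∉ e} ∪ H.incidenceSet v) := by
    intro e he
    by_cases hve : v ∈ e
    · exact Or.inr (Or.inr ⟨he, hve⟩)
    induction e using Sym2.ind with
    | _ x y =>
      have hxv : x ≠ v := by rintro rfl; simp at hve
      have hyv : y ≠ v := by rintro rfl; simp at hve
      have hxy : H.Adj x y := he
      by_cases hx : x ∈ w.support
      · exact Or.inr (Or.inl ⟨hedge x hx hxv y (hHT hxy), hve⟩)
      by_cases hy : y ∈ w.support
      · refine Or.inr (Or.inl ⟨?_, hve⟩)
        rw [Sym2.eq_swap]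
        exact hedge y hy hyv x (hHT hxy).symm
      · exact Or.inl ⟨s(⟨x, hx⟩, ⟨y, hy⟩), hxy, rfl⟩
  have c1 := Set.ncard_le_ncard hcover (Set.toFinite _)
  have c2 := Set.ncard_union_le (Sym2.map Subtype.val '' (H.induce S).edgeSet)
      ({e | e ∈ w.edges ∧ v ∉ e} ∪ H.incidenceSet v)
  have c3 := Set.ncard_union_le {e | e ∈ w.edges ∧ v ∉ e} (H.incidenceSet v)
  have c4 := Set.ncard_image_le (f := Sym2.map (Subtype.val : S → V))
    (Set.toFinite (H.induce S).edgeSet)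
  have c5 := edges_away T w hw v hv hva hvb
  have c6 := (inc_le H v).trans (hdeg v)
  have c7 : Nat.card S + (w.length + 1) = Nat.card V := by
    have hc : Sᶜ = (w.support.toFinset : Set V) := by ext; simp [hS]
    have := Set.ncard_add_ncard_compl S
    rw [hc, Set.ncard_coe_finset, List.toFinset_card_of_nodup hw.support_nodup,
      Walk.length_support] at this
    exact this
  have hfin : pathCoverNumber (T.induce S) ≤ Nat.card (H.induce S).ConnectedComponent := by
    apply Nat.sInf_le
    refine HPC_mono (H := H.induce S) (fun x y h => hHT h) (HPC_of_deg _ fun x => ?_)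
    rw [← Set.ncard_image_of_injective _ (Subtype.val_injective : Function.Injective (Subtype.val : S → V))]
    refine le_trans (Set.ncard_le_ncard ?_ (Set.toFinite _)) (hdeg x)
    rintro _ ⟨y, hy, rfl⟩
    exact hy
  omega
end

section
/- For every tree T, the minimum number q(T) of distinct eigenvalues over all real symmetric matrices whose graph is T satisfies q(T) ≥ d(T) + 1, where d(T) is the diameter of T. -/
open Polynomial Matrix

/-- `q(G)`: the minimum number of distinct eigenvalues over all real symmetric matrices
whose graph is `G`. -/
noncomputable def minDistinctEigen {V : Type*} [Fintype V] [DecidableEq V]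
    (G : SimpleGraph V) : ℕ :=
  sInf {q | ∃ A : Matrix V V ℝ, A.IsSymm ∧ graphOf A = G ∧
    q = A.charpoly.roots.toFinset.card}

theorem aux_off {V : Type*} (A : Matrix V V ℝ) (hA : A.IsSymm) {w v : V} (hne : w ≠ v) :
    (graphOf A).Adj w v ↔ A w v ≠ 0 := by
  have h := hA.apply w v
  simp only [graphOf, SimpleGraph.fromRel_adj, h]
  tauto

theorem aux_pow {V : Type*} [Fintype V] [DecidableEq V] (A : Matrix V V ℝ) (hA : A.IsSymm)
    (hT : (graphOf A).IsTree) (u : V) (k : ℕ) :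
    (∀ v, k < (graphOf A).dist u v → (A ^ k) u v = 0) ∧
    (∀ v, k = (graphOf A).dist u v → (A ^ k) u v ≠ 0) := by
  induction k with
  | zero =>
    refine ⟨fun v hv => ?_, fun v hv => ?_⟩
    · have : u ≠ v := by rintro rfl; simp at hv
      simp [Matrix.one_apply, this]
    · have : u = v := (hT.connected.dist_eq_zero_iff).1 hv.symm
      simp [this]
  | succ k ih =>
    have adj : ∀ w v, A w v ≠ 0 → w = v ∨ (graphOf A).Adj w v := by
      intro w v h
      by_cases hwv : w = v
      · exact Or.inl hwv
      · exact Or.inr ((aux_off A hA hwv).2 h)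
    have step : ∀ w v, (graphOf A).Adj w v →
        (graphOf A).dist u v ≤ (graphOf A).dist u w + 1 := by
      intro w v h
      have := hT.connected.dist_triangle (u := u) (v := w) (w := v)
      rwa [SimpleGraph.dist_eq_one_iff_adj.2 h] at this
    refine ⟨fun v hv => ?_, fun v hv => ?_⟩
    · rw [pow_succ, Matrix.mul_apply]
      refine Finset.sum_eq_zero fun w _ => ?_
      by_cases h0 : A w v = 0
      · simp [h0]
      · have : k < (graphOf A).dist u w := by
          rcases adj w v h0 with rfl | h
          · omega
          · have := step w v h
            omega
        rw [ih.1 w this, zero_mul]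
    · obtain ⟨p, hp⟩ := hT.connected.exists_walk_length_eq_dist u v
      have hpp := p.isPath_of_length_eq_dist hp
      have hnil : ¬ p.Nil := by
        intro h
        have := SimpleGraph.Walk.nil_iff_length_eq.1 h
        omega
      have hadj := p.adj_penultimate hnil
      have uniq : ∀ w, (graphOf A).Adj w v → (graphOf A).dist u w = k → w = p.penultimate := by
        intro w hw hd
        obtain ⟨q, hq⟩ := hT.connected.exists_walk_length_eq_dist u w
        have hq' := (q.concat hw).isPath_of_length_eq_dist (by
          rw [SimpleGraph.Walk.length_concat]; omega)
        have e : q.concat hw = p := (hT.existsUnique_path u v).unique hq' hpp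
        rw [← e, SimpleGraph.Walk.penultimate_concat]
      have hdist : (graphOf A).dist u p.penultimate = k := by
        have h1 := step _ _ hadj
        have h2 := SimpleGraph.dist_le p.dropLast
        have h3 : p.dropLast.length = p.length - 1 := by simp
        omega
      rw [pow_succ, Matrix.mul_apply, Finset.sum_eq_single p.penultimate]
      · exact mul_ne_zero (ih.2 _ hdist.symm) ((aux_off A hA hadj.ne).1 hadj)
      · intro w _ hw
        by_cases h0 : A w v = 0
        · simp [h0]
        · have : k < (graphOf A).dist u w := by
            rcases adj w v h0 with rfl | h
            · omega
            · have := step w v h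
              have h4 := mt (uniq w h) hw
              omega
          rw [ih.1 w this, zero_mul]
      · simp

theorem aux_annih {V : Type*} [Fintype V] [DecidableEq V] (A : Matrix V V ℝ) (hA : A.IsSymm) :
    aeval A (∏ x ∈ A.charpoly.roots.toFinset, (X - C x)) = 0 := by
  have hH : A.IsHermitian := by
    rw [Matrix.IsHermitian, Matrix.conjTranspose_eq_transpose_of_trivial]; exact hA
  set p : ℝ[X] := ∏ x ∈ A.charpoly.roots.toFinset, (X - C x) with hp
  have hroot : ∀ i, p.eval (hH.eigenvalues i) = 0 := by
    intro i
    rw [hp, eval_prod]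
    refine Finset.prod_eq_zero (i := hH.eigenvalues i) ?_ (by simp)
    rw [hH.roots_charpoly_eq_eigenvalues]
    simp
  have h1 : aeval (diagonalAlgHom ℝ hH.eigenvalues) p = 0 := by
    rw [aeval_algHom_apply]
    have : aeval hH.eigenvalues p = 0 := by
      ext i
      rw [← Pi.evalAlgHom_apply ℝ (fun _ => ℝ) i (aeval hH.eigenvalues p), ← aeval_algHom_apply]
      simpa using hroot i
    rw [this, map_zero]
  have h2 : A = (Unitary.conjStarAlgAut ℝ _ hH.eigenvectorUnitary).toAlgEquiv.toAlgHom
      (diagonalAlgHom ℝ hH.eigenvalues) := hH.spectral_theorem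
  rw [h2, aeval_algHom_apply, h1, map_zero]

theorem diam_add_one_le_minDistinctEigen {V : Type*} [Fintype V] [DecidableEq V]
    (T : SimpleGraph V) (hT : T.IsTree) :
    T.diam + 1 ≤ minDistinctEigen T := by
  have hne : {q | ∃ A : Matrix V V ℝ, A.IsSymm ∧ graphOf A = T ∧
    q = A.charpoly.roots.toFinset.card}.Nonempty := by
    classical
    refine ⟨_, T.adjMatrix ℝ, T.isSymm_adjMatrix, ?_, rfl⟩
    ext a b
    simp only [graphOf, SimpleGraph.fromRel_adj, SimpleGraph.adjMatrix_apply]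
    have := T.adj_comm a b
    constructor
    · rintro ⟨_, h⟩
      by_contra h'
      simp [h', ← this] at h
    · intro h
      exact ⟨h.ne, by simp [h]⟩
  obtain ⟨A, hA, rfl, hq⟩ := Nat.sInf_mem hne
  unfold minDistinctEigen
  rw [hq]
  by_contra hlt
  haveI : Nonempty V := hT.connected.nonempty
  obtain ⟨u, v, huv⟩ := (graphOf A).exists_dist_eq_diam
  set d := (graphOf A).diam
  set p : ℝ[X] := ∏ x ∈ A.charpoly.roots.toFinset, (X - C x) with hp
  have hpm : p.Monic := monic_prod_X_sub_C _ _
  have hpd : p.natDegree = A.charpoly.roots.toFinset.card := by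
    rw [hp, natDegree_finset_prod_X_sub_C_eq_card]
  set r : ℝ[X] := X ^ (d - p.natDegree) * p with hr
  have hrm : r.Monic := (monic_X_pow _).mul hpm
  have hrd : r.natDegree = d := by
    rw [hr, (monic_X_pow _).natDegree_mul hpm, natDegree_X_pow]; omega
  have hr0 : aeval A r = 0 := by rw [hr, map_mul, aux_annih A hA, mul_zero]
  rw [aeval_eq_sum_range, hrd, Finset.sum_range_succ] at hr0
  have hc : r.coeff d = 1 := by rw [← hrd]; exact hrm
  have h := congrFun (congrFun hr0 u) v
  rw [hc, one_smul, Matrix.add_apply, Matrix.sum_apply, Finset.sum_eq_zero, zero_add] at h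
  · exact (aux_pow A hA hT u d).2 v huv.symm h
  · intro i hi
    rw [Matrix.smul_apply, (aux_pow A hA hT u i).1 v (by rw [huv]; simpa using hi), smul_zero]
end

section
/- Let W be the (3,ℓ)-whirl with ℓ ≥ 2. Then the minimum number q(W) of distinct eigenvalues over all real symmetric matrices whose graph is W satisfies q(W) ≥ 9·d(W)/8 + 1/2 = d(W) + 1 + (ℓ−1)/4 > d(W) + 1, where d(W) = 2ℓ + 2 is the diameter of W. -/
open Polynomial Matrix

/-- The generalized `k`-whirl with leg lengths `L`: a tree consisting of an axis vertex
(`Sum.inl ()`), `k` vertices `v_1, …, v_k` adjacent to the axis (`Sum.inr (Sum.inl i)`),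
and, for each `i` and each `j : Fin 2`, a pendant path (leg) with `L (i, j)` vertices
attached at `v_i`. -/
def genWhirl (k : ℕ) (L : Fin k × Fin 2 → ℕ) :
    SimpleGraph (Unit ⊕ Fin k ⊕ ((p : Fin k × Fin 2) × Fin (L p))) :=
  SimpleGraph.fromRel (fun a b =>
    match a, b with
    | Sum.inl _, Sum.inr (Sum.inl _) => True
    | Sum.inr (Sum.inl i), Sum.inr (Sum.inr q) => q.1.1 = i ∧ (q.2 : ℕ) = 0
    | Sum.inr (Sum.inr q), Sum.inr (Sum.inr q') => q.1 = q'.1 ∧ (q.2 : ℕ) + 1 = (q'.2 : ℕ)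
    | _, _ => False)

/-- The `(k,ℓ)`-whirl: the generalized `k`-whirl all of whose `2k` legs have `ℓ`
vertices; it has `2kℓ + k + 1` vertices and diameter `2ℓ + 2`. -/
def whirl (k ℓ : ℕ) : SimpleGraph (Unit ⊕ Fin k ⊕ ((p : Fin k × Fin 2) × Fin ℓ)) :=
  genWhirl k (fun _ => ℓ)

namespace WhirlAux

abbrev WV (ℓ : ℕ) := Unit ⊕ Fin 3 ⊕ ((_ : Fin 3 × Fin 2) × Fin ℓ)

abbrev ax (ℓ : ℕ) : WV ℓ := Sum.inl ()
abbrev hub {ℓ : ℕ} (i : Fin 3) : WV ℓ := Sum.inr (Sum.inl i)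
abbrev leg {ℓ : ℕ} (p : Fin 3 × Fin 2) (t : Fin ℓ) : WV ℓ := Sum.inr (Sum.inr ⟨p, t⟩)

theorem WV.cases {ℓ : ℕ} {P : WV ℓ → Prop} (h1 : P (ax ℓ)) (h2 : ∀ i, P (hub i))
    (h3 : ∀ p t, P (leg p t)) (w : WV ℓ) : P w := by
  rcases w with ⟨⟩ | i | ⟨p, t⟩
  · exact h1
  · exact h2 i
  · exact h3 p t

variable {ℓ : ℕ}

theorem adj_ax_hub (i : Fin 3) : (whirl 3 ℓ).Adj (ax ℓ) (hub i) := by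
  simp [whirl, genWhirl]

theorem not_adj_ax_leg (p : Fin 3 × Fin 2) (t : Fin ℓ) : ¬ (whirl 3 ℓ).Adj (ax ℓ) (leg p t) := by
  simp [whirl, genWhirl]

theorem not_adj_hub_hub (i j : Fin 3) : ¬ (whirl 3 ℓ).Adj (hub i) (hub j) := by
  simp [whirl, genWhirl]

theorem adj_hub_leg (i : Fin 3) (p : Fin 3 × Fin 2) (t : Fin ℓ) :
    (whirl 3 ℓ).Adj (hub i) (leg p t) ↔ p.1 = i ∧ (t : ℕ) = 0 := by
  simp [whirl, genWhirl]

theorem adj_leg_leg (p p' : Fin 3 × Fin 2) (t t' : Fin ℓ) :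
    (whirl 3 ℓ).Adj (leg p t) (leg p' t') ↔
      p = p' ∧ ((t : ℕ) + 1 = t' ∨ (t' : ℕ) + 1 = t) := by
  simp only [whirl, genWhirl, SimpleGraph.fromRel_adj]
  constructor
  · rintro ⟨_, ⟨h1, h2⟩ | ⟨h1, h2⟩⟩
    · exact ⟨h1, Or.inl h2⟩
    · exact ⟨h1.symm, Or.inr h2⟩
  · rintro ⟨rfl, h⟩
    refine ⟨?_, ?_⟩
    · intro h'
      simp at h'
      subst h'
      omega
    · rcases h with h | h
      · exact Or.inl ⟨rfl, h⟩
      · exact Or.inr ⟨rfl, h⟩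

/-- pattern -/
structure Pat (M : Matrix (WV ℓ) (WV ℓ) ℝ) : Prop where
  symm : M.IsSymm
  off : ∀ u w, u ≠ w → (M u w ≠ 0 ↔ (whirl 3 ℓ).Adj u w)

variable {M : Matrix (WV ℓ) (WV ℓ) ℝ}

theorem Pat.ne (h : Pat M) {u w : WV ℓ} (ha : (whirl 3 ℓ).Adj u w) : M u w ≠ 0 :=
  (h.off u w ha.ne).2 ha

theorem Pat.ze (h : Pat M) {u w : WV ℓ} (hn : u ≠ w) (ha : ¬ (whirl 3 ℓ).Adj u w) : M u w = 0 := by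
  by_contra h0
  exact ha ((h.off u w hn).1 h0)

theorem Pat.comm (h : Pat M) (u w : WV ℓ) : M u w = M w u := h.symm.apply w u

theorem force {x : WV ℓ → ℝ} {u w : WV ℓ} (h0 : (M *ᵥ x) u = 0) (hw : M u w ≠ 0)
    (h : ∀ w', w' ≠ w → M u w' = 0 ∨ x w' = 0) : x w = 0 := by
  rw [Matrix.mulVec, dotProduct, Finset.sum_eq_single w] at h0
  · simpa [hw] using h0
  · intro b _ hb
    rcases h b hb with h | h <;> simp [h]
  · simp

theorem single_val {x : WV ℓ → ℝ} {u w : WV ℓ}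
    (h : ∀ w', w' ≠ w → M u w' = 0 ∨ x w' = 0) : (M *ᵥ x) u = M u w * x w := by
  rw [Matrix.mulVec, dotProduct, Finset.sum_eq_single w]
  · intro b _ hb
    rcases h b hb with h | h <;> simp [h]
  · simp

theorem Pat.pair (h : Pat M) (x y : WV ℓ → ℝ) : y ⬝ᵥ (M *ᵥ x) = (M *ᵥ y) ⬝ᵥ x := by
  rw [Matrix.dotProduct_mulVec, ← Matrix.mulVec_transpose, h.symm.eq]

theorem leg_zero (h : Pat M) {x : WV ℓ → ℝ} (p : Fin 3 × Fin 2)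
    (hr : ∀ t, (M *ᵥ x) (leg p t) = 0) (hh : x (hub p.1) = 0)
    (h0 : ∀ t : Fin ℓ, (t : ℕ) = 0 → x (leg p t) = 0) : ∀ t, x (leg p t) = 0 := by
  have key : ∀ n : ℕ, ∀ t : Fin ℓ, (t : ℕ) = n → x (leg p t) = 0 := by
    intro n
    induction n using Nat.strong_induction_on with
    | _ n ih =>
      intro t ht
      rcases n with _ | n
      · exact h0 t ht
      · have hn : n < ℓ := by omega
        refine force (hr ⟨n, hn⟩) (w := leg p t) (h.ne ?_) ?_
        · rw [adj_leg_leg]; simp [ht]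
        · refine WV.cases ?_ ?_ ?_
          · intro _
            left
            refine h.ze (by simp) (fun hA => not_adj_ax_leg _ _ hA.symm)
          · intro i _
            by_cases hi : i = p.1
            · right; rw [hi]; exact hh
            · left
              refine h.ze (by simp) (fun hA => ?_)
              rw [SimpleGraph.adj_comm, adj_hub_leg] at hA
              exact hi hA.1.symm
          · intro p' t' hne
            by_cases hp : p = p'
            · subst hp
              have htt : t' ≠ t := fun hc => hne (by rw [hc])
              by_cases hle : (t' : ℕ) ≤ n
              · right; exact ih t' (by omega) t' rfl
              · left
                refine h.ze ?_ (fun hA => ?_)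
                · intro hc; simp at hc; rw [← hc] at hle; simp at hle
                · rw [adj_leg_leg] at hA
                  apply htt
                  ext
                  have := hA.2
                  simp at this
                  omega
            · left
              refine h.ze (by simp [hp]) (fun hA => ?_)
              rw [adj_leg_leg] at hA
              exact hp hA.1
  exact fun t => key t t rfl

open Classical in
/-- restriction -/
noncomputable def res (S : Set (WV ℓ)) (x : WV ℓ → ℝ) : WV ℓ → ℝ := fun u => if u ∈ S then x u else 0

theorem res_in {S : Set (WV ℓ)} {x : WV ℓ → ℝ} {u} (hu : u ∈ S) : res S x u = x u := by
  simp [res, hu]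
theorem res_out {S : Set (WV ℓ)} {x : WV ℓ → ℝ} {u} (hu : u ∉ S) : res S x u = 0 := by
  simp [res, hu]

theorem res_row {S : Set (WV ℓ)} {x : WV ℓ → ℝ} {u : WV ℓ}
    (h : ∀ w, w ∉ S → M u w = 0 ∨ x w = 0) : (M *ᵥ res S x) u = (M *ᵥ x) u := by
  simp only [Matrix.mulVec, dotProduct]
  refine Finset.sum_congr rfl fun w _ => ?_
  by_cases hw : w ∈ S
  · rw [res_in hw]
  · rw [res_out hw]
    rcases h w hw with h | h <;> simp [h]

def legS (p : Fin 3 × Fin 2) : Set (WV ℓ) := {u | ∃ t, u = leg p t}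
def brS (i : Fin 3) : Set (WV ℓ) := {u | u = hub i ∨ ∃ j t, u = leg (i, j) t}

theorem legS_sep (h : Pat M) {p : Fin 3 × Fin 2} {u w : WV ℓ} (hu : u ∈ legS p) (hw : w ∉ legS p)
    (hh : w ≠ hub p.1) : M u w = 0 := by
  obtain ⟨t, rfl⟩ := hu
  refine h.ze (fun hc => hw ⟨t, hc.symm⟩) ?_
  suffices H : ∀ w : WV ℓ, w ∉ legS p → w ≠ hub p.1 → ¬(whirl 3 ℓ).Adj (leg p t) w from H w hw hh
  clear hw hh w
  refine WV.cases ?_ ?_ ?_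
  · intro _ _ hA; exact not_adj_ax_leg _ _ hA.symm
  · intro i _ hh hA
    rw [SimpleGraph.adj_comm, adj_hub_leg] at hA
    exact hh (by rw [hA.1])
  · intro p' t' hw _ hA
    rw [adj_leg_leg] at hA
    exact hw ⟨t', by rw [hA.1]⟩

theorem brS_sep (h : Pat M) {i : Fin 3} {u w : WV ℓ} (hu : u ∈ brS i) (hw : w ∉ brS i)
    (hh : w ≠ ax ℓ) : M u w = 0 := by
  refine h.ze (fun hc => hw (hc ▸ hu)) ?_
  suffices H : ∀ w : WV ℓ, w ∉ brS i → w ≠ ax ℓ → ¬(whirl 3 ℓ).Adj u w from H w hw hh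
  clear hw hh w
  rcases hu with rfl | ⟨j, t, rfl⟩
  · refine WV.cases ?_ ?_ ?_
    · intro _ hh; exact absurd rfl hh
    · intro i' _ _; exact not_adj_hub_hub _ _
    · rintro ⟨a, b⟩ t' hw _ hA
      rw [adj_hub_leg] at hA
      exact hw (Or.inr ⟨b, t', by rw [← hA.1]⟩)
  · refine WV.cases ?_ ?_ ?_
    · intro _ hh; exact absurd rfl hh
    · intro i' hw _ hA
      rw [SimpleGraph.adj_comm, adj_hub_leg] at hA
      exact hw (Or.inl (by rw [← hA.1]))
    · rintro p t' hw _ hA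
      rw [adj_leg_leg] at hA
      exact hw (Or.inr ⟨j, t', by rw [hA.1]⟩)

/-- leg singular -/
def LS (M : Matrix (WV ℓ) (WV ℓ) ℝ) (p : Fin 3 × Fin 2) : Prop :=
  ∃ y : WV ℓ → ℝ, y ≠ 0 ∧ (∀ u, u ∉ legS p → y u = 0) ∧ ∀ u, u ∈ legS p → (M *ᵥ y) u = 0

theorem hub_notin (p : Fin 3 × Fin 2) (i) : (hub i : WV ℓ) ∉ legS p := by
  rintro ⟨t, ht⟩; simp at ht

theorem ax_notin_br (i) : (ax ℓ) ∉ brS i := by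
  rintro (h | ⟨j, t, ht⟩) <;> simp_all

/-- Only first leg vertex matters for hub row on leg-supported vectors. -/
theorem hub_row (h : Pat M) (hl : 0 < ℓ) {p : Fin 3 × Fin 2} {y : WV ℓ → ℝ}
    (hy : ∀ u, u ∉ legS p → y u = 0) :
    (M *ᵥ y) (hub p.1) = M (hub p.1) (leg p ⟨0, hl⟩) * y (leg p ⟨0, hl⟩) := by
  refine single_val ?_
  intro w hw
  by_cases hwl : w ∈ legS p
  · left
    obtain ⟨t, rfl⟩ := hwl
    refine h.ze (by simp) (fun hA => hw ?_)
    rw [adj_hub_leg] at hA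
    congr 1
    ext; exact hA.2
  · right; exact hy w hwl

theorem ax_row (h : Pat M) {i : Fin 3} {y : WV ℓ → ℝ}
    (hy : ∀ u, u ∉ brS i → y u = 0) :
    (M *ᵥ y) (ax ℓ) = M (ax ℓ) (hub i) * y (hub i) := by
  refine single_val ?_
  intro w hw
  by_cases hwl : w ∈ brS i
  · left
    rcases hwl with rfl | ⟨j, t, rfl⟩
    · exact absurd rfl hw
    · exact h.ze (by simp) (not_adj_ax_leg _ _)
  · right; exact hy w hwl

theorem hub_zero_of_LS (h : Pat M) (hl : 0 < ℓ) {p : Fin 3 × Fin 2} (hp : LS M p) {x : WV ℓ → ℝ}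
    (hx : M *ᵥ x = 0) : x (hub p.1) = 0 := by
  obtain ⟨y, hy0, hys, hyr⟩ := hp
  have hfirst : y (leg p ⟨0, hl⟩) ≠ 0 := by
    intro h0
    apply hy0
    have := leg_zero h (x := y) p (fun t => hyr _ ⟨t, rfl⟩) (hys _ (hub_notin _ _))
      (fun t ht => by rw [← h0]; congr 2; ext; exact ht)
    ext u
    by_cases hu : u ∈ legS p
    · obtain ⟨t, rfl⟩ := hu; exact this t
    · exact hys u hu
  have h1 := h.pair x y
  rw [hx, dotProduct_zero, dotProduct, Finset.sum_eq_single (hub p.1)] at h1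
  · rw [hub_row h hl hys] at h1
    have h2 : M (hub p.1) (leg p ⟨0, hl⟩) ≠ 0 := h.ne (by rw [adj_hub_leg]; simp)
    simpa [h2, hfirst] using h1.symm
  · intro u _ hu
    by_cases hul : u ∈ legS p
    · rw [hyr u hul, zero_mul]
    · have : (M *ᵥ y) u = 0 := by
        rw [Matrix.mulVec, dotProduct]
        refine Finset.sum_eq_zero fun w _ => ?_
        by_cases hw : w ∈ legS p
        · rw [h.comm, legS_sep h hw hul hu, zero_mul]
        · rw [hys w hw, mul_zero]
      rw [this, zero_mul]
  · simp

theorem leg_zero_of_not_LS (h : Pat M) {p : Fin 3 × Fin 2} (hp : ¬ LS M p) {x : WV ℓ → ℝ}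
    (hx : M *ᵥ x = 0) (hh : x (hub p.1) = 0) (t : Fin ℓ) : x (leg p t) = 0 := by
  by_contra hne
  apply hp
  refine ⟨res (legS p) x, ?_, fun u hu => res_out hu, ?_⟩
  · intro h0
    have := congrFun h0 (leg p t)
    rw [res_in (show leg p t ∈ legS p from ⟨t, rfl⟩)] at this
    exact hne this
  · intro u hu
    rw [res_row, hx]; · rfl
    intro w hw
    by_cases hwh : w = hub p.1
    · right; rw [hwh, hh]
    · left; exact legS_sep h hu hw hwh

theorem all_zero (h : Pat M) (hl : 0 < ℓ) {x : WV ℓ → ℝ} (hx : M *ᵥ x = 0) (hax : x (ax ℓ) = 0)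
    (hhub : ∀ i, x (hub i) = 0)
    (hleg : ∀ i, ∃ j, x (leg (i, j) ⟨0, hl⟩) = 0) : x = 0 := by
  have h1 : ∀ i j, x (leg (i, j) ⟨0, hl⟩) = 0 := by
    intro i j
    obtain ⟨j0, hj0⟩ := hleg i
    by_cases hj : j = j0
    · rw [hj, hj0]
    refine force (u := hub i) (congrFun hx _) (h.ne (by rw [adj_hub_leg]; simp)) ?_
    refine WV.cases ?_ ?_ ?_
    · intro _; right; exact hax
    · intro i' _; right; exact hhub i'
    · rintro ⟨a, b⟩ t hne
      by_cases hA : (whirl 3 ℓ).Adj (hub i) (leg (a, b) t)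
      · right
        rw [adj_hub_leg] at hA
        obtain ⟨rfl, h0⟩ := hA
        have ht : t = ⟨0, hl⟩ := by ext; exact h0
        subst ht
        have : b ≠ j := fun hc => hne (by rw [hc])
        have : b = j0 := by omega
        rw [this, hj0]
      · left; exact h.ze (by simp) hA
  ext u
  refine WV.cases (P := fun u => x u = 0) hax hhub ?_ u
  rintro ⟨i, j⟩
  refine leg_zero h (i, j) (fun t => congrFun hx _) (hhub i) ?_
  intro t ht
  have ht : t = ⟨0, hl⟩ := by ext; exact ht
  rw [ht, h1]

theorem hub_zero_of_exists (h : Pat M) {x y : WV ℓ → ℝ} (hx : M *ᵥ x = 0) (hy : M *ᵥ y = 0)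
    (hxa : x (ax ℓ) ≠ 0) (hya : y (ax ℓ) = 0) (i : Fin 3) : y (hub i) = 0 := by
  have h1 := h.pair x (res (brS i) y)
  rw [hx, dotProduct_zero, dotProduct, Finset.sum_eq_single (ax ℓ)] at h1
  · rw [ax_row h (fun u hu => res_out hu), res_in (Or.inl rfl)] at h1
    have h2 : M (ax ℓ) (hub i) ≠ 0 := h.ne (adj_ax_hub i)
    simpa [h2, hxa] using h1.symm
  · intro u _ hu
    have : (M *ᵥ (res (brS i) y)) u = 0 := by
      by_cases hub : u ∈ brS i
      · rw [res_row, hy]; · rfl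
        intro w hw
        by_cases hwa : w = ax ℓ
        · right; rw [hwa, hya]
        · left; exact brS_sep h hub hw hwa
      · rw [Matrix.mulVec, dotProduct]
        refine Finset.sum_eq_zero fun w _ => ?_
        by_cases hw : w ∈ brS i
        · rw [h.comm, brS_sep h hw hub hu, zero_mul]
        · rw [res_out hw, mul_zero]
    rw [this, zero_mul]
  · simp

/-- third hub forced -/
theorem hub_third (h : Pat M) {x : WV ℓ → ℝ} (hx : M *ᵥ x = 0) (hax : x (ax ℓ) = 0) (i : Fin 3)
    (hi : ∀ j, j ≠ i → x (hub j) = 0) : x (hub i) = 0 := by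
  refine force (u := ax ℓ) (congrFun hx _) (h.ne (adj_ax_hub i)) ?_
  refine WV.cases ?_ ?_ ?_
  · intro _; right; exact hax
  · intro j hj; right; exact hi j (fun hc => hj (by rw [hc]))
  · intro p t _; left; exact h.ze (by simp) (not_adj_ax_leg _ _)

abbrev Ker (M : Matrix (WV ℓ) (WV ℓ) ℝ) : Submodule ℝ (WV ℓ → ℝ) := LinearMap.ker (Matrix.toLin' M)

theorem mem_Ker {x : WV ℓ → ℝ} : x ∈ Ker M ↔ M *ᵥ x = 0 := by
  simp [Ker]

/-- dimension bound by coordinates -/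
theorem dim_le {ι : Type} [Fintype ι] (f : ι → WV ℓ)
    (h : ∀ x, M *ᵥ x = 0 → (∀ i, x (f i) = 0) → x = 0) :
    Module.finrank ℝ (Ker M) ≤ Fintype.card ι := by
  have := LinearMap.finrank_le_finrank_of_injective (R := ℝ)
    (f := (LinearMap.funLeft ℝ ℝ f).comp (Ker M).subtype) ?_
  · simpa using this
  · rw [← LinearMap.ker_eq_bot, LinearMap.ker_eq_bot']
    rintro ⟨x, hx⟩ h0
    ext1
    refine h x (mem_Ker.1 hx) fun i => ?_
    exact congrFun h0 i

theorem simple_of_psd (h : Pat M) (hl : 0 < ℓ) (hp : M.PosSemidef) :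
    Module.finrank ℝ (Ker M) ≤ 1 := by
  have hps : ∀ z : WV ℓ → ℝ, z ⬝ᵥ (M *ᵥ z) = 0 → M *ᵥ z = 0 := by
    intro z hz
    exact (hp.dotProduct_mulVec_zero_iff z).1 (by simpa using hz)
  refine (dim_le (fun _ : Unit => ax ℓ) ?_).trans (by simp)
  intro x hx hax
  replace hax := hax ()
  have hhub : ∀ i, x (hub i) = 0 := by
    intro i
    have hz : M *ᵥ (res (brS i) x) = 0 := by
      apply hps
      rw [dotProduct]
      refine Finset.sum_eq_zero fun u _ => ?_
      by_cases hu : u ∈ brS i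
      · rw [res_row, hx]; · simp
        intro w hw
        by_cases hwa : w = ax ℓ
        · right; rw [hwa, hax]
        · left; exact brS_sep h hu hw hwa
      · rw [res_out hu, zero_mul]
    have h1 := congrFun hz (ax ℓ)
    rw [ax_row h (fun u hu => res_out hu), res_in (Or.inl rfl)] at h1
    have h2 : M (ax ℓ) (hub i) ≠ 0 := h.ne (adj_ax_hub i)
    simpa [h2] using h1
  refine all_zero h hl hx hax hhub fun i => ⟨0, ?_⟩
  have hz : M *ᵥ (res (legS (i, 0)) x) = 0 := by
    apply hps
    rw [dotProduct]
    refine Finset.sum_eq_zero fun u _ => ?_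
    by_cases hu : u ∈ legS (i, 0)
    · rw [res_row, hx]; · simp
      intro w hw
      by_cases hwa : w = hub i
      · right; rw [hwa, hhub]
      · left; exact legS_sep h hu hw hwa
    · rw [res_out hu, zero_mul]
  have h1 := congrFun hz (hub i)
  rw [hub_row h hl (p := (i, 0)) (fun u hu => res_out hu), 
    res_in (show leg (i, 0) ⟨0, hl⟩ ∈ legS (i, 0) from ⟨_, rfl⟩)] at h1
  have h2 : M (hub i) (leg (i, 0) ⟨0, hl⟩) ≠ 0 := h.ne (by rw [adj_hub_leg]; simp)
  simpa [h2] using h1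

open Classical in
/-- the set of doubly singular branches -/
noncomputable def Bs (M : Matrix (WV ℓ) (WV ℓ) ℝ) : Finset (Fin 3) :=
  Finset.univ.filter fun i => LS M (i, 0) ∧ LS M (i, 1)

theorem leg_ex (h : Pat M) (hl : 0 < ℓ) {i : Fin 3} (hi : i ∉ Bs M) {x : WV ℓ → ℝ}
    (hx : M *ᵥ x = 0) (hh : x (hub i) = 0) : ∃ j, x (leg (i, j) ⟨0, hl⟩) = 0 := by
  simp only [Bs, Finset.mem_filter, Finset.mem_univ, true_and, not_and_or] at hi
  rcases hi with hi | hi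
  · exact ⟨0, leg_zero_of_not_LS h hi hx hh _⟩
  · exact ⟨1, leg_zero_of_not_LS h hi hx hh _⟩

theorem hub_Bs (h : Pat M) (hl : 0 < ℓ) {i : Fin 3} (hi : i ∈ Bs M) {x : WV ℓ → ℝ}
    (hx : M *ᵥ x = 0) : x (hub i) = 0 := by
  simp only [Bs, Finset.mem_filter, Finset.mem_univ, true_and] at hi
  exact hub_zero_of_LS h hl hi.1 hx

/-- the coordinates used on branches -/
noncomputable def tc (M : Matrix (WV ℓ) (WV ℓ) ℝ) (hl : 0 < ℓ) (i : Fin 3) : WV ℓ :=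
  if i ∈ Bs M then leg (i, 0) ⟨0, hl⟩ else hub i

theorem hub_of_tc (h : Pat M) (hl : 0 < ℓ) {i : Fin 3} {x : WV ℓ → ℝ}
    (hx : M *ᵥ x = 0) (ht : x (tc M hl i) = 0) : x (hub i) = 0 := by
  by_cases hi : i ∈ Bs M
  · exact hub_Bs h hl hi hx
  · simpa [tc, hi] using ht

theorem leg_of_tc (h : Pat M) (hl : 0 < ℓ) {i : Fin 3} {x : WV ℓ → ℝ}
    (hx : M *ᵥ x = 0) (ht : x (tc M hl i) = 0) : ∃ j, x (leg (i, j) ⟨0, hl⟩) = 0 := by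
  by_cases hi : i ∈ Bs M
  · exact ⟨0, by simpa [tc, hi] using ht⟩
  · exact leg_ex h hl hi hx (hub_of_tc h hl hx ht)

open Classical in
theorem dim_bound (h : Pat M) (hl : 0 < ℓ) :
    2 * Module.finrank ℝ (Ker M) ≤ 4 + (Bs M).card + (if M (ax ℓ) (ax ℓ) = 0 then 1 else 0) := by
  by_cases hc : ∃ x, M *ᵥ x = 0 ∧ x (ax ℓ) ≠ 0
  · obtain ⟨x0, hx0, hx0a⟩ := hc
    have h1 : Module.finrank ℝ (Ker M) ≤ (Bs M).card + 1 := by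
      refine (dim_le (ι := Option (Bs M))
        (fun o => o.elim (ax ℓ) (fun i => leg (i.1, 0) ⟨0, hl⟩)) ?_).trans (by simp)
      intro y hy hy0
      have hya : y (ax ℓ) = 0 := hy0 none
      have hh := hub_zero_of_exists h hx0 hy hx0a hya
      refine all_zero h hl hy hya hh fun i => ?_
      by_cases hi : i ∈ Bs M
      · exact ⟨0, hy0 (some ⟨i, hi⟩)⟩
      · exact leg_ex h hl hi hy (hh i)
    have h3 : (Bs M).card ≤ 3 := (Finset.card_le_univ _).trans (by simp)
    by_cases hB : (Bs M).card = 3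
    · have hall : ∀ i, i ∈ Bs M := by
        have : Bs M = Finset.univ := by
          rw [← Finset.card_eq_iff_eq_univ, hB]; simp
        simp [this]
      have ha : M (ax ℓ) (ax ℓ) = 0 := by
        by_contra hne
        apply hx0a
        refine force (congrFun hx0 (ax ℓ)) hne ?_
        refine WV.cases ?_ ?_ ?_
        · intro hc; exact absurd rfl hc
        · intro i _; right; exact hub_Bs h hl (hall i) hx0
        · intro p t _; left; exact h.ze (by simp) (not_adj_ax_leg _ _)
      rw [if_pos ha]
      omega
    · omega
  · push Not at hc
    by_cases hB : 2 ≤ (Bs M).card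
    · have h1 : Module.finrank ℝ (Ker M) ≤ 3 := by
        refine (dim_le (tc M hl) ?_).trans (by simp)
        intro y hy hy0
        exact all_zero h hl hy (hc y hy) (fun i => hub_of_tc h hl hy (hy0 i))
          (fun i => leg_of_tc h hl hy (hy0 i))
      omega
    · have hk : ∃ k, k ∉ Bs M := by
        by_contra hcon
        push Not at hcon
        have : Bs M = Finset.univ := by ext; simp [hcon]
        rw [this] at hB
        simp at hB
      obtain ⟨k, hk⟩ := hk
      have h1 : Module.finrank ℝ (Ker M) ≤ 2 := by
        refine (dim_le (ι := {i : Fin 3 // i ≠ k}) (fun i => tc M hl i.1) ?_).trans ?_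
        · intro y hy hy0
          have hh : ∀ i, i ≠ k → y (hub i) = 0 := fun i hi => hub_of_tc h hl hy (hy0 ⟨i, hi⟩)
          have hhk := hub_third h hy (hc y hy) k hh
          have hh' : ∀ i, y (hub i) = 0 := fun i => by
            by_cases hi : i = k
            · rw [hi, hhk]
            · exact hh i hi
          refine all_zero h hl hy (hc y hy) hh' fun i => ?_
          by_cases hi : i = k
          · rw [hi]; exact leg_ex h hl hk hy hhk
          · exact leg_of_tc h hl hy (hy0 ⟨i, hi⟩)
        · simp [Fintype.card_subtype_compl]
      omega

end WhirlAux

namespace WhirlAux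
variable {ℓ : ℕ} {M A : Matrix (WV ℓ) (WV ℓ) ℝ}

theorem Pat.neg (h : Pat M) : Pat (-M) :=
  ⟨h.symm.neg, fun u w hn => by rw [← h.off u w hn]; simp⟩

theorem Pat.sub (h : Pat A) (r : ℝ) : Pat (A - r • (1 : Matrix (WV ℓ) (WV ℓ) ℝ)) := by
  refine ⟨?_, fun u w hn => by rw [← h.off u w hn]; simp [hn]⟩
  rw [Matrix.IsSymm, Matrix.transpose_sub, h.symm.eq, Matrix.transpose_smul, Matrix.transpose_one]

theorem Pat.of_graph (hs : A.IsSymm) (hg : graphOf A = whirl 3 ℓ) : Pat A := by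
  refine ⟨hs, fun u w hn => ?_⟩
  rw [← hg, graphOf, SimpleGraph.fromRel_adj, hs.apply u w]
  simp [hn]

theorem Ker_neg : Ker (-M) = Ker M := by
  ext x; rw [mem_Ker, mem_Ker, Matrix.neg_mulVec, neg_eq_zero]

abbrev sh (A : Matrix (WV ℓ) (WV ℓ) ℝ) (r : ℝ) : Matrix (WV ℓ) (WV ℓ) ℝ :=
  A - r • (1 : Matrix (WV ℓ) (WV ℓ) ℝ)

theorem sh_mulVec (r : ℝ) (x : WV ℓ → ℝ) : sh A r *ᵥ x = A *ᵥ x - r • x := by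
  rw [sh, Matrix.sub_mulVec, Matrix.smul_mulVec, Matrix.one_mulVec]

theorem herm (h : Pat A) : A.IsHermitian := by
  rw [Matrix.IsHermitian, Matrix.conjTranspose_eq_transpose_of_trivial, h.symm.eq]

theorem count_le (h : Pat A) (r : ℝ) :
    A.charpoly.roots.count r ≤ Module.finrank ℝ (Ker (sh A r)) := by
  classical
  have hA := herm h
  have hli : LinearIndependent ℝ (fun i => (WithLp.linearEquiv 2 ℝ (WV ℓ → ℝ)) (hA.eigenvectorBasis i)) := by
    have := hA.eigenvectorBasis.toBasis.linearIndependent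
    have := this.map' (WithLp.linearEquiv 2 ℝ (WV ℓ → ℝ)).toLinearMap (LinearEquiv.ker _)
    simpa [Function.comp_def] using this
  have hmem : ∀ i : {i // hA.eigenvalues i = r},
      (WithLp.linearEquiv 2 ℝ (WV ℓ → ℝ)) (hA.eigenvectorBasis i.1) ∈ Ker (sh A r) := by
    rintro ⟨i, hi⟩
    rw [mem_Ker, sh_mulVec]
    have := hA.mulVec_eigenvectorBasis i
    rw [hi] at this
    exact sub_eq_zero.2 this
  have hli2 : LinearIndependent ℝ (fun i : {i // hA.eigenvalues i = r} =>
      (⟨_, hmem i⟩ : Ker (sh A r))) := by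
    apply LinearIndependent.of_comp (Ker (sh A r)).subtype
    exact hli.comp (fun i : {i // hA.eigenvalues i = r} => i.1) Subtype.val_injective
  refine le_trans (le_of_eq ?_) hli2.fintype_card_le_finrank
  rw [hA.roots_charpoly_eq_eigenvalues, Multiset.count_map, Fintype.card_subtype]
  simp only [eq_comm, Function.comp]
  rfl

theorem root_of_mulVec {n : Type*} [Fintype n] [DecidableEq n] {P : Matrix n n ℝ} {x : n → ℝ}
    {r : ℝ} (hx : x ≠ 0) (h : P *ᵥ x = r • x) : r ∈ P.charpoly.roots := by
  rw [Polynomial.mem_roots (Matrix.charpoly_monic P).ne_zero, Polynomial.IsRoot,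
    Matrix.eval_charpoly, ← Matrix.exists_mulVec_eq_zero_iff]
  refine ⟨x, hx, ?_⟩
  rw [Matrix.sub_mulVec, h]
  simp [← Matrix.smul_one_eq_diagonal, Matrix.smul_mulVec]

theorem psd_top (h : Pat A) {r : ℝ} (hr : ∀ s ∈ A.charpoly.roots, s ≤ r) :
    (-(sh A r)).PosSemidef := by
  have hM := herm (h.sub r).neg
  rw [hM.posSemidef_iff_eigenvalues_nonneg]
  intro i
  have h1 := hM.mulVec_eigenvectorBasis i
  have h2 : (⇑(hM.eigenvectorBasis i) : WV ℓ → ℝ) ≠ 0 := by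
    intro hc
    apply hM.eigenvectorBasis.toBasis.ne_zero i
    ext j
    simpa using congrFun hc j
  have h3 : A *ᵥ ⇑(hM.eigenvectorBasis i) = (r - hM.eigenvalues i) • ⇑(hM.eigenvectorBasis i) := by
    have h4 : (-(sh A r)) *ᵥ ⇑(hM.eigenvectorBasis i) = hM.eigenvalues i • ⇑(hM.eigenvectorBasis i) := h1
    rw [Matrix.neg_mulVec, sh_mulVec] at h4
    rw [sub_smul, ← h4]
    abel
  have := hr _ (root_of_mulVec h2 h3)
  simp only [Pi.zero_apply]
  linarith

theorem psd_bot (h : Pat A) {r : ℝ} (hr : ∀ s ∈ A.charpoly.roots, r ≤ s) :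
    (sh A r).PosSemidef := by
  have hM := herm (h.sub r)
  rw [hM.posSemidef_iff_eigenvalues_nonneg]
  intro i
  have h1 := hM.mulVec_eigenvectorBasis i
  have h2 : (⇑(hM.eigenvectorBasis i) : WV ℓ → ℝ) ≠ 0 := by
    intro hc
    apply hM.eigenvectorBasis.toBasis.ne_zero i
    ext j
    simpa using congrFun hc j
  have h3 : A *ᵥ ⇑(hM.eigenvectorBasis i) = (r + hM.eigenvalues i) • ⇑(hM.eigenvectorBasis i) := by
    have h4 : (sh A r) *ᵥ ⇑(hM.eigenvectorBasis i) = hM.eigenvalues i • ⇑(hM.eigenvectorBasis i) := h1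
    rw [sh_mulVec] at h4
    rw [add_smul, ← h4]
    abel
  have := hr _ (root_of_mulVec h2 h3)
  simp only [Pi.zero_apply]
  linarith

open Classical in
theorem card_LS (p : Fin 3 × Fin 2) (R : Finset ℝ) :
    (R.filter fun r => LS (sh A r) p).card ≤ ℓ := by
  let P : Matrix (Fin ℓ) (Fin ℓ) ℝ := A.submatrix (leg p) (leg p)
  have hsub : (R.filter fun r => LS (sh A r) p) ⊆ P.charpoly.roots.toFinset := by
    intro r hr
    rw [Finset.mem_filter] at hr
    obtain ⟨_, y, hy0, hys, hyr⟩ := hr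
    rw [Multiset.mem_toFinset]
    refine root_of_mulVec (x := fun t => y (leg p t)) ?_ ?_
    · intro hc
      apply hy0
      ext u
      by_cases hu : u ∈ legS p
      · obtain ⟨t, rfl⟩ := hu
        exact congrFun hc t
      · exact hys u hu
    · ext t
      have := hyr (leg p t) ⟨t, rfl⟩
      rw [sh_mulVec, Pi.sub_apply, sub_eq_zero] at this
      refine Eq.trans ?_ this
      simp only [Matrix.mulVec, dotProduct, P, Matrix.submatrix_apply]
      refine Finset.sum_of_injOn (leg p) ?_ ?_ ?_ ?_
      · intro a _ b _ hab; simpa using hab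
      · intro a _; simp
      · intro u _ hu
        rw [hys u, mul_zero]
        rintro ⟨t, rfl⟩
        exact hu ⟨t, by simp, rfl⟩
      · intro a _; rfl
  calc _ ≤ _ := Finset.card_le_card hsub
    _ ≤ _ := Multiset.toFinset_card_le _
    _ ≤ _ := Polynomial.card_roots' _
    _ = ℓ := by rw [Matrix.charpoly_natDegree_eq_dim]; simp

open Classical in
theorem sum_Bs (R : Finset ℝ) : ∑ r ∈ R, (Bs (sh A r)).card ≤ 3 * ℓ := by
  have : ∀ r, (Bs (sh A r)).card ≤ ∑ i : Fin 3, if LS (sh A r) (i, 0) then 1 else 0 := by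
    intro r
    rw [← Finset.card_filter]
    refine Finset.card_le_card ?_
    intro i hi
    simp only [Bs, Finset.mem_filter, Finset.mem_univ, true_and] at hi ⊢
    exact hi.1
  calc _ ≤ ∑ r ∈ R, ∑ i : Fin 3, (if LS (sh A r) (i, 0) then 1 else 0) :=
        Finset.sum_le_sum fun r _ => this r
    _ = ∑ i : Fin 3, ∑ r ∈ R, (if LS (sh A r) (i, 0) then 1 else 0) := Finset.sum_comm
    _ ≤ ∑ i : Fin 3, ℓ := by
        refine Finset.sum_le_sum fun i _ => ?_
        rw [← Finset.card_filter]
        exact card_LS (i, 0) R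
    _ = 3 * ℓ := by simp

theorem main_bound (h : Pat A) (hl : 0 < ℓ) :
    9 * ℓ + 11 ≤ 4 * A.charpoly.roots.toFinset.card := by
  classical
  set R := A.charpoly.roots.toFinset with hR
  have hsum : ∑ r ∈ R, A.charpoly.roots.count r = 6 * ℓ + 4 := by
    rw [Multiset.toFinset_sum_count_eq, (herm h).roots_charpoly_eq_eigenvalues]
    simp
    ring
  have hne : R.Nonempty := by
    by_contra hc
    rw [Finset.not_nonempty_iff_eq_empty] at hc
    rw [hc] at hsum
    simp at hsum
  set mx := R.max' hne
  set mn := R.min' hne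
  have hmx : A.charpoly.roots.count mx ≤ 1 := by
    refine (count_le h mx).trans ?_
    rw [← Ker_neg]
    refine simple_of_psd (h.sub mx).neg hl (psd_top h fun s hs => ?_)
    exact R.le_max' s (by simpa [hR] using hs)
  have hmn : A.charpoly.roots.count mn ≤ 1 := by
    refine (count_le h mn).trans ?_
    refine simple_of_psd (h.sub mn) hl (psd_bot h fun s hs => ?_)
    exact R.min'_le s (by simpa [hR] using hs)
  have hdiff : mx ≠ mn := by
    intro hc
    have hall : ∀ r ∈ R, r = mn := fun r hr =>
      le_antisymm (hc ▸ R.le_max' r hr) (R.min'_le r hr)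
    have : R = {mn} := Finset.eq_singleton_iff_unique_mem.2 ⟨R.min'_mem hne, hall⟩
    rw [this, Finset.sum_singleton] at hsum
    omega
  have hpt : ∀ r ∈ R, 2 * A.charpoly.roots.count r + (if r = mx then 2 else 0)
      + (if r = mn then 2 else 0) ≤ 4 + (Bs (sh A r)).card +
        (if r = A (ax ℓ) (ax ℓ) then 1 else 0) := by
    intro r _
    by_cases h1 : r = mx
    · have h2 : r ≠ mn := fun hc => hdiff (h1 ▸ hc)
      rw [if_pos h1, if_neg h2]
      rw [← h1] at hmx
      omega
    by_cases h2 : r = mn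
    · rw [if_neg h1, if_pos h2]
      rw [← h2] at hmn
      omega
    rw [if_neg h1, if_neg h2]
    have h3 := dim_bound (h.sub r) hl
    have h4 := count_le h r
    have h5 : (sh A r) (ax ℓ) (ax ℓ) = 0 ↔ r = A (ax ℓ) (ax ℓ) := by
      simp [sh, sub_eq_zero]; exact eq_comm
    simp only [h5] at h3
    change 2 * Module.finrank ℝ (Ker (sh A r)) ≤ 4 + (Bs (sh A r)).card + _ at h3
    omega
  have htot := Finset.sum_le_sum hpt
  simp only [Finset.sum_add_distrib, ← Finset.mul_sum] at htot
  rw [hsum] at htot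
  have e1 : ∑ r ∈ R, (if r = mx then 2 else 0) = 2 := by
    simp [Finset.sum_ite_eq', R.max'_mem hne, mx]
  have e2 : ∑ r ∈ R, (if r = mn then 2 else 0) = 2 := by
    simp [Finset.sum_ite_eq', R.min'_mem hne, mn]
  have e3 : ∑ r ∈ R, (if r = A (ax ℓ) (ax ℓ) then 1 else 0) ≤ 1 := by
    rw [Finset.sum_ite_eq']
    split_ifs <;> simp
  have e4 := sum_Bs (A := A) R
  have e5 : ∑ r ∈ R, 4 = 4 * R.card := by simp [mul_comm]
  omega

theorem exists_mat (ℓ : ℕ) : ∃ A : Matrix (WV ℓ) (WV ℓ) ℝ, A.IsSymm ∧ graphOf A = whirl 3 ℓ := by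
  classical
  refine ⟨(whirl 3 ℓ).adjMatrix ℝ, SimpleGraph.isSymm_adjMatrix _, ?_⟩
  ext u w
  rw [graphOf, SimpleGraph.fromRel_adj]
  simp only [SimpleGraph.adjMatrix_apply, (whirl 3 ℓ).adj_comm w u]
  constructor
  · rintro ⟨_, h⟩
    by_contra hc
    simp [hc] at h
  · intro h
    exact ⟨h.ne, by simp [h]⟩

theorem q_bound (hl : 0 < ℓ) : 9 * ℓ + 11 ≤ 4 * minDistinctEigen (whirl 3 ℓ) := by
  have hne : {q | ∃ A : Matrix (WV ℓ) (WV ℓ) ℝ, A.IsSymm ∧ graphOf A = whirl 3 ℓ ∧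
    q = A.charpoly.roots.toFinset.card}.Nonempty := by
    obtain ⟨A, h1, h2⟩ := exists_mat ℓ
    exact ⟨_, A, h1, h2, rfl⟩
  obtain ⟨A, h1, h2, h3⟩ := Nat.sInf_mem hne
  have h4 := main_bound (Pat.of_graph h1 h2) hl
  rw [← h3] at h4
  exact h4

/-- signed depth -/
def pot : WV ℓ → ℤ
  | Sum.inl _ => 0
  | Sum.inr (Sum.inl i) => if i = 0 then 1 else -1
  | Sum.inr (Sum.inr q) => if q.1.1 = 0 then (q.2 : ℤ) + 2 else -((q.2 : ℤ) + 2)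

theorem pot_adj {u w : WV ℓ} (h : (whirl 3 ℓ).Adj u w) : pot w ≤ pot u + 1 := by
  suffices H : ∀ u w : WV ℓ, (whirl 3 ℓ).Adj u w → pot w ≤ pot u + 1 from H u w h
  clear h u w
  refine WV.cases ?_ ?_ ?_
  · refine WV.cases ?_ ?_ ?_
    · intro h; exact absurd rfl h.ne
    · intro i _; simp only [pot]; split_ifs <;> omega
    · intro p t h; exact absurd h (not_adj_ax_leg _ _)
  · intro i
    refine WV.cases ?_ ?_ ?_
    · intro _; simp only [pot]; split_ifs <;> omega
    · intro j h; exact absurd h (not_adj_hub_hub _ _)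
    · intro p t h
      rw [adj_hub_leg] at h
      obtain ⟨rfl, h⟩ := h
      simp only [pot]; split_ifs <;> omega
  · intro p t
    refine WV.cases ?_ ?_ ?_
    · intro h; exact absurd h.symm (not_adj_ax_leg _ _)
    · intro i h
      rw [SimpleGraph.adj_comm, adj_hub_leg] at h
      obtain ⟨rfl, h⟩ := h
      simp only [pot]; split_ifs <;> omega
    · intro p' t' h
      rw [adj_leg_leg] at h
      obtain ⟨rfl, h⟩ := h
      simp only [pot]; split_ifs <;> omega

theorem pot_walk {u w : WV ℓ} (p : (whirl 3 ℓ).Walk u w) : pot w ≤ pot u + p.length := by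
  induction p with
  | nil => simp
  | cons h p ih =>
    have := pot_adj h
    rw [SimpleGraph.Walk.length_cons]
    push_cast
    omega

theorem walk_hub (i : Fin 3) : (whirl 3 ℓ).edist (ax ℓ) (hub i) ≤ 1 :=
  (SimpleGraph.edist_eq_one_iff_adj.2 (adj_ax_hub i)).le

theorem walk_leg (p : Fin 3 × Fin 2) (n : ℕ) (hn : n < ℓ) :
    (whirl 3 ℓ).edist (ax ℓ) (leg p ⟨n, hn⟩) ≤ ((n + 2 : ℕ) : ℕ∞) := by
  induction n with
  | zero =>
    refine (SimpleGraph.edist_triangle (v := hub p.1)).trans ?_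
    have h2 : (whirl 3 ℓ).edist (hub p.1) (leg p ⟨0, hn⟩) = 1 :=
      SimpleGraph.edist_eq_one_iff_adj.2 (by rw [adj_hub_leg]; simp)
    rw [h2]
    refine (add_le_add_left (walk_hub _) 1).trans ?_
    norm_num
  | succ n ih =>
    refine (SimpleGraph.edist_triangle (v := leg p ⟨n, by omega⟩)).trans ?_
    have h2 : (whirl 3 ℓ).edist (leg p ⟨n, by omega⟩) (leg p ⟨n + 1, hn⟩) = 1 :=
      SimpleGraph.edist_eq_one_iff_adj.2 (by rw [adj_leg_leg]; simp)
    rw [h2]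
    refine (add_le_add_left (ih (by omega)) 1).trans ?_
    norm_cast

theorem edist_ax (u : WV ℓ) : (whirl 3 ℓ).edist (ax ℓ) u ≤ ((ℓ + 1 : ℕ) : ℕ∞) := by
  revert u
  refine WV.cases ?_ ?_ ?_
  · simp
  · intro i
    refine (walk_hub i).trans ?_
    norm_cast; omega
  · rintro p ⟨t, ht⟩
    refine (walk_leg p t ht).trans ?_
    norm_cast; omega

theorem diam_whirl (hl : 0 < ℓ) : (whirl 3 ℓ).diam = 2 * ℓ + 2 := by
  have hup : (whirl 3 ℓ).ediam ≤ ((2 * ℓ + 2 : ℕ) : ℕ∞) := by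
    refine SimpleGraph.ediam_le_of_edist_le fun u v => ?_
    refine (SimpleGraph.edist_triangle (v := ax ℓ)).trans ?_
    rw [SimpleGraph.edist_comm]
    refine (add_le_add (edist_ax u) (edist_ax v)).trans ?_
    norm_cast; omega
  have hlow : ((2 * ℓ + 2 : ℕ) : ℕ∞) ≤ (whirl 3 ℓ).ediam := by
    refine le_trans ?_ (SimpleGraph.edist_le_ediam (u := leg (1, 0) ⟨ℓ - 1, by omega⟩)
      (v := leg (0, 0) ⟨ℓ - 1, by omega⟩))
    rw [SimpleGraph.edist]
    refine le_iInf fun p => ?_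
    have := pot_walk p
    simp [pot] at this
    norm_cast
    omega
  rw [SimpleGraph.diam, le_antisymm hup hlow, ENat.toNat_natCast]

end WhirlAux

/-- For the `(3,ℓ)`-whirl `W` with `ℓ ≥ 2` and diameter `d(W) = 2ℓ + 2`, one has
`q(W) ≥ 9 d(W)/8 + 1/2 = d(W) + 1 + (ℓ - 1)/4 > d(W) + 1`. -/
theorem minDistinctEigen_whirl_three (ℓ : ℕ) (hℓ : 2 ≤ ℓ) :
    (whirl 3 ℓ).diam = 2 * ℓ + 2 ∧
    (9 * ((2 * ℓ : ℚ) + 2) / 8 + 1 / 2 ≤ (minDistinctEigen (whirl 3 ℓ) : ℚ)) ∧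
    9 * ((2 * ℓ : ℚ) + 2) / 8 + 1 / 2 = ((2 * ℓ : ℚ) + 2) + 1 + ((ℓ : ℚ) - 1) / 4 ∧
    ((2 * ℓ : ℚ) + 2) + 1 < 9 * ((2 * ℓ : ℚ) + 2) / 8 + 1 / 2 := by
  
  have hl : 0 < ℓ := by omega
  have hq : (2 : ℚ) ≤ ℓ := by exact_mod_cast hℓ
  refine ⟨WhirlAux.diam_whirl hl, ?_, by ring, by linarith⟩
  have h := WhirlAux.q_bound hl
  have h' : (9 * ℓ + 11 : ℚ) ≤ 4 * (minDistinctEigen (whirl 3 ℓ) : ℚ) := by exact_mod_cast h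
  linarith
end

section
/- Let W be a generalized k-whirl (k ≥ 2) in which each of the 2k legs has at least one vertex. Then the path cover number of W is p(W) = k + 1. -/
open SimpleGraph

abbrev GWV (k : ℕ) (L : Fin k × Fin 2 → ℕ) := Unit ⊕ Fin k ⊕ ((p : Fin k × Fin 2) × Fin (L p))

/-- branch index of a vertex -/
def gwCls (k : ℕ) (L : Fin k × Fin 2 → ℕ) : GWV k L → Fin (k+1)
  | Sum.inl _ => 0
  | Sum.inr (Sum.inl i) => i.succ
  | Sum.inr (Sum.inr q) => q.1.1.succ

/-- weight -/
def gwC (k : ℕ) (L : Fin k × Fin 2 → ℕ) : GWV k L → ℤ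
  | Sum.inl _ => 1
  | Sum.inr (Sum.inl _) => -1
  | Sum.inr (Sum.inr q) => if (q.2 : ℕ) = 0 then 1 else 0

def gwG (k : ℕ) (L : Fin k × Fin 2 → ℕ) : GWV k L → ℤ
  | Sum.inr (Sum.inl _) => 0
  | _ => 1

lemma gw_stay (k : ℕ) (L : Fin k × Fin 2 → ℕ) (p : Fin k × Fin 2) {u v : GWV k L}
    (w : (genWhirl k L).Walk u v) :
    ∀ m : Fin (L p), u = Sum.inr (Sum.inr ⟨p, m⟩) →
    (∀ z : Fin (L p), (z : ℕ) = 0 → (Sum.inr (Sum.inr ⟨p, z⟩) : GWV k L) ∉ w.support) →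
    (w.support.map (gwC k L)).sum = 0 := by
  induction w with
  | nil =>
    rintro m rfl h
    have h1 : (m : ℕ) ≠ 0 := fun h0 => h m h0 (by simp)
    simp [gwC, h1]
  | cons hadj w ih =>
    rename_i a b c
    rintro m rfl h
    have h1 : (m : ℕ) ≠ 0 := fun h0 => h m h0 (by simp)
    simp only [Walk.support_cons, List.map_cons, List.sum_cons]
    rcases b with _ | i | ⟨p', m'⟩
    · simp [genWhirl] at hadj
    · simp [genWhirl, h1] at hadj
    · have hp : p' = p := by
        simp [genWhirl] at hadj
        rcases hadj.2 with h | h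
        · exact h.1.symm
        · exact h.1
      subst hp
      rw [ih m' rfl (fun z hz hm => h z hz (by simp [hm]))]
      simp [gwC, h1]

lemma gw_bound (k : ℕ) (L : Fin k × Fin 2 → ℕ) {u v : GWV k L}
    (w : (genWhirl k L).Walk u v) (hw : w.IsPath) :
    (w.support.map (gwC k L)).sum ≤ gwG k L u := by
  induction w with
  | nil =>
    rename_i u
    rcases u with _ | i | ⟨p, m⟩ <;> simp [gwC, gwG]
    split_ifs <;> simp
  | cons hadj w ih =>
    rename_i a b c
    rw [Walk.cons_isPath_iff] at hw
    have ih := ih hw.1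
    simp only [Walk.support_cons, List.map_cons, List.sum_cons]
    rcases a with _ | i | ⟨p, m⟩
    · rcases b with _ | i' | ⟨p', m'⟩
      · simp [genWhirl] at hadj
      · simp only [gwC, gwG] at *; linarith
      · simp [genWhirl] at hadj
    · rcases b with _ | i' | ⟨p', m'⟩
      · simp only [gwC, gwG] at *; linarith
      · simp [genWhirl] at hadj
      · simp only [gwC, gwG] at *; linarith
    · by_cases hm : (m : ℕ) = 0
      · rcases b with _ | i' | ⟨p', m'⟩
        · simp [genWhirl] at hadj
        · simp only [gwC, gwG, hm, if_true] at *; linarith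
        · have hp : p' = p := by
            simp [genWhirl] at hadj
            rcases hadj.2 with h | h
            · exact h.1.symm
            · exact h.1
          subst hp
          rw [gw_stay k L p' w m' rfl]
          · simp [gwC, gwG, hm]
          · intro z hz hz'
            have : z = m := Fin.ext (by omega)
            subst this
            exact hw.2 hz'
      · have : gwG k L b ≤ 1 := by
          rcases b with _ | i' | ⟨p', m'⟩ <;> simp [gwG]
        simp only [gwC, gwG, hm, if_false] at *; linarith

lemma gw_total (k : ℕ) (L : Fin k × Fin 2 → ℕ) (hL : ∀ p, 1 ≤ L p) :
    ∑ v, gwC k L v = k + 1 := by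
  have h : ∀ p : Fin k × Fin 2, ∑ m : Fin (L p), (if (m : ℕ) = 0 then (1:ℤ) else 0) = 1 := by
    intro p
    rw [Finset.sum_eq_single (⟨0, hL p⟩ : Fin (L p))]
    · simp
    · intro b _ hb
      rw [if_neg]
      intro h0
      exact hb (Fin.ext h0)
    · simp
  rw [Fintype.sum_sum_type, Fintype.sum_sum_type, Fintype.sum_sigma]
  simp only [gwC, h]
  simp
  ring

lemma gw_lower (k : ℕ) (L : Fin k × Fin 2 → ℕ) (hL : ∀ p, 1 ≤ L p) (n : ℕ)
    (h : HasPathCover (genWhirl k L) n) : k + 1 ≤ n := by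
  classical
  obtain ⟨i, j, w, hp, hd, hc⟩ := h
  have hu : (Finset.univ : Finset (GWV k L)) =
      Finset.univ.biUnion (fun s : Fin n => (w s).support.toFinset) := by
    ext v; simpa using hc v
  have ht := gw_total k L hL
  rw [hu, Finset.sum_biUnion] at ht
  · have : ∀ s ∈ (Finset.univ : Finset (Fin n)),
        ∑ v ∈ (w s).support.toFinset, gwC k L v ≤ 1 := by
      intro s _
      rw [List.sum_toFinset _ (hp s).support_nodup]
      refine (gw_bound k L (w s) (hp s)).trans ?_
      generalize i s = b
      rcases b with _ | i' | ⟨p', m'⟩ <;> simp [gwG]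
    have := Finset.sum_le_sum this
    rw [ht] at this
    simp at this
    omega
  · intro s _ t _ hst
    rw [Function.onFun, Finset.disjoint_left]
    intro v hv hv'
    exact hd s t hst v (by simpa using hv) (by simpa using hv')

lemma gw_extend (k : ℕ) (L : Fin k × Fin 2 → ℕ) (p : Fin k × Fin 2) {x : GWV k L}
    (w : (genWhirl k L).Walk (Sum.inr (Sum.inl p.1)) x) (hw : w.IsPath)
    (hav : ∀ z : Fin (L p), (Sum.inr (Sum.inr ⟨p, z⟩) : GWV k L) ∉ w.support) (m : ℕ) :
    ∀ hm : m < L p, ∃ w' : (genWhirl k L).Walk (Sum.inr (Sum.inr ⟨p, ⟨m, hm⟩⟩)) x,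
      w'.IsPath ∧ ∀ v, v ∈ w'.support ↔
        (v ∈ w.support ∨ ∃ z : Fin (L p), (z : ℕ) ≤ m ∧ v = Sum.inr (Sum.inr ⟨p, z⟩)) := by
  induction m with
  | zero =>
    intro hm
    have hadj : (genWhirl k L).Adj (Sum.inr (Sum.inr ⟨p, ⟨0, hm⟩⟩)) (Sum.inr (Sum.inl p.1)) := by
      simp [genWhirl]
    refine ⟨Walk.cons hadj w, ?_, ?_⟩
    · rw [Walk.cons_isPath_iff]; exact ⟨hw, hav _⟩
    · intro v
      rw [Walk.support_cons, List.mem_cons]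
      constructor
      · rintro (h | h)
        · exact Or.inr ⟨⟨0, hm⟩, le_refl _, h⟩
        · exact Or.inl h
      · rintro (h | ⟨z, hz, h⟩)
        · exact Or.inr h
        · left
          have : z = ⟨0, hm⟩ := Fin.ext (by simpa using hz)
          rw [h, this]
  | succ m ih =>
    intro hm
    obtain ⟨w', h1, h2⟩ := ih (by omega)
    have hadj : (genWhirl k L).Adj (Sum.inr (Sum.inr ⟨p, ⟨m+1, hm⟩⟩))
        (Sum.inr (Sum.inr ⟨p, ⟨m, by omega⟩⟩)) := by
      simp [genWhirl]
    refine ⟨Walk.cons hadj w', ?_, ?_⟩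
    · rw [Walk.cons_isPath_iff]
      refine ⟨h1, ?_⟩
      rw [h2]
      rintro (h | ⟨z, hz, h⟩)
      · exact hav _ h
      · simp at h
        rw [← h] at hz
        simp at hz
    · intro v
      rw [Walk.support_cons, List.mem_cons, h2]
      constructor
      · rintro (h | h | ⟨z, hz, h⟩)
        · exact Or.inr ⟨⟨m+1, hm⟩, le_refl _, h⟩
        · exact Or.inl h
        · exact Or.inr ⟨z, by omega, h⟩
      · rintro (h | ⟨z, hz, h⟩)
        · exact Or.inr (Or.inl h)
        · by_cases hz' : (z : ℕ) ≤ m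
          · exact Or.inr (Or.inr ⟨z, hz', h⟩)
          · left
            have : z = ⟨m+1, hm⟩ := Fin.ext (by simp; omega)
            rw [h, this]

lemma gw_upper (k : ℕ) (L : Fin k × Fin 2 → ℕ) (hL : ∀ p, 1 ≤ L p) :
    HasPathCover (genWhirl k L) (k + 1) := by
  have key : ∀ s : Fin (k+1), ∃ (a b : GWV k L) (w : (genWhirl k L).Walk a b),
      w.IsPath ∧ ∀ v, v ∈ w.support ↔ gwCls k L v = s := by
    intro s
    refine Fin.cases ?_ (fun i => ?_) s
    · refine ⟨Sum.inl (), Sum.inl (), Walk.nil, by simp, ?_⟩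
      rintro (_ | i' | ⟨p', m'⟩) <;> simp [gwCls]
    · have h0 := hL (i, 0)
      have h1 := hL (i, 1)
      obtain ⟨w, hw, hs⟩ := gw_extend k L (i, 0) (x := Sum.inr (Sum.inl i)) Walk.nil (by simp)
        (by simp) (L (i, 0) - 1) (by omega)
      obtain ⟨w', hw', hs'⟩ := gw_extend k L (i, 1) w.reverse hw.reverse
        (by
          intro z
          rw [Walk.support_reverse, List.mem_reverse, hs]
          simp) (L (i, 1) - 1) (by omega)
      refine ⟨_, _, w', hw', ?_⟩
      intro v
      rw [hs', Walk.support_reverse, List.mem_reverse, hs]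
      rcases v with _ | i' | ⟨⟨i', t⟩, m'⟩
      · simp [gwCls]
        exact (Fin.succ_ne_zero i).symm
      · simp [gwCls]
      · simp only [gwCls, Fin.succ_inj]
        constructor
        · rintro ((h | ⟨z, hz, h⟩) | ⟨z, hz, h⟩)
          · simp at h
          · simp at h; exact h.1.1
          · simp at h; exact h.1.1
        · rintro rfl
          have hm := m'.2
          match t, m', hm with
          | 0, m', hm => exact Or.inl (Or.inr ⟨m', by omega, rfl⟩)
          | 1, m', hm => exact Or.inr ⟨m', by omega, rfl⟩
  choose a b w hp hs using key
  refine ⟨a, b, w, hp, ?_, ?_⟩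
  · intro s t hst v hv hv'
    rw [hs] at hv hv'
    exact hst (hv.symm.trans hv')
  · intro v
    exact ⟨gwCls k L v, (hs _ v).2 rfl⟩

/-- The path cover number of a generalized `k`-whirl (`k ≥ 2`, all `2k` legs nonempty) is
`k + 1`. -/
theorem pathCoverNumber_genWhirl (k : ℕ) (hk : 2 ≤ k)
    (L : Fin k × Fin 2 → ℕ) (hL : ∀ p, 1 ≤ L p) :
    pathCoverNumber (genWhirl k L) = k + 1 := by
  apply le_antisymm
  · exact Nat.sInf_le (gw_upper k L hL)
  · exact le_csInf ⟨_, gw_upper k L hL⟩ (fun n hn => gw_lower k L hL n hn)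
end

section
/- Let W be a generalized k-whirl (k ≥ 2) on n vertices in which each of the 2k legs has at least one vertex, and let A be a real symmetric matrix with graph W. Then no eigenvalue of A has algebraic multiplicity k + 2 or more, and at most one eigenvalue of A has algebraic multiplicity exactly k + 1. -/
open Polynomial Matrix

section Helpers

/-- vertex type -/
abbrev WV (k : ℕ) (L : Fin k × Fin 2 → ℕ) := Unit ⊕ Fin k ⊕ ((p : Fin k × Fin 2) × Fin (L p))

lemma mult_eq_finrank {V : Type*} [Fintype V] [DecidableEq V] (A : Matrix V V ℝ) (hA : A.IsSymm)
    (lam : ℝ) : A.charpoly.rootMultiplicity lam =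
      Module.finrank ℝ (Module.End.eigenspace (Matrix.toEuclideanLin A) lam) := by
  have hs : (Matrix.toEuclideanLin A).IsSymmetric := by
    rw [Matrix.isSymmetric_toEuclideanLin_iff, Matrix.IsHermitian, Matrix.conjTranspose_eq_transpose_of_trivial]
    exact hA
  have hc : (Matrix.toEuclideanLin A).charpoly = A.charpoly := by
    rw [Matrix.toEuclideanLin_eq_toLin, Matrix.charpoly_toLin]
  rw [← hs.isFinitelySemisimple.maxGenEigenspace_eq_eigenspace,
    LinearMap.finrank_maxGenEigenspace_eq, hc]

lemma entry_ne {V : Type*} {A : Matrix V V ℝ} (hA : A.IsSymm) {a b : V} (h : (graphOf A).Adj a b) :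
    A a b ≠ 0 := by
  simp only [graphOf, SimpleGraph.fromRel_adj] at h
  rcases h.2 with h | h
  · exact h
  · rwa [← hA.apply a b]

lemma entry_eq {V : Type*} {A : Matrix V V ℝ} {a b : V} (hab : a ≠ b)
    (h : ¬ (graphOf A).Adj a b) : A a b = 0 := by
  by_contra h'
  exact h (by simp only [graphOf, SimpleGraph.fromRel_adj]; exact ⟨hab, Or.inl h'⟩)

lemma force {V : Type*} [Fintype V] [DecidableEq V] {A : Matrix V V ℝ} (hA : A.IsSymm)
    {x : V → ℝ} {lam : ℝ} (hx : A *ᵥ x = lam • x) {a c : V} (ha : x a = 0)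
    (hac : (graphOf A).Adj a c)
    (h : ∀ b, (graphOf A).Adj a b → b ≠ c → x b = 0) : x c = 0 := by
  have h1 := congrFun hx a
  simp only [Matrix.mulVec, dotProduct, Pi.smul_apply, ha, smul_zero] at h1
  rw [Finset.sum_eq_single c] at h1
  · exact (mul_eq_zero.mp h1).resolve_left (entry_ne hA hac)
  · intro b _ hb
    by_cases hab : a = b
    · rw [← hab, ha, mul_zero]
    · by_cases hadj : (graphOf A).Adj a b
      · rw [h b hadj hb, mul_zero]
      · rw [entry_eq hab hadj, zero_mul]
  · simp

variable {k : ℕ} {L : Fin k × Fin 2 → ℕ}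

lemma adj_axis (b : WV k L) : (genWhirl k L).Adj (Sum.inl ()) b ↔ ∃ i, b = Sum.inr (Sum.inl i) := by
  rcases b with b | b | b <;> simp [genWhirl]

lemma adj_mid (i : Fin k) (b : WV k L) : (genWhirl k L).Adj (Sum.inr (Sum.inl i)) b ↔
    b = Sum.inl () ∨ ∃ (j : Fin 2) (h : 0 < L (i, j)), b = Sum.inr (Sum.inr ⟨(i, j), ⟨0, h⟩⟩) := by
  rcases b with b | b | ⟨⟨i', j⟩, ⟨m, hm⟩⟩
  · simp [genWhirl]
  · simp [genWhirl]
  · simp only [genWhirl, SimpleGraph.fromRel_adj]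
    constructor
    · rintro ⟨_, h | h⟩
      · obtain ⟨h1, h2⟩ := h
        subst h1 h2
        exact Or.inr ⟨j, hm, rfl⟩
      · exact h.elim
    · rintro (h | ⟨j', h, e⟩)
      · cases h
      · simp only [Sum.inr.injEq, Sigma.mk.injEq, Prod.mk.injEq] at e
        obtain ⟨⟨rfl, rfl⟩, e⟩ := e
        cases eq_of_heq e
        simp

lemma adj_leg (p : Fin k × Fin 2) (m : ℕ) (hm : m < L p) (b : WV k L) :
    (genWhirl k L).Adj (Sum.inr (Sum.inr ⟨p, ⟨m, hm⟩⟩)) b ↔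
    (m = 0 ∧ b = Sum.inr (Sum.inl p.1)) ∨
    (∃ (m' : ℕ) (h : m' < L p), (m + 1 = m' ∨ m' + 1 = m) ∧ b = Sum.inr (Sum.inr ⟨p, ⟨m', h⟩⟩)) := by
  rcases b with b | b | ⟨p', ⟨m', hm'⟩⟩
  · simp [genWhirl]
  · simp [genWhirl]
    tauto
  · simp only [genWhirl, SimpleGraph.fromRel_adj]
    constructor
    · rintro ⟨_, h | h⟩ <;>
      · obtain ⟨h1, h2⟩ := h
        subst h1
        exact Or.inr ⟨m', hm', by omega, rfl⟩
    · rintro (h | ⟨m'', h, hmm, e⟩)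
      · cases h.2
      · simp only [Sum.inr.injEq, Sigma.mk.injEq] at e
        obtain ⟨rfl, e⟩ := e
        cases eq_of_heq e
        refine ⟨?_, ?_⟩
        · simp; omega
        · simpa using hmm

section
variable {A : Matrix (WV k L) (WV k L) ℝ} (hA : A.IsSymm) (hG : graphOf A = genWhirl k L)
  {x : WV k L → ℝ} {lam : ℝ} (hx : A *ᵥ x = lam • x)
include hA hG hx

lemma leg_back (p : Fin k × Fin 2) (hL : 1 ≤ L p)
    (htip : x (Sum.inr (Sum.inr ⟨p, ⟨L p - 1, by omega⟩⟩)) = 0) :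
    ∀ n m (hm : m < L p), L p ≤ m + 1 + n → x (Sum.inr (Sum.inr ⟨p, ⟨m, hm⟩⟩)) = 0 := by
  intro n
  induction n with
  | zero =>
    intro m hm h
    have : m = L p - 1 := by omega
    subst this
    exact htip
  | succ n ih =>
    intro m hm h
    by_cases h2 : L p ≤ m + 1 + n
    · exact ih m hm h2
    · refine force hA hx (a := Sum.inr (Sum.inr ⟨p, ⟨m + 1, by omega⟩⟩)) (ih _ _ (by omega)) ?_ ?_
      · rw [hG, adj_leg]
        exact Or.inr ⟨m, hm, by omega, rfl⟩
      · intro b hb hne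
        rw [hG, adj_leg] at hb
        rcases hb with ⟨h0, _⟩ | ⟨m', h', hm', rfl⟩
        · omega
        · rcases hm' with hm' | hm'
          · exact ih _ _ (by omega)
          · have : m' = m := by omega
            subst this
            exact absurd rfl hne

lemma mid_zero (p : Fin k × Fin 2) (hL : 1 ≤ L p)
    (htip : x (Sum.inr (Sum.inr ⟨p, ⟨L p - 1, by omega⟩⟩)) = 0) :
    x (Sum.inr (Sum.inl p.1)) = 0 := by
  have hb := leg_back hA hG hx p hL htip
  refine force hA hx (a := Sum.inr (Sum.inr ⟨p, ⟨0, by omega⟩⟩)) (hb (L p) _ _ (by omega)) ?_ ?_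
  · rw [hG, adj_leg]; exact Or.inl ⟨rfl, rfl⟩
  · intro b h hne
    rw [hG, adj_leg] at h
    rcases h with ⟨_, h⟩ | ⟨m', h', hm', rfl⟩
    · exact absurd h hne
    · exact hb (L p) _ _ (by omega)

lemma leg_fwd (p : Fin k × Fin 2) (hmid : x (Sum.inr (Sum.inl p.1)) = 0)
    (h0 : ∀ h : 0 < L p, x (Sum.inr (Sum.inr ⟨p, ⟨0, h⟩⟩)) = 0) :
    ∀ m (hm : m < L p), x (Sum.inr (Sum.inr ⟨p, ⟨m, hm⟩⟩)) = 0 := by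
  intro m
  induction m using Nat.strong_induction_on with
  | _ m ih =>
  intro hm
  rcases m with _ | m
  · exact h0 hm
  · refine force hA hx (a := Sum.inr (Sum.inr ⟨p, ⟨m, by omega⟩⟩)) (ih _ (by omega) _) ?_ ?_
    · rw [hG, adj_leg]
      exact Or.inr ⟨m + 1, hm, by omega, rfl⟩
    · intro b hb hne
      rw [hG, adj_leg] at hb
      rcases hb with ⟨_, rfl⟩ | ⟨m', h', hm', rfl⟩
      · exact hmid
      · rcases hm' with hm' | hm'
        · subst hm'
          exact absurd rfl hne
        · exact ih _ (by omega) _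

lemma all_zero (hL : ∀ p, 1 ≤ L p) (hax : x (Sum.inl ()) = 0)
    (htip : ∀ i, x (Sum.inr (Sum.inr ⟨(i, 0), ⟨L (i, 0) - 1, by have := hL (i, 0); omega⟩⟩)) = 0) :
    x = 0 := by
  have hmid : ∀ i, x (Sum.inr (Sum.inl i)) = 0 := fun i =>
    mid_zero hA hG hx (i, 0) (hL _) (htip i)
  have hl0 : ∀ i m (hm : m < L (i, 0)), x (Sum.inr (Sum.inr ⟨(i, 0), ⟨m, hm⟩⟩)) = 0 :=
    fun i m hm => leg_back hA hG hx (i, 0) (hL _) (htip i) (L (i, 0)) m hm (by omega)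
  have hl1 : ∀ i m (hm : m < L (i, 1)), x (Sum.inr (Sum.inr ⟨(i, 1), ⟨m, hm⟩⟩)) = 0 := by
    intro i
    refine leg_fwd hA hG hx (i, 1) (hmid i) ?_
    intro h
    refine force hA hx (a := Sum.inr (Sum.inl i)) (hmid i) ?_ ?_
    · rw [hG, adj_mid]
      exact Or.inr ⟨1, h, rfl⟩
    · intro b hb hne
      rw [hG, adj_mid] at hb
      rcases hb with rfl | ⟨j, hj, rfl⟩
      · exact hax
      · fin_cases j
        · exact hl0 i 0 hj
        · exact absurd rfl hne
  funext b
  rcases b with ⟨⟩ | i | ⟨⟨i, j⟩, ⟨m, hm⟩⟩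
  · exact hax
  · exact hmid i
  · fin_cases j
    · exact hl0 i m hm
    · exact hl1 i m hm

lemma lam_eq (hL : ∀ p, 1 ≤ L p) (hax : x (Sum.inl ()) = 1)
    (htip : ∀ i, x (Sum.inr (Sum.inr ⟨(i, 0), ⟨L (i, 0) - 1, by have := hL (i, 0); omega⟩⟩)) = 0) :
    lam = A (Sum.inl ()) (Sum.inl ()) := by
  have hmid : ∀ i, x (Sum.inr (Sum.inl i)) = 0 := fun i =>
    mid_zero hA hG hx (i, 0) (hL _) (htip i)
  have h1 := congrFun hx (Sum.inl ())
  simp only [Matrix.mulVec, dotProduct, Pi.smul_apply, hax, smul_eq_mul, mul_one] at h1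
  rw [← h1, Finset.sum_eq_single (Sum.inl ()), hax, mul_one]
  · intro b _ hb
    by_cases hadj : (graphOf A).Adj (Sum.inl ()) b
    · rw [hG, adj_axis] at hadj
      obtain ⟨i, rfl⟩ := hadj
      rw [hmid, mul_zero]
    · rw [entry_eq hb.symm hadj, zero_mul]
  · simp
end

/-- evaluation at the forcing set -/
noncomputable def evalMap (hL : ∀ p, 1 ≤ L p) :
    EuclideanSpace ℝ (WV k L) →ₗ[ℝ] (Option (Fin k) → ℝ) where
  toFun x o := match o with
    | none => x (Sum.inl ())
    | some i => x (Sum.inr (Sum.inr ⟨(i, 0), ⟨L (i, 0) - 1, by have := hL (i, 0); omega⟩⟩))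
  map_add' x y := by funext o; cases o <;> simp
  map_smul' c x := by funext o; cases o <;> simp

lemma mem_eig {V : Type*} [Fintype V] [DecidableEq V] {A : Matrix V V ℝ} {lam : ℝ}
    {x : EuclideanSpace ℝ V} (hx : x ∈ Module.End.eigenspace (Matrix.toEuclideanLin A) lam) :
    A *ᵥ (x : V → ℝ) = lam • (x : V → ℝ) := by
  rw [Module.End.mem_eigenspace_iff] at hx
  funext i
  simpa [Matrix.toLpLin_apply] using congrArg (fun y : EuclideanSpace ℝ V => y i) hx

lemma main_aux (hL : ∀ p, 1 ≤ L p) {A : Matrix (WV k L) (WV k L) ℝ} (hA : A.IsSymm)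
    (hG : graphOf A = genWhirl k L) (lam : ℝ) :
    A.charpoly.rootMultiplicity lam ≤ k + 1 ∧
    (A.charpoly.rootMultiplicity lam = k + 1 → lam = A (Sum.inl ()) (Sum.inl ())) := by
  rw [mult_eq_finrank A hA]
  set S := Module.End.eigenspace (Matrix.toEuclideanLin A) lam
  let Φ := (evalMap hL).comp S.subtype
  have hinj : Function.Injective Φ := by
    rw [← LinearMap.ker_eq_bot, LinearMap.ker_eq_bot']
    rintro ⟨x, hxS⟩ h
    have h0 := all_zero hA hG (mem_eig hxS) hL (congrFun h none) (fun i => congrFun h (some i))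
    ext b
    exact congrFun h0 b
  have hcard : Module.finrank ℝ (Option (Fin k) → ℝ) = k + 1 := by simp
  refine ⟨hcard ▸ LinearMap.finrank_le_finrank_of_injective hinj, fun h => ?_⟩
  have hsurj : Function.Surjective Φ :=
    (LinearMap.injective_iff_surjective_of_finrank_eq_finrank (h.trans hcard.symm)).mp hinj
  obtain ⟨⟨x, hxS⟩, hx⟩ := hsurj (fun o => if o = none then 1 else 0)
  refine lam_eq hA hG (mem_eig hxS) hL ?_ (fun i => ?_)
  · exact (congrFun hx none).trans (by simp)
  · exact (congrFun hx (some i)).trans (by simp)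

end Helpers

/-- Let `W` be a generalized `k`-whirl (`k ≥ 2`, all `2k` legs nonempty) and `A` a real
symmetric matrix with graph `W`.  Then no eigenvalue of `A` has algebraic multiplicity
`k + 2` or more, and at most one eigenvalue of `A` has algebraic multiplicity exactly
`k + 1`. -/
theorem genWhirl_multiplicity_bounds (k : ℕ) (hk : 2 ≤ k)
    (L : Fin k × Fin 2 → ℕ) (hL : ∀ p, 1 ≤ L p)
    (A : Matrix (Unit ⊕ Fin k ⊕ ((p : Fin k × Fin 2) × Fin (L p)))
                (Unit ⊕ Fin k ⊕ ((p : Fin k × Fin 2) × Fin (L p))) ℝ)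
    (hA : A.IsSymm) (hG : graphOf A = genWhirl k L) :
    (∀ lam : ℝ, A.charpoly.rootMultiplicity lam ≤ k + 1) ∧
    (A.charpoly.roots.toFinset.filter
        (fun lam => A.charpoly.rootMultiplicity lam = k + 1)).card ≤ 1 := by
  refine ⟨fun lam => (main_aux hL hA hG lam).1, ?_⟩
  rw [Finset.card_le_one]
  intro a ha b hb
  rw [Finset.mem_filter] at ha hb
  rw [(main_aux hL hA hG a).2 ha.2, (main_aux hL hA hG b).2 hb.2]
end
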